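/- Let u_ε be least energy solutions of the nearly critical Hartree equation and v_ε the rescaled solutions (extended by 0 outside Ω_ε). There exists a constant c > 0, independent of ε, such that v_ε(x) ≤ c W(x) for all x ∈ ℝⁿ, where W(x) = W[0,1](x) = c̃_{n,n−2}(1+|x|²)^{−(n−2)/2} is the standard bubble. -/

import Mathlib

open MeasureTheory Real Filter Topology Metric Bornology RealInnerProductSpace

noncomputable section

abbrev Eu (n : ℕ) := EuclideanSpace ℝ (Fin n)

/-- The Laplacian of a function `f : ℝⁿ → ℝ`. -/
noncomputable def lapl {n : ℕ} (f : Eu n → ℝ) (x : Eu n) : ℝ :=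
  ∑ i : Fin n, fderiv ℝ (fun y => fderiv ℝ f y (EuclideanSpace.single i 1)) x
    (EuclideanSpace.single i 1)

/-- Convolution with the kernel `|x|^(-k)`, integrating over the set `S`. -/
noncomputable def rzk {n : ℕ} (S : Set (Eu n)) (k : ℝ) (f : Eu n → ℝ) (x : Eu n) : ℝ :=
  ∫ z in S, f z / ‖x - z‖ ^ k

/-- Convolution with the Riesz kernel `|x|^(-(n-2))` over `S`. -/
noncomputable def rz {n : ℕ} (S : Set (Eu n)) (f : Eu n → ℝ) (x : Eu n) : ℝ :=
  rzk S ((n : ℝ) - 2) f x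

/-- The critical exponent `p = (n+2)/(n-2)`. -/
noncomputable def pcrit (n : ℕ) : ℝ := ((n : ℝ) + 2) / ((n : ℝ) - 2)

/-- `u` is a positive solution of the nearly critical Hartree equation
`-Δu = (|x|^{-(n-2)} ∗ u^{p-ε}) u^{p-1-ε}` in `Ω`, `u > 0` in `Ω`, `u = 0` on `∂Ω`
(extended by zero outside `Ω`). -/
def IsSol {n : ℕ} (Ω : Set (Eu n)) (ε : ℝ) (u : Eu n → ℝ) : Prop :=
  ContDiffOn ℝ 2 u Ω ∧ ContinuousOn u (closure Ω) ∧
  (∀ x ∈ Ω, - lapl u x =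
      rz Ω (fun z => u z ^ (pcrit n - ε)) x * u x ^ (pcrit n - 1 - ε)) ∧
  (∀ x ∈ Ω, 0 < u x) ∧ (∀ x ∈ Ωᶜ, u x = 0)

/-- The Hartree Rayleigh quotient with exponent `q`. -/
noncomputable def enRatio {n : ℕ} (Ω : Set (Eu n)) (q : ℝ) (u : Eu n → ℝ) : ℝ :=
  (∫ x in Ω, ‖gradient u x‖ ^ 2) /
    (∫ x in Ω, rz Ω (fun z => |u z| ^ q) x * |u x| ^ q) ^ (1 / q)

/-- The best constant in the Hardy–Littlewood–Sobolev–Sobolev inequality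
`C_HLS (∫∫ |u|^p |u|^p / |x-z|^{n-2})^{1/p} ≤ ∫ |∇u|²`. -/
noncomputable def CHLS (n : ℕ) : ℝ :=
  sInf { c : ℝ | ∃ u : Eu n → ℝ, ContDiff ℝ (⊤ : ℕ∞) u ∧ HasCompactSupport u ∧ u ≠ 0 ∧
    c = (∫ x, ‖gradient u x‖ ^ 2) /
      (∫ x, rz Set.univ (fun z => |u z| ^ pcrit n) x * |u x| ^ pcrit n) ^ (1 / pcrit n) }

/-- The sup norm of `u` over the closure of `Ω`. -/
noncomputable def supN {n : ℕ} (Ω : Set (Eu n)) (u : Eu n → ℝ) : ℝ :=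
  sSup ((fun x => |u x|) '' closure Ω)

/-- The area of the unit sphere in `ℝⁿ`. -/
noncomputable def ωn (n : ℕ) : ℝ := 2 * π ^ ((n : ℝ) / 2) / Real.Gamma ((n : ℝ) / 2)

/-- A family of least energy solutions of the nearly critical Hartree equation. -/
def LeastEnergyFamily {n : ℕ} (Ω : Set (Eu n)) (ε₀ : ℝ) (u : ℝ → Eu n → ℝ) : Prop :=
  (∀ ε ∈ Set.Ioo (0:ℝ) ε₀, IsSol Ω ε (u ε)) ∧
  Tendsto (fun ε => enRatio Ω (pcrit n - ε) (u ε)) (𝓝[>] (0:ℝ)) (𝓝 (CHLS n))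

/-- The best Sobolev constant in `ℝⁿ`. -/
noncomputable def Sbest (n : ℕ) : ℝ :=
  sInf { c : ℝ | ∃ u : Eu n → ℝ, ContDiff ℝ (⊤ : ℕ∞) u ∧ HasCompactSupport u ∧ u ≠ 0 ∧
    c = (∫ x, ‖gradient u x‖ ^ 2) /
      (∫ x, |u x| ^ (2 * (n : ℝ) / ((n : ℝ) - 2))) ^ (((n : ℝ) - 2) / (n : ℝ)) }

/-- The explicit constant `α̃_n` of Theorem 1.2. -/
noncomputable def alphaTilde (n : ℕ) : ℝ :=
  ((n : ℝ) * ((n : ℝ) - 2) / Real.sqrt (Sbest n)) ^ (((n : ℝ) - 2) / 4) *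
    (π ^ ((n : ℝ) / 2) * Real.Gamma 1 / Real.Gamma (((n : ℝ) + 2) / 2)) *
    (Real.Gamma 1 * π ^ (((n : ℝ) - 2) / 2) / Real.Gamma (((n : ℝ) + 2) / 2) *
        (Real.Gamma (n : ℝ) / Real.Gamma ((n : ℝ) / 2)) ^ ((2 : ℝ) / (n : ℝ))) ^
      ((2 - (n : ℝ)) / 8)

/-- The sharp HLS constant `C_{n,μ}`. -/
noncomputable def Cnmu (n : ℕ) (μ : ℝ) : ℝ :=
  Real.Gamma (((n : ℝ) - μ) / 2) * π ^ (μ / 2) / Real.Gamma ((n : ℝ) - μ / 2) *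
    (Real.Gamma (n : ℝ) / Real.Gamma ((n : ℝ) / 2)) ^ (1 - μ / (n : ℝ))

/-- The bubble normalisation constant `c̃_{n,μ}`. -/
noncomputable def ctilde (n : ℕ) (μ : ℝ) : ℝ :=
  ((n : ℝ) * ((n : ℝ) - 2)) ^ (((n : ℝ) - 2) / 4) *
    Sbest n ^ ((((n : ℝ) - μ) * (2 - (n : ℝ))) / (4 * ((n : ℝ) - μ + 2))) *
    Cnmu n μ ^ ((2 - (n : ℝ)) / (2 * ((n : ℝ) - μ + 2)))

/-- The standard bubble `W[ξ,λ]`. -/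
noncomputable def Wb (n : ℕ) (μ : ℝ) (ξ : Eu n) (l : ℝ) (x : Eu n) : ℝ :=
  ctilde n μ * (l / (1 + l ^ 2 * ‖x - ξ‖ ^ 2)) ^ (((n : ℝ) - 2) / 2)

/-- The standard bubble `W = W[0,1]` with `μ = n-2`. -/
noncomputable def W0 (n : ℕ) : Eu n → ℝ := Wb n ((n : ℝ) - 2) 0 1

/-- `C^{1,α}`-type norm of `f` on a set `s`. -/
noncomputable def c1aNorm {n : ℕ} (a : ℝ) (s : Set (Eu n)) (f : Eu n → ℝ) : ℝ :=
  (⨆ x ∈ s, |f x|) + (⨆ x ∈ s, ‖gradient f x‖) +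
    ⨆ x ∈ s, ⨆ y ∈ s, ‖gradient f x - gradient f y‖ / ‖x - y‖ ^ a

section aux
variable {n : ℕ}
local notation "oR" => ENNReal.ofReal
lemma fr_Eu (n : ℕ) : Module.finrank ℝ (Eu n) = n := by simp
lemma integrableOn_pow_in (hn : 3 ≤ n) {σ : ℝ} (h : σ < n) (R : ℝ) :
    IntegrableOn (fun z : Eu n => ‖z‖ ^ (-σ)) (ball 0 R) := by
  refine integrableOn_ball_of_norm_le_rpow (C := 1) (α := σ) ?_ ?_ ?_ ?_
  · rw [fr_Eu]; omega
  · rw [fr_Eu]; exact h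
  · refine Eventually.of_forall fun x => ?_
    rw [Real.norm_of_nonneg (by positivity)]; simp
  · exact (by fun_prop : Measurable fun z : Eu n => ‖z‖ ^ (-σ)).aestronglyMeasurable
lemma integrableOn_pow_out (hn : 3 ≤ n) {σ : ℝ} (h : (n:ℝ) < σ) {R : ℝ} (hR : 0 < R) :
    IntegrableOn (fun z : Eu n => ‖z‖ ^ (-σ)) (ball 0 R)ᶜ := by
  have h1 : Integrable (fun z : Eu n => ((1 + R⁻¹) ^ σ) * (1 + ‖z‖) ^ (-σ)) :=
    (integrable_one_add_norm (by rw [fr_Eu]; exact h)).const_mul _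
  refine Integrable.mono' h1.integrableOn ?_ ?_
  · exact (by fun_prop : Measurable fun z : Eu n => ‖z‖ ^ (-σ)).aestronglyMeasurable
  · refine (ae_restrict_iff' measurableSet_ball.compl).2 (Eventually.of_forall fun z hz => ?_)
    have hz' : R ≤ ‖z‖ := by simpa using hz
    have hz0 : 0 < ‖z‖ := hR.trans_le hz'
    have hs : 0 ≤ σ := le_trans (by positivity) h.le
    rw [Real.norm_of_nonneg (by positivity), rpow_neg (by positivity),
      rpow_neg (by positivity), ← Real.inv_rpow (by positivity),
      ← Real.inv_rpow (by positivity), ← Real.mul_rpow (by positivity) (by positivity)]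
    refine rpow_le_rpow (by positivity) ?_ hs
    rw [← div_eq_mul_inv, le_div_iff₀ (by positivity), inv_mul_eq_div, div_le_iff₀ hz0]
    have : 1 ≤ R⁻¹ * ‖z‖ := by rw [inv_mul_eq_div, le_div_iff₀ hR]; linarith
    nlinarith
lemma exists_lint_in (hn : 3 ≤ n) {σ : ℝ} (h : σ < n) :
    ∃ C > 0, ∀ R > (0:ℝ), ∀ x : Eu n,
      ∫⁻ z in ball x R, oR (‖x - z‖ ^ (-σ)) ≤ oR (C * R ^ ((n:ℝ) - σ)) := by
  refine ⟨(∫ z in ball (0:Eu n) 1, ‖z‖ ^ (-σ)) + 1,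
    by have : 0 ≤ ∫ z in ball (0:Eu n) 1, ‖z‖ ^ (-σ) := integral_nonneg fun z => by positivity
       linarith, fun R hR x => ?_⟩
  have e1 : ∫⁻ z in ball x R, oR (‖x - z‖ ^ (-σ))
      = ∫⁻ z in ball (0:Eu n) R, oR (‖z‖ ^ (-σ)) := by
    rw [← lintegral_indicator measurableSet_ball, ← lintegral_indicator measurableSet_ball]
    rw [← lintegral_sub_left_eq_self _ x]
    congr 1; ext z
    simp [Set.indicator, dist_eq_norm]
  rw [e1, ← ofReal_integral_eq_lintegral_ofReal (integrableOn_pow_in hn h R)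
    (Eventually.of_forall fun z => by positivity)]
  refine ENNReal.ofReal_le_ofReal ?_
  have e2 := Measure.setIntegral_comp_smul_of_pos (volume : Measure (Eu n))
    (fun z : Eu n => ‖z‖ ^ (-σ)) (ball 0 1) hR
  rw [fr_Eu, smul_unitBall hR.ne', Real.norm_of_nonneg hR.le] at e2
  have e3 : ∀ z : Eu n, ‖R • z‖ ^ (-σ) = R ^ (-σ) * ‖z‖ ^ (-σ) := fun z => by
    rw [norm_smul, Real.norm_of_nonneg hR.le, Real.mul_rpow hR.le (norm_nonneg _)]
  simp only [e3, integral_const_mul] at e2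
  have e4 : ∫ z in ball (0:Eu n) R, ‖z‖ ^ (-σ) =
      R ^ ((n:ℝ) - σ) * ∫ z in ball (0:Eu n) 1, ‖z‖ ^ (-σ) := by
    rw [sub_eq_add_neg, rpow_add hR, rpow_natCast, mul_assoc, e2, smul_eq_mul,
      mul_inv_cancel_left₀ (by positivity)]
  rw [e4, mul_comm]
  gcongr
  linarith
open scoped Pointwise in
lemma exists_lint_out (hn : 3 ≤ n) {σ : ℝ} (h : (n:ℝ) < σ) :
    ∃ C > 0, ∀ R > (0:ℝ), ∀ x : Eu n,
      ∫⁻ z in (ball x R)ᶜ, oR (‖x - z‖ ^ (-σ)) ≤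
        oR (C * R ^ ((n:ℝ) - σ)) := by
  refine ⟨(∫ z in (ball (0:Eu n) 1)ᶜ, ‖z‖ ^ (-σ)) + 1,
    by have : 0 ≤ ∫ z in (ball (0:Eu n) 1)ᶜ, ‖z‖ ^ (-σ) := integral_nonneg fun z => by positivity
       linarith, fun R hR x => ?_⟩
  have e1 : ∫⁻ z in (ball x R)ᶜ, oR (‖x - z‖ ^ (-σ))
      = ∫⁻ z in (ball (0:Eu n) R)ᶜ, oR (‖z‖ ^ (-σ)) := by
    rw [← lintegral_indicator measurableSet_ball.compl,
      ← lintegral_indicator measurableSet_ball.compl]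
    rw [← lintegral_sub_left_eq_self _ x]
    congr 1; ext z
    simp [Set.indicator, dist_eq_norm]
  rw [e1, ← ofReal_integral_eq_lintegral_ofReal (integrableOn_pow_out hn h hR)
    (Eventually.of_forall fun z => by positivity)]
  refine ENNReal.ofReal_le_ofReal ?_
  have e2 := Measure.setIntegral_comp_smul_of_pos (volume : Measure (Eu n))
    (fun z : Eu n => ‖z‖ ^ (-σ)) (ball 0 1)ᶜ hR
  have e0 : R • (ball (0:Eu n) 1)ᶜ = (ball (0:Eu n) R)ᶜ := by
    ext z
    rw [Set.mem_smul_set_iff_inv_smul_mem₀ hR.ne']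
    simp only [Set.mem_compl_iff, mem_ball_zero_iff, norm_smul, norm_inv,
      Real.norm_of_nonneg hR.le, not_lt]
    rw [inv_mul_eq_div, le_div_iff₀ hR, one_mul]
  rw [fr_Eu, e0] at e2
  have e3 : ∀ z : Eu n, ‖R • z‖ ^ (-σ) = R ^ (-σ) * ‖z‖ ^ (-σ) := fun z => by
    rw [norm_smul, Real.norm_of_nonneg hR.le, Real.mul_rpow hR.le (norm_nonneg _)]
  simp only [e3, integral_const_mul] at e2
  have e4 : ∫ z in (ball (0:Eu n) R)ᶜ, ‖z‖ ^ (-σ) =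
      R ^ ((n:ℝ) - σ) * ∫ z in (ball (0:Eu n) 1)ᶜ, ‖z‖ ^ (-σ) := by
    rw [sub_eq_add_neg, rpow_add hR, rpow_natCast, mul_assoc, e2, smul_eq_mul,
      mul_inv_cancel_left₀ (by positivity)]
  rw [e4, mul_comm]
  gcongr
  linarith
/-- Newtonian-type potential. -/
def NN (f : Eu n → ENNReal) (x : Eu n) : ENNReal :=
  ∫⁻ z, f z * oR (‖x - z‖ ^ (-((n:ℝ) - 2)))
/-- The Sobolev exponent. -/
def sob (n : ℕ) : ℝ := pcrit n + 1
lemma al_pos (hn : 3 ≤ n) : (0:ℝ) < (n:ℝ) - 2 := by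
  have : (3:ℝ) ≤ n := by exact_mod_cast hn
  linarith
lemma al_p (hn : 3 ≤ n) : ((n:ℝ) - 2) * pcrit n = n + 2 := by
  have := al_pos hn
  unfold pcrit; field_simp
lemma p_pos (hn : 3 ≤ n) : 0 < pcrit n := by
  have := al_pos hn
  unfold pcrit; positivity
lemma p_gt (hn : 3 ≤ n) : 1 < pcrit n := by
  have h := al_pos hn
  have := al_p hn
  by_contra hc
  nlinarith
lemma sob_pos (hn : 3 ≤ n) : 0 < sob n := by
  have := p_pos hn
  unfold sob; linarith
lemma al_sob (hn : 3 ≤ n) : ((n:ℝ) - 2) * sob n = 2 * n := by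
  have := al_p hn
  unfold sob; linarith
lemma al_p1 (hn : 3 ≤ n) : ((n:ℝ) - 2) * (pcrit n - 1) = 4 := by
  have := al_p hn
  linarith
lemma young_t {p w k t : ℝ} (hp : 0 < p) (hw : 0 ≤ w) (hk : 0 ≤ k) (ht : 0 < t) :
    w ^ p * k ≤ t⁻¹ * w ^ (p + 1) + t ^ p * k ^ (p + 1) := by
  rcases le_total k (w / t) with h | h
  · have : w ^ p * k ≤ t⁻¹ * w ^ (p + 1) := by
      rw [rpow_add_one' hw (by linarith)]
      calc w ^ p * k ≤ w ^ p * (w / t) := by gcongr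
        _ = _ := by field_simp
    have h2 : 0 ≤ t ^ p * k ^ (p + 1) := by positivity
    linarith
  · have : w ^ p * k ≤ t ^ p * k ^ (p + 1) := by
      rw [rpow_add_one' hk (by linarith), ← mul_assoc, ← Real.mul_rpow ht.le hk]
      gcongr
      rw [div_le_iff₀ ht] at h; linarith
    have h2 : 0 ≤ t⁻¹ * w ^ (p + 1) := by positivity
    linarith
/-- far part of the potential -/
lemma exists_far (hn : 3 ≤ n) : ∃ C > 0, ∀ (w : Eu n → ℝ) (x : Eu n) (ρ F : ℝ),
    0 < ρ → 0 ≤ F → (∀ z, 0 ≤ w z) → Measurable w → ∫⁻ z, oR (w z ^ sob n) ≤ oR F →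
    ∫⁻ z in (ball x ρ)ᶜ, oR (w z ^ pcrit n) * oR (‖x - z‖ ^ (-((n:ℝ) - 2)))
      ≤ oR ((F + C) * ρ ^ (-(((n:ℝ) - 2) / 2))) := by
  have hα := al_pos hn
  have hp := p_pos hn
  obtain ⟨C, hC, hC'⟩ := exists_lint_out hn (σ := 2 * n) (by
    have : (3:ℝ) ≤ n := by exact_mod_cast hn
    linarith)
  refine ⟨C, hC, fun w x ρ F hρ hF hw hwm hwF => ?_⟩
  set t := ρ ^ (((n:ℝ) - 2) / 2) with ht
  have htp : 0 < t := by positivity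
  have hpt : ∀ z, oR (w z ^ pcrit n) * oR (‖x - z‖ ^ (-((n:ℝ) - 2))) ≤
      oR t⁻¹ * oR (w z ^ sob n) + oR (t ^ pcrit n) *
        oR (‖x - z‖ ^ (-(2 * (n:ℝ)))) := by
    intro z
    have h0 := hw z
    rw [← ENNReal.ofReal_mul (by positivity), ← ENNReal.ofReal_mul (by positivity),
      ← ENNReal.ofReal_mul (by positivity), ← ENNReal.ofReal_add (by positivity) (by positivity)]
    refine ENNReal.ofReal_le_ofReal ?_
    have := young_t hp h0 (k := ‖x - z‖ ^ (-((n:ℝ) - 2))) (by positivity) htp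
    rw [← rpow_mul (norm_nonneg _)] at this
    have e : -((n:ℝ) - 2) * (pcrit n + 1) = -(2 * n) := by
      have := al_sob hn; unfold sob at this; linarith
    rw [e] at this
    exact this
  calc _ ≤ ∫⁻ z in (ball x ρ)ᶜ, (oR t⁻¹ * oR (w z ^ sob n) +
        oR (t ^ pcrit n) * oR (‖x - z‖ ^ (-(2 * (n:ℝ))))) :=
        lintegral_mono hpt
    _ = (oR t⁻¹ * ∫⁻ z in (ball x ρ)ᶜ, oR (w z ^ sob n)) +
        oR (t ^ pcrit n) *
          ∫⁻ z in (ball x ρ)ᶜ, oR (‖x - z‖ ^ (-(2 * (n:ℝ)))) := by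
        rw [lintegral_add_left (by fun_prop), lintegral_const_mul _ (by fun_prop),
          lintegral_const_mul _ (by fun_prop)]
    _ ≤ oR t⁻¹ * oR F +
        oR (t ^ pcrit n) * oR (C * ρ ^ ((n:ℝ) - 2 * n)) := by
        gcongr
        · exact (setLIntegral_le_lintegral _ _).trans hwF
        · exact hC' ρ hρ x
    _ = _ := by
        rw [← ENNReal.ofReal_mul (by positivity), ← ENNReal.ofReal_mul (by positivity),
          ← ENNReal.ofReal_add (by positivity) (by positivity)]
        congr 1
        rw [ht, ← rpow_neg hρ.le, ← rpow_mul hρ.le, mul_left_comm, ← rpow_add hρ,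
          add_mul, mul_comm F]
        congr 3
        have := al_p hn
        linarith
lemma exists_NN_le (hn : 3 ≤ n) : ∃ C > 0, ∀ (w : Eu n → ℝ) (x : Eu n) (ρ F T : ℝ),
    0 < ρ → 0 ≤ F → 0 ≤ T → (∀ z, 0 ≤ w z) → Measurable w →
    ∫⁻ z, oR (w z ^ sob n) ≤ oR F →
    (∀ z ∈ ball x ρ, w z ≤ T) →
    NN (fun z => oR (w z ^ pcrit n)) x
      ≤ oR (C * (T ^ pcrit n * ρ ^ 2 + (F + 1) * ρ ^ (-(((n:ℝ) - 2) / 2)))) := by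
  have hα := al_pos hn
  have hp := p_pos hn
  obtain ⟨C1, hC1, h1⟩ := exists_far hn
  obtain ⟨C2, hC2, h2⟩ := exists_lint_in hn (σ := (n:ℝ) - 2) (by linarith)
  refine ⟨C1 + C2 + 1, by linarith, fun w x ρ F T hρ hF hT hw hwm hwF hwT => ?_⟩
  unfold NN
  rw [← lintegral_add_compl _ (measurableSet_ball (x := x) (ε := ρ))]
  have a1 : ∫⁻ z in ball x ρ, oR (w z ^ pcrit n) * oR (‖x - z‖ ^ (-((n:ℝ) - 2)))
      ≤ oR (T ^ pcrit n) * oR (C2 * ρ ^ 2) := by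
    calc _ ≤ ∫⁻ z in ball x ρ, oR (T ^ pcrit n) * oR (‖x - z‖ ^ (-((n:ℝ) - 2))) := by
          refine setLIntegral_mono' measurableSet_ball fun z hz => ?_
          gcongr
          · exact hw z
          · exact hwT z hz
      _ ≤ _ := by
          rw [lintegral_const_mul _ (by fun_prop)]
          gcongr
          refine (h2 ρ hρ x).trans (le_of_eq ?_)
          rw [sub_sub_cancel, ← rpow_natCast]; norm_num
  refine (add_le_add a1 (h1 w x ρ F hρ hF hw hwm hwF)).trans ?_
  rw [← ENNReal.ofReal_mul (by positivity), ← ENNReal.ofReal_add (by positivity) (by positivity)]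
  refine ENNReal.ofReal_le_ofReal ?_
  set P := ρ ^ (-(((n:ℝ) - 2) / 2))
  have hP : 0 ≤ P := by positivity
  have hTT : 0 ≤ T ^ pcrit n * ρ ^ 2 := by positivity
  nlinarith [mul_nonneg hF hP, mul_nonneg hC1.le hP, mul_nonneg hC2.le hP, mul_nonneg (mul_nonneg hC1.le hF) hP,
    mul_nonneg (mul_nonneg hC2.le hF) hP, mul_nonneg hC1.le hTT]
lemma exists_NN_weight (hn : 3 ≤ n) {θ : ℝ} (h0 : 0 < θ) (h1 : θ < (n:ℝ) - 2) :
    ∃ C > 0, ∀ x : Eu n, x ≠ 0 →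
      NN (fun z => oR (‖z‖ ^ (-(2 + θ)))) x ≤ oR (C * ‖x‖ ^ (-θ)) := by
  have hα := al_pos hn
  obtain ⟨C1, hC1, h1'⟩ := exists_lint_in hn (σ := (n:ℝ) - 2) (by linarith)
  obtain ⟨C2, hC2, h2'⟩ := exists_lint_in hn (σ := 2 + θ) (by linarith)
  obtain ⟨C3, hC3, h3'⟩ := exists_lint_out hn (σ := (n:ℝ) + θ) (by linarith)
  set α := (n:ℝ) - 2 with hαd
  refine ⟨C1 * (2⁻¹:ℝ) ^ (-(2 + θ)) * (2⁻¹:ℝ) ^ (2:ℝ) + C2 * (2⁻¹:ℝ) ^ (-α) * (2⁻¹:ℝ) ^ ((n:ℝ) - (2+θ)) +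
    C3 * (3⁻¹:ℝ) ^ (-α) * (2⁻¹:ℝ) ^ (-θ), by positivity, fun x hx => ?_⟩
  have hx0 : 0 < ‖x‖ := norm_pos_iff.2 hx
  set R := 2⁻¹ * ‖x‖ with hR
  have hR0 : 0 < R := by positivity
  unfold NN
  rw [← hαd]
  set g : Eu n → ENNReal := fun z => oR (‖z‖ ^ (-(2 + θ))) * oR (‖x - z‖ ^ (-α))
  have cover : (Set.univ : Set (Eu n)) ⊆ (ball x R ∪ ball 0 R) ∪ ((ball x R)ᶜ ∩ (ball 0 R)ᶜ) := by
    intro z _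
    by_cases a : z ∈ ball x R <;> by_cases b : z ∈ ball (0:Eu n) R <;> simp [a, b]
  have b1 : ∫⁻ z in ball x R, g z ≤ oR (R ^ (-(2 + θ))) * oR (C1 * R ^ (2:ℝ)) := by
    calc _ ≤ ∫⁻ z in ball x R, oR (R ^ (-(2 + θ))) * oR (‖x - z‖ ^ (-α)) := by
          refine setLIntegral_mono' measurableSet_ball fun z hz => ?_
          simp only [g]
          gcongr oR ?_ * _
          refine rpow_le_rpow_of_nonpos hR0 ?_ (by linarith)
          have : ‖z - x‖ < R := by rw [mem_ball, dist_eq_norm] at hz; exact hz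
          have := norm_sub_norm_le x z
          rw [norm_sub_rev] at this
          linarith
      _ ≤ _ := by
          rw [lintegral_const_mul _ (by fun_prop)]
          gcongr
          refine (h1' R hR0 x).trans (le_of_eq ?_)
          congr 3; rw [hαd]; ring
  have b2 : ∫⁻ z in ball 0 R, g z ≤ oR (R ^ (-α)) * oR (C2 * R ^ ((n:ℝ) - (2 + θ))) := by
    calc _ ≤ ∫⁻ z in ball (0:Eu n) R, oR (R ^ (-α)) * oR (‖0 - z‖ ^ (-(2 + θ))) := by
          refine setLIntegral_mono' measurableSet_ball fun z hz => ?_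
          simp only [g]
          rw [mul_comm, zero_sub, norm_neg]
          gcongr oR ?_ * _
          refine rpow_le_rpow_of_nonpos hR0 ?_ (by linarith)
          have : ‖z‖ < R := by simpa using hz
          have := norm_sub_norm_le x z
          linarith
      _ ≤ _ := by
          rw [lintegral_const_mul _ (by fun_prop)]
          gcongr
          exact (h2' R hR0 0)
  have b3 : ∫⁻ z in (ball x R)ᶜ ∩ (ball 0 R)ᶜ, g z ≤ oR ((3⁻¹:ℝ) ^ (-α)) * oR (C3 * R ^ (-θ)) := by
    calc _ ≤ ∫⁻ z in (ball x R)ᶜ ∩ (ball (0:Eu n) R)ᶜ, oR ((3⁻¹:ℝ) ^ (-α)) * oR (‖0 - z‖ ^ (-((n:ℝ) + θ))) := by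
          refine setLIntegral_mono' (measurableSet_ball.compl.inter measurableSet_ball.compl) fun z hz => ?_
          simp only [g]
          obtain ⟨hz1, hz2⟩ := hz
          have hz2' : R ≤ ‖z‖ := by simpa using hz2
          have hz1' : R ≤ ‖x - z‖ := by
            rw [norm_sub_rev]; simpa [dist_eq_norm] using hz1
          have hz0 : 0 < ‖z‖ := by linarith
          rw [← ENNReal.ofReal_mul (by positivity), ← ENNReal.ofReal_mul (by positivity)]
          refine ENNReal.ofReal_le_ofReal ?_
          rw [zero_sub, norm_neg]
          have e : -((n:ℝ) + θ) = -(2 + θ) + -α := by rw [hαd]; ring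
          rw [e, rpow_add hz0, mul_left_comm, ← Real.mul_rpow (by positivity) (by positivity)]
          refine mul_le_mul_of_nonneg_left (rpow_le_rpow_of_nonpos (by positivity) ?_ (by linarith))
            (by positivity)
          have := norm_sub_norm_le z x
          rw [norm_sub_rev] at this
          linarith
      _ ≤ ∫⁻ z in (ball (0:Eu n) R)ᶜ, oR ((3⁻¹:ℝ) ^ (-α)) * oR (‖0 - z‖ ^ (-((n:ℝ) + θ))) :=
          lintegral_mono_set Set.inter_subset_right
      _ ≤ _ := by
          rw [lintegral_const_mul _ (by fun_prop)]
          gcongr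
          refine (h3' R hR0 0).trans (le_of_eq ?_)
          congr 3; ring
  calc ∫⁻ z, g z = ∫⁻ z in Set.univ, g z := by simp
    _ ≤ ∫⁻ z in (ball x R ∪ ball 0 R) ∪ ((ball x R)ᶜ ∩ (ball 0 R)ᶜ), g z := lintegral_mono_set cover
    _ ≤ ((∫⁻ z in ball x R, g z) + (∫⁻ z in ball 0 R, g z)) + ∫⁻ z in (ball x R)ᶜ ∩ (ball 0 R)ᶜ, g z :=
        (lintegral_union_le _ _ _).trans (add_le_add (lintegral_union_le _ _ _) le_rfl)
    _ ≤ _ := add_le_add (add_le_add b1 b2) b3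
    _ = _ := by
        rw [← ENNReal.ofReal_mul (by positivity), ← ENNReal.ofReal_mul (by positivity),
          ← ENNReal.ofReal_mul (by positivity), ← ENNReal.ofReal_add (by positivity) (by positivity),
          ← ENNReal.ofReal_add (by positivity) (by positivity)]
        congr 1
        have e1 : ‖x‖ ^ (-(2+θ)) * ‖x‖ ^ (2:ℝ) = ‖x‖ ^ (-θ) := by rw [← rpow_add hx0]; congr 1; ring
        have e2 : ‖x‖ ^ (-α) * ‖x‖ ^ ((n:ℝ) - (2+θ)) = ‖x‖ ^ (-θ) := by
          rw [← rpow_add hx0]; congr 1; rw [hαd]; ring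
        simp only [hR]
        rw [Real.mul_rpow (by positivity) hx0.le, Real.mul_rpow (by positivity) hx0.le,
          Real.mul_rpow (by positivity) hx0.le, Real.mul_rpow (by positivity) hx0.le,
          Real.mul_rpow (by positivity) hx0.le]
        linear_combination (C1 * (2⁻¹:ℝ) ^ (-(2 + θ)) * (2⁻¹:ℝ) ^ (2:ℝ)) * e1 + (C2 * (2⁻¹:ℝ) ^ (-α) * (2⁻¹:ℝ) ^ ((n:ℝ) - (2+θ))) * e2
/-- Bilinear Hartree form. -/
def DD (f g : Eu n → ENNReal) : ENNReal := ∫⁻ x, f x * NN g x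
lemma NN_meas {f : Eu n → ENNReal} (hf : Measurable f) : Measurable (NN f) := by
  unfold NN
  exact Measurable.lintegral_prod_right' (f := fun q : Eu n × Eu n =>
    f q.2 * oR (‖q.1 - q.2‖ ^ (-((n:ℝ) - 2)))) (by fun_prop)
lemma NN_mono {f g : Eu n → ENNReal} (h : ∀ z, f z ≤ g z) (x : Eu n) :
    NN f x ≤ NN g x := lintegral_mono fun z => by gcongr; exact h z
lemma DD_mono {f g f' g' : Eu n → ENNReal} (h : ∀ z, f z ≤ g z) (h' : ∀ z, f' z ≤ g' z) :
    DD f f' ≤ DD g g' := lintegral_mono fun z => mul_le_mul' (h z) (NN_mono h' z)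
lemma NN_add {f g : Eu n → ENNReal} (hf : Measurable f) (x : Eu n) :
    NN (fun z => f z + g z) x = NN f x + NN g x := by
  unfold NN
  rw [← lintegral_add_left (by fun_prop)]
  simp only [add_mul]
lemma DD_eq {f g : Eu n → ENNReal} (hg : Measurable g) : DD f g =
    ∫⁻ x, ∫⁻ z, f x * (g z * oR (‖x - z‖ ^ (-((n:ℝ) - 2)))) := by
  unfold DD NN
  congr 1; ext x
  rw [lintegral_const_mul _ (by fun_prop)]
lemma DD_symm {f g : Eu n → ENNReal} (hf : Measurable f) (hg : Measurable g) :
    DD f g = DD g f := by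
  rw [DD_eq hg, DD_eq hf, lintegral_lintegral_swap (by fun_prop)]
  congr 1; ext x; congr 1; ext z
  rw [norm_sub_rev]; ring
lemma DD_add_right {f g h : Eu n → ENNReal} (hf : Measurable f) (hg : Measurable g) :
    DD f (fun z => g z + h z) = DD f g + DD f h := by
  unfold DD
  have := NN_meas hg
  rw [← lintegral_add_left (by fun_prop)]
  simp only [NN_add hg, mul_add]
lemma DD_add_left {f g h : Eu n → ENNReal} (hf : Measurable f) (hh : Measurable h) :
    DD (fun z => f z + g z) h = DD f h + DD g h := by
  unfold DD
  have := NN_meas hh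
  rw [← lintegral_add_left (by fun_prop)]
  simp only [add_mul]
lemma exists_HLS1 (hn : 3 ≤ n) : ∃ C > 0, ∀ (a b : Eu n → ℝ),
    (∀ z, 0 ≤ a z) → (∀ z, 0 ≤ b z) → Measurable a → Measurable b →
    ∫⁻ z, oR (a z ^ sob n) ≤ 1 → ∫⁻ z, oR (b z ^ sob n) ≤ 1 →
    DD (fun z => oR (a z ^ pcrit n)) (fun z => oR (b z ^ pcrit n))
      ≤ oR C := by
  have hα := al_pos hn
  have hp := p_pos hn
  have hs := sob_pos hn
  obtain ⟨C, hC, h⟩ := exists_NN_le hn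
  have key : ∀ (a b : Eu n → ℝ),
    (∀ z, 0 ≤ a z) → (∀ z, 0 ≤ b z) → Measurable a → Measurable b →
    ∫⁻ z, oR (a z ^ sob n) ≤ 1 → ∫⁻ z, oR (b z ^ sob n) ≤ 1 →
    ∫⁻ x, ∫⁻ z, (if b z ≤ a x then oR (a x ^ pcrit n) * (oR (b z ^ pcrit n) *
      oR (‖x - z‖ ^ (-((n:ℝ) - 2)))) else 0) ≤ oR (3 * C) := by
    intro a b ha hb ham hbm hA hB
    calc _ ≤ ∫⁻ x, oR (3 * C) * oR (a x ^ sob n) := by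
          refine lintegral_mono fun x => ?_
          simp only
          rcases (ha x).eq_or_lt with h0 | h0
          · rw [← h0, Real.zero_rpow hp.ne']; simp
          set b' : Eu n → ℝ := fun z => if b z ≤ a x then b z else 0 with hb'
          have e : ∀ z, (if b z ≤ a x then oR (a x ^ pcrit n) * (oR (b z ^ pcrit n) *
              oR (‖x - z‖ ^ (-((n:ℝ) - 2)))) else 0) = oR (a x ^ pcrit n) *
              (oR (b' z ^ pcrit n) * oR (‖x - z‖ ^ (-((n:ℝ) - 2)))) := by
            intro z
            simp only [hb']
            split_ifs with hh
            · rfl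
            · rw [Real.zero_rpow hp.ne']; simp
          have hb'm : Measurable b' :=
            Measurable.ite (measurableSet_le hbm measurable_const) hbm measurable_const
          have hb'0 : ∀ z, 0 ≤ b' z := fun z => by
            simp only [hb']; split_ifs; exacts [hb z, le_rfl]
          simp only [e]
          rw [lintegral_const_mul _ (by fun_prop)]
          have hh := h b' x ((a x) ^ (-(2 / ((n:ℝ) - 2)))) 1 (a x) (by positivity) zero_le_one h0.le hb'0 hb'm
            (by
              rw [ENNReal.ofReal_one]
              refine le_trans (lintegral_mono fun z => ENNReal.ofReal_le_ofReal ?_) hB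
              refine rpow_le_rpow (hb'0 z) ?_ hs.le
              simp only [hb']; split_ifs; exacts [le_rfl, hb z])
            (fun z _ => by simp only [hb']; split_ifs with q; exacts [q, h0.le])
          unfold NN at hh
          refine (mul_le_mul_right hh _).trans ?_
          rw [← ENNReal.ofReal_mul (by positivity), ← ENNReal.ofReal_mul (by positivity)]
          refine ENNReal.ofReal_le_ofReal (le_of_eq ?_)
          rw [← rpow_natCast, ← rpow_mul h0.le, ← rpow_mul h0.le, ← rpow_add h0]
          have e1 : pcrit n + -(2 / ((n:ℝ) - 2)) * ((2:ℕ):ℝ) = 1 := by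
            have := al_p1 hn
            push_cast; field_simp; linarith
          have e2 : -(2 / ((n:ℝ) - 2)) * -(((n:ℝ) - 2) / 2) = 1 := by field_simp
          rw [e1, e2, rpow_one, sob, rpow_add_one h0.ne']; ring
      _ ≤ _ := by
          rw [lintegral_const_mul _ (by fun_prop)]
          calc _ ≤ oR (3 * C) * 1 := by gcongr
            _ = _ := mul_one _
  refine ⟨6 * C, by positivity, fun a b ha hb ham hbm hA hB => ?_⟩
  rw [DD_eq (by fun_prop)]
  have k1 := key a b ha hb ham hbm hA hB
  have k2 := key b a hb ha hbm ham hB hA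
  have m1 : ∀ (a b : Eu n → ℝ), Measurable a → Measurable b → Measurable (fun q : Eu n × Eu n =>
      if b q.2 ≤ a q.1 then oR (a q.1 ^ pcrit n) * (oR (b q.2 ^ pcrit n) *
      oR (‖q.1 - q.2‖ ^ (-((n:ℝ) - 2)))) else 0) := fun a b ha hb =>
    Measurable.ite (measurableSet_le (by fun_prop) (by fun_prop)) (by fun_prop) (by fun_prop)
  have k2' : ∫⁻ x, ∫⁻ z, (if a x ≤ b z then oR (a x ^ pcrit n) * (oR (b z ^ pcrit n) *
      oR (‖x - z‖ ^ (-((n:ℝ) - 2)))) else 0) ≤ oR (3 * C) := by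
    rw [lintegral_lintegral_swap]
    · refine le_trans (le_of_eq ?_) k2
      congr 1; ext x; congr 1; ext z
      rw [norm_sub_rev]; congr 1; ring
    · refine Measurable.aemeasurable ?_
      exact Measurable.ite (measurableSet_le (by fun_prop) (by fun_prop)) (by fun_prop) (by fun_prop)
  calc _ ≤ ∫⁻ x, ∫⁻ z, ((if b z ≤ a x then oR (a x ^ pcrit n) * (oR (b z ^ pcrit n) *
      oR (‖x - z‖ ^ (-((n:ℝ) - 2)))) else 0) + (if a x ≤ b z then oR (a x ^ pcrit n) * (oR (b z ^ pcrit n) *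
      oR (‖x - z‖ ^ (-((n:ℝ) - 2)))) else 0)) := by
        refine lintegral_mono fun x => lintegral_mono fun z => ?_
        simp only
        rcases le_total (b z) (a x) with q | q
        · rw [if_pos q]; exact le_self_add
        · rw [if_pos q]; exact le_add_self
    _ = (∫⁻ x, ∫⁻ z, (if b z ≤ a x then oR (a x ^ pcrit n) * (oR (b z ^ pcrit n) *
      oR (‖x - z‖ ^ (-((n:ℝ) - 2)))) else 0)) + ∫⁻ x, ∫⁻ z, (if a x ≤ b z then oR (a x ^ pcrit n) * (oR (b z ^ pcrit n) *
      oR (‖x - z‖ ^ (-((n:ℝ) - 2)))) else 0) := by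
        rw [← lintegral_add_left (Measurable.lintegral_prod_right' (m1 a b ham hbm))]
        congr 1; ext x
        exact lintegral_add_left ((m1 a b ham hbm).comp measurable_prodMk_left) _
    _ ≤ oR (3 * C) + oR (3 * C) := add_le_add k1 k2'
    _ = _ := by rw [← ENNReal.ofReal_add (by positivity) (by positivity)]; congr 1; ring
lemma exists_HLS (hn : 3 ≤ n) : ∃ C > 0, ∀ (a b : Eu n → ℝ) (A B : ℝ), 0 < A → 0 < B →
    (∀ z, 0 ≤ a z) → (∀ z, 0 ≤ b z) → Measurable a → Measurable b →
    ∫⁻ z, oR (a z ^ sob n) ≤ oR (A ^ sob n) →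
    ∫⁻ z, oR (b z ^ sob n) ≤ oR (B ^ sob n) →
    DD (fun z => oR (a z ^ pcrit n)) (fun z => oR (b z ^ pcrit n))
      ≤ oR (C * (A ^ pcrit n * B ^ pcrit n)) := by
  have hp := p_pos hn
  have hs := sob_pos hn
  obtain ⟨C, hC, h⟩ := exists_HLS1 hn
  refine ⟨C, hC, fun a b A B hA hB ha hb ham hbm haA hbB => ?_⟩
  have nrm : ∀ (a : Eu n → ℝ) (A : ℝ), 0 < A → (∀ z, 0 ≤ a z) → Measurable a →
      ∫⁻ z, oR (a z ^ sob n) ≤ oR (A ^ sob n) →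
      ∫⁻ z, oR ((A⁻¹ * a z) ^ sob n) ≤ 1 := by
    intro a A hA ha ham haA
    calc _ = oR (A⁻¹ ^ sob n) * ∫⁻ z, oR (a z ^ sob n) := by
          rw [← lintegral_const_mul _ (by fun_prop)]
          congr 1; ext z
          rw [← ENNReal.ofReal_mul (by positivity), Real.mul_rpow (by positivity) (ha z)]
      _ ≤ oR (A⁻¹ ^ sob n) * oR (A ^ sob n) := by gcongr
      _ = 1 := by
          rw [← ENNReal.ofReal_mul (by positivity), ← Real.mul_rpow (by positivity) hA.le,
            inv_mul_cancel₀ hA.ne', Real.one_rpow, ENNReal.ofReal_one]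
  have := h (fun z => A⁻¹ * a z) (fun z => B⁻¹ * b z) (fun z => mul_nonneg (by positivity) (ha z))
    (fun z => mul_nonneg (by positivity) (hb z)) (by fun_prop) (by fun_prop) (nrm a A hA ha ham haA) (nrm b B hB hb hbm hbB)
  have e : DD (fun z => oR (a z ^ pcrit n)) (fun z => oR (b z ^ pcrit n)) =
      oR (A ^ pcrit n * B ^ pcrit n) * DD (fun z => oR ((A⁻¹ * a z) ^ pcrit n)) (fun z => oR ((B⁻¹ * b z) ^ pcrit n)) := by
    rw [DD_eq (by fun_prop), DD_eq (by fun_prop), ← lintegral_const_mul _ ?_]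
    · congr 1; ext x
      rw [← lintegral_const_mul _ (by fun_prop)]
      congr 1; ext z
      have h1 := ha x
      have h2 := hb z
      rw [← ENNReal.ofReal_mul (by positivity), ← ENNReal.ofReal_mul (by positivity),
        ← ENNReal.ofReal_mul (by positivity), ← ENNReal.ofReal_mul (by positivity),
        ← ENNReal.ofReal_mul (by positivity), Real.mul_rpow (by positivity) h1,
        Real.mul_rpow (by positivity) h2, Real.inv_rpow hA.le, Real.inv_rpow hB.le]
      congr 1
      have : 0 < A ^ pcrit n := by positivity
      have : 0 < B ^ pcrit n := by positivity
      field_simp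
    · exact Measurable.lintegral_prod_right' (f := fun q : Eu n × Eu n => oR ((A⁻¹ * a q.1) ^ pcrit n) * (oR ((B⁻¹ * b q.2) ^ pcrit n) *
      oR (‖q.1 - q.2‖ ^ (-((n:ℝ) - 2))))) (by fun_prop)
  rw [e]
  refine (mul_le_mul_right this _).trans ?_
  rw [← ENNReal.ofReal_mul (by positivity), mul_comm]
lemma exists_cross (hn : 3 ≤ n) : ∃ C > 0, ∀ (a b : Eu n → ℝ) (x0 : Eu n) (r L F : ℝ),
    0 < r → 4 ≤ L → 0 ≤ F →
    (∀ z, 0 ≤ a z) → (∀ z, 0 ≤ b z) → Measurable a → Measurable b →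
    (∀ z, z ∉ ball x0 (2 * r) → a z = 0) → (∀ z ∈ ball x0 (L * r), b z = 0) →
    ∫⁻ z, oR (a z ^ sob n) ≤ oR F →
    ∫⁻ z, oR (b z ^ sob n) ≤ oR F →
    DD (fun z => oR (a z ^ pcrit n)) (fun z => oR (b z ^ pcrit n))
      ≤ oR (C * (F + C) ^ 2 * L ^ (-(((n:ℝ) - 2) / 2))) := by
  have hα := al_pos hn
  have hp := p_pos hn
  have hs := sob_pos hn
  obtain ⟨C1, hC1, h1⟩ := exists_far hn
  set α := (n:ℝ) - 2 with hαd
  obtain ⟨C2, hC2, h2⟩ := exists_lint_in hn (σ := 0) (by simp; omega)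
  set C := (2⁻¹:ℝ) ^ (-α) + C1 + C2 * 2 ^ (n:ℝ) with hCd
  refine ⟨C, by positivity, fun a b x0 r L F hr hL hF ha hb ham hbm ha0 hb0 haF hbF => ?_⟩
  have hLr : 0 < L * r := by positivity
  have step1 : ∀ x, oR (a x ^ pcrit n) * NN (fun z => oR (b z ^ pcrit n)) x ≤
      oR (a x ^ pcrit n) * oR ((2⁻¹:ℝ) ^ (-α) * ((F + C1) * (L * r) ^ (-(α / 2)))) := by
    intro x
    by_cases hx : x ∈ ball x0 (2 * r)
    swap
    · rw [ha0 x hx, Real.zero_rpow hp.ne']; simp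
    gcongr
    have hx' : ‖x - x0‖ < 2 * r := by rw [mem_ball, dist_eq_norm] at hx; exact hx
    calc NN (fun z => oR (b z ^ pcrit n)) x
        = ∫⁻ z in (ball x0 (L * r))ᶜ, oR (b z ^ pcrit n) * oR (‖x - z‖ ^ (-α)) := by
          unfold NN
          rw [← lintegral_add_compl _ (measurableSet_ball (x := x0) (ε := L * r)),
            setLIntegral_congr_fun (g := fun _ => 0) measurableSet_ball]
          · simp [hαd]
          · intro z hz
            simp only
            rw [hb0 z hz, Real.zero_rpow hp.ne']; simp
      _ ≤ ∫⁻ z in (ball x0 (L * r))ᶜ, oR ((2⁻¹:ℝ) ^ (-α)) * (oR (b z ^ pcrit n) * oR (‖x0 - z‖ ^ (-α))) := by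
          refine setLIntegral_mono' measurableSet_ball.compl fun z hz => ?_
          rw [mul_left_comm, ← ENNReal.ofReal_mul (p := (2⁻¹:ℝ) ^ (-α)) (by positivity),
            ← Real.mul_rpow (by positivity) (by positivity)]
          have hz' : L * r ≤ ‖x0 - z‖ := by rw [norm_sub_rev]; simpa [dist_eq_norm] using hz
          have : 0 < ‖x0 - z‖ := by linarith
          gcongr _ * oR ?_
          refine rpow_le_rpow_of_nonpos (by positivity) ?_ (by linarith)
          have h4 : 4 * r ≤ L * r := by gcongr
          have := norm_sub_norm_le (x0 - z) (x0 - x)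
          rw [sub_sub_sub_cancel_left] at this
          rw [norm_sub_rev x0 x] at this
          linarith
      _ ≤ oR ((2⁻¹:ℝ) ^ (-α)) * oR ((F + C1) * (L * r) ^ (-(α / 2))) := by
          rw [lintegral_const_mul _ (by fun_prop)]
          gcongr
          exact h1 b x0 (L * r) F hLr hF hb hbm hbF
      _ = _ := by rw [← ENNReal.ofReal_mul (by positivity)]
  have step2 : ∫⁻ x, oR (a x ^ pcrit n) ≤ oR ((F + C2 * 2 ^ (n:ℝ)) * r ^ (α / 2)) := by
    set t := r ^ (-(α / 2)) with ht
    have htp : 0 < t := by positivity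
    calc _ = ∫⁻ x in ball x0 (2 * r), oR (a x ^ pcrit n) := by
          rw [← lintegral_indicator measurableSet_ball]
          congr 1; ext z
          by_cases hz : z ∈ ball x0 (2 * r)
          · simp [hz]
          · rw [Set.indicator_of_notMem hz, ha0 z hz, Real.zero_rpow hp.ne']; simp
      _ ≤ ∫⁻ x in ball x0 (2 * r), (oR t⁻¹ * oR (a x ^ sob n) + oR (t ^ pcrit n) * oR (‖x0 - x‖ ^ (-(0:ℝ)))) := by
          refine lintegral_mono fun x => ?_
          simp only
          have h0 := ha x
          rw [← ENNReal.ofReal_mul (by positivity), ← ENNReal.ofReal_mul (by positivity), ← ENNReal.ofReal_add (by positivity) (by positivity)]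
          refine ENNReal.ofReal_le_ofReal ?_
          have := young_t hp h0 zero_le_one htp
          simpa [sob] using this
      _ = (oR t⁻¹ * ∫⁻ x in ball x0 (2 * r), oR (a x ^ sob n)) + oR (t ^ pcrit n) * ∫⁻ x in ball x0 (2 * r), oR (‖x0 - x‖ ^ (-(0:ℝ))) := by
          rw [lintegral_add_left (by fun_prop), lintegral_const_mul _ (by fun_prop), lintegral_const_mul _ (by fun_prop)]
      _ ≤ oR t⁻¹ * oR F + oR (t ^ pcrit n) * oR (C2 * (2 * r) ^ ((n:ℝ) - 0)) := by
          gcongr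
          · exact (setLIntegral_le_lintegral _ _).trans haF
          · exact h2 (2 * r) (by positivity) x0
      _ = _ := by
          rw [← ENNReal.ofReal_mul (by positivity), ← ENNReal.ofReal_mul (by positivity), ← ENNReal.ofReal_add (by positivity) (by positivity)]
          congr 1
          rw [ht, ← rpow_neg hr.le, neg_neg, ← rpow_mul hr.le, sub_zero, Real.mul_rpow (by norm_num) hr.le]
          have : r ^ (-(α / 2) * pcrit n) * r ^ (n:ℝ) = r ^ (α / 2) := by
            rw [← rpow_add hr]; congr 1
            have := al_p hn
            rw [← hαd] at this
            linarith
          linear_combination (C2 * 2 ^ (n:ℝ)) * this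
  calc _ ≤ ∫⁻ x, oR (a x ^ pcrit n) * oR ((2⁻¹:ℝ) ^ (-α) * ((F + C1) * (L * r) ^ (-(α / 2)))) :=
        lintegral_mono step1
    _ = (∫⁻ x, oR (a x ^ pcrit n)) * oR ((2⁻¹:ℝ) ^ (-α) * ((F + C1) * (L * r) ^ (-(α / 2)))) := by
        rw [lintegral_mul_const _ (by fun_prop)]
    _ ≤ oR ((F + C2 * 2 ^ (n:ℝ)) * r ^ (α / 2)) * oR ((2⁻¹:ℝ) ^ (-α) * ((F + C1) * (L * r) ^ (-(α / 2)))) := by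
        gcongr
    _ ≤ _ := by
        rw [← ENNReal.ofReal_mul (by positivity)]
        refine ENNReal.ofReal_le_ofReal ?_
        have hL0 : 0 < L := by linarith
        rw [Real.mul_rpow hL0.le hr.le]
        have e : r ^ (α / 2) * r ^ (-(α / 2)) = 1 := by rw [← rpow_add hr]; simp
        have e0 : 0 ≤ C2 * 2 ^ (n:ℝ) := by positivity
        have e00 : 0 ≤ (2⁻¹:ℝ) ^ (-α) := by positivity
        calc _ = (2⁻¹:ℝ) ^ (-α) * ((F + C2 * 2 ^ (n:ℝ)) * (F + C1)) * L ^ (-(α / 2)) * (r ^ (α / 2) * r ^ (-(α / 2))) := by ring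
          _ = (2⁻¹:ℝ) ^ (-α) * ((F + C2 * 2 ^ (n:ℝ)) * (F + C1)) * L ^ (-(α / 2)) := by rw [e, mul_one]
          _ ≤ C * ((F + C) * (F + C)) * L ^ (-(α / 2)) := by
            gcongr
            · rw [hCd]; linarith
            · rw [hCd]; linarith
            · rw [hCd]; linarith
          _ = _ := by ring
lemma two_le_top : (2 : WithTop ℕ∞) ≤ ((⊤ : ℕ∞) : WithTop ℕ∞) := by
  have : ((2:ℕ∞) : WithTop ℕ∞) ≤ ((⊤ : ℕ∞) : WithTop ℕ∞) := by
    rw [WithTop.coe_le_coe]; exact le_top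
  exact this
/-- Partial derivative. -/
def pd (f : Eu n → ℝ) (i : Fin n) (x : Eu n) : ℝ :=
  fderiv ℝ f x (EuclideanSpace.single i 1)
lemma lapl_pd (f : Eu n → ℝ) (x : Eu n) : lapl f x = ∑ i, pd (pd f i) i x := rfl
/-- smooth truncation profile -/
def hT (t : ℝ) : ℝ := ∫ s in (0:ℝ)..t, Real.smoothTransition (s - 1)
lemma hT_cont : Continuous (fun s : ℝ => Real.smoothTransition (s - 1)) :=
  Real.smoothTransition.continuous.comp (by fun_prop)
lemma hT_deriv (t : ℝ) : HasDerivAt hT (Real.smoothTransition (t - 1)) t :=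
  (hT_cont.integral_hasStrictDerivAt 0 t).hasDerivAt
lemma hT_deriv' : deriv hT = fun t => Real.smoothTransition (t - 1) := by
  ext t; exact (hT_deriv t).deriv
lemma sT_smooth : ContDiff ℝ (⊤ : ℕ∞) (fun t : ℝ => Real.smoothTransition (t - 1)) :=
  Real.smoothTransition.contDiff.comp (by fun_prop)
lemma hT_smooth : ContDiff ℝ (⊤ : ℕ∞) hT := by
  rw [contDiff_infty_iff_deriv]
  refine ⟨fun t => (hT_deriv t).differentiableAt, ?_⟩
  rw [hT_deriv']; exact sT_smooth
lemma hT_zero {t : ℝ} (h : t ≤ 1) : hT t = 0 := by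
  unfold hT
  rw [intervalIntegral.integral_congr (g := fun _ => (0:ℝ))]
  · simp
  · intro s hs
    apply Real.smoothTransition.zero_of_nonpos
    have := hs.2
    have h2 : max 0 t ≤ 1 := max_le zero_le_one h
    linarith
lemma hT_mono : Monotone hT := by
  apply monotone_of_deriv_nonneg (fun t => (hT_deriv t).differentiableAt)
  intro t; rw [hT_deriv']; exact Real.smoothTransition.nonneg _
lemma hT_nonneg (t : ℝ) : 0 ≤ hT t := by
  rcases le_total t 1 with h | h
  · rw [hT_zero h]
  · rw [← hT_zero (le_refl 1)]; exact hT_mono h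
lemma hT_subd (t : ℝ) : HasDerivAt (fun t => hT t - t) (Real.smoothTransition (t - 1) - 1) t :=
  (hT_deriv t).sub (hasDerivAt_id t)
lemma hT_sub_anti : Antitone (fun t => hT t - t) := by
  apply antitone_of_deriv_nonpos
  · exact fun t => ((hT_deriv t).sub (hasDerivAt_id t)).differentiableAt
  · intro t; rw [(hT_subd t).deriv]
    linarith [Real.smoothTransition.le_one (t-1)]
lemma hT_le {t : ℝ} (h : 0 ≤ t) : hT t ≤ t := by
  have := hT_sub_anti h
  simp only [hT_zero zero_le_one] at this; linarith
lemma hT_ge (t : ℝ) : t - 2 ≤ hT t := by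
  rcases le_total t 2 with h | h
  · linarith [hT_nonneg t]
  · have hm : Monotone (fun t => hT (max t 2) - max t 2) := by
      have : MonotoneOn (fun t => hT t - t) (Set.Ici 2) := by
        apply monotoneOn_of_deriv_nonneg (convex_Ici 2)
        · exact fun t _ => ((hT_deriv t).sub (hasDerivAt_id t)).continuousAt.continuousWithinAt
        · exact fun t _ => ((hT_deriv t).sub (hasDerivAt_id t)).differentiableAt.differentiableWithinAt
        · intro t ht; rw [(hT_subd t).deriv]
          rw [interior_Ici] at ht
          rw [Real.smoothTransition.one_of_one_le]
          · simp
          · have : 2 < t := ht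
            linarith
      intro a b hab
      exact this (Set.mem_Ici.2 (le_max_right _ _)) (Set.mem_Ici.2 (le_max_right _ _)) (max_le_max_right 2 hab)
    have := hm h
    simp only [max_self, max_eq_left h] at this
    linarith [hT_nonneg 2]
/-- scaled truncation -/
def HT (δ t : ℝ) : ℝ := δ * hT (t / δ)
lemma HT_deriv {δ : ℝ} (hδ : 0 < δ) (t : ℝ) : HasDerivAt (HT δ) (Real.smoothTransition (t / δ - 1)) t := by
  have := ((hT_deriv (t/δ)).comp t ((hasDerivAt_id t).div_const δ)).const_mul δ
  refine this.congr_deriv ?_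
  field_simp
lemma HT_smooth (δ : ℝ) : ContDiff ℝ (⊤ : ℕ∞) (HT δ) := by
  unfold HT
  exact contDiff_const.mul (hT_smooth.comp (by fun_prop))
lemma HT_zero {δ t : ℝ} (hδ : 0 < δ) (h : t ≤ δ) : HT δ t = 0 := by
  unfold HT; rw [hT_zero, mul_zero]; rwa [div_le_one hδ]
lemma HT_nonneg {δ : ℝ} (hδ : 0 < δ) (t : ℝ) : 0 ≤ HT δ t := mul_nonneg hδ.le (hT_nonneg _)
lemma HT_le {δ t : ℝ} (hδ : 0 < δ) (h : 0 ≤ t) : HT δ t ≤ t := by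
  have := mul_le_mul_of_nonneg_left (hT_le (div_nonneg h hδ.le)) hδ.le
  unfold HT; refine this.trans (le_of_eq ?_); field_simp
lemma HT_ge {δ : ℝ} (hδ : 0 < δ) (t : ℝ) : t - 2 * δ ≤ HT δ t := by
  have := mul_le_mul_of_nonneg_left (hT_ge (t / δ)) hδ.le
  unfold HT; refine le_trans (le_of_eq ?_) this; field_simp
lemma HT_deriv' {δ : ℝ} (hδ : 0 < δ) : deriv (HT δ) = fun t => Real.smoothTransition (t / δ - 1) := by
  ext t; exact (HT_deriv hδ t).deriv
lemma HT_deriv2 {δ : ℝ} (hδ : 0 < δ) (t : ℝ) : 0 ≤ deriv (deriv (HT δ)) t := by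
  rw [HT_deriv' hδ]
  apply Monotone.deriv_nonneg
  intro a b h
  exact Real.smoothTransition.monotone (by simpa using div_le_div_of_nonneg_right h hδ.le)
/-! calculus -/
lemma pd_comp {H : ℝ → ℝ} {v : Eu n → ℝ} {x : Eu n} (i : Fin n)
    (hH : DifferentiableAt ℝ H (v x)) (hv : DifferentiableAt ℝ v x) :
    pd (fun y => H (v y)) i x = deriv H (v x) * pd v i x := by
  unfold pd
  have := (hH.hasDerivAt.comp_hasFDerivAt x hv.hasFDerivAt).fderiv
  have e : fderiv ℝ (fun y => H (v y)) x = deriv H (v x) • fderiv ℝ v x := this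
  rw [e]; rfl
lemma pd_mul {f g : Eu n → ℝ} {x : Eu n} (i : Fin n)
    (hf : DifferentiableAt ℝ f x) (hg : DifferentiableAt ℝ g x) :
    pd (fun y => f y * g y) i x = f x * pd g i x + g x * pd f i x := by
  unfold pd
  have := (hf.hasFDerivAt.mul hg.hasFDerivAt).fderiv
  have e : fderiv ℝ (fun y => f y * g y) x = _ := this
  rw [e]; rfl
lemma pd_contDiffAt {v : Eu n → ℝ} {x : Eu n} (i : Fin n) (hv : ContDiffAt ℝ 2 v x) :
    ContDiffAt ℝ 1 (pd v i) x := by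
  have := hv.fderiv_right (m := 1) (by norm_num)
  exact this.clm_apply contDiffAt_const
lemma pd_contDiff {v : Eu n → ℝ} (i : Fin n) (hv : ContDiff ℝ 2 v) :
    ContDiff ℝ 1 (pd v i) := 
  contDiff_iff_contDiffAt.2 fun _ => pd_contDiffAt i hv.contDiffAt
lemma pd_continuous {v : Eu n → ℝ} (i : Fin n) (hv : ContDiff ℝ 1 v) :
    Continuous (pd v i) :=
  (hv.continuous_fderiv one_ne_zero).clm_apply continuous_const
lemma pd_compact {v : Eu n → ℝ} (i : Fin n) (hv : HasCompactSupport v) :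
    HasCompactSupport (pd v i) := hv.fderiv_apply ℝ _
lemma lapl_continuous {v : Eu n → ℝ} (hv : ContDiff ℝ 2 v) : Continuous (lapl v) := by
  have : lapl v = fun x => ∑ i, pd (pd v i) i x := rfl
  rw [this]
  exact continuous_finsetSum _ fun i _ => pd_continuous i (pd_contDiff i hv)
lemma pd_congr {f g : Eu n → ℝ} {x : Eu n} (i : Fin n) (h : f =ᶠ[𝓝 x] g) : pd f i x = pd g i x := by
  unfold pd; rw [h.fderiv_eq]
lemma lapl_congr {f g : Eu n → ℝ} {x : Eu n} (h : f =ᶠ[𝓝 x] g) : lapl f x = lapl g x := by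
  rw [lapl_pd, lapl_pd]
  refine Finset.sum_congr rfl fun i _ => ?_
  apply pd_congr
  filter_upwards [eventually_eventually_nhds.2 h] with y hy using pd_congr i hy
lemma lapl_comp {H : ℝ → ℝ} {v : Eu n → ℝ} {x : Eu n}
    (hH : ContDiff ℝ 2 H) (hv : ContDiffAt ℝ 2 v x) :
    lapl (fun y => H (v y)) x = deriv H (v x) * lapl v x +
      deriv (deriv H) (v x) * ∑ i, pd v i x ^ 2 := by
  rw [lapl_pd, lapl_pd, Finset.mul_sum, Finset.mul_sum, ← Finset.sum_add_distrib]
  refine Finset.sum_congr rfl fun i _ => ?_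
  have hH1 : ContDiff ℝ 1 (deriv H) := by
    have : ContDiff ℝ (1+1) H := by simpa [one_add_one_eq_two] using hH
    exact (contDiff_succ_iff_deriv.1 this).2.2
  have hvd : ∀ᶠ y in 𝓝 x, DifferentiableAt ℝ v y := by
    have := hv.eventually (by simp)
    filter_upwards [this] with y hy using hy.differentiableAt (by norm_num)
  have e : pd (fun y => H (v y)) i =ᶠ[𝓝 x] fun y => deriv H (v y) * pd v i y := by
    filter_upwards [hvd] with y hy
    exact pd_comp i (hH.differentiable (by norm_num) _) hy
  rw [pd_congr i e, pd_mul (f := fun y => deriv H (v y)), pd_comp i (hH1.differentiable (by norm_num) _) hvd.self_of_nhds]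
  · ring
  · exact (hH1.differentiable (by norm_num) _).comp x hvd.self_of_nhds
  · exact (pd_contDiffAt i hv).differentiableAt (by norm_num)
lemma clm_eq_sum (L : Eu n →L[ℝ] ℝ) (y : Eu n) :
    L y = ∑ i, y i * L (EuclideanSpace.single i 1) := by
  conv_lhs => rw [← (EuclideanSpace.basisFun (Fin n) ℝ).sum_repr y]
  rw [map_sum]
  refine Finset.sum_congr rfl fun i _ => ?_
  simp
lemma fderiv_apply_eq (f : Eu n → ℝ) (x y : Eu n) :
    fderiv ℝ f x y = ∑ i, y i * pd f i x := clm_eq_sum _ _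
lemma norm_grad_sq (f : Eu n → ℝ) (x : Eu n) : ‖gradient f x‖ ^ 2 = ∑ i, pd f i x ^ 2 := by
  rw [EuclideanSpace.norm_sq_eq]
  refine Finset.sum_congr rfl fun i _ => ?_
  have : (gradient f x) i = pd f i x := by
    have h : inner ℝ (gradient f x) (EuclideanSpace.single i (1:ℝ)) = pd f i x := by
      unfold gradient pd; exact InnerProductSpace.toDual_symm_apply
    rw [← h, EuclideanSpace.inner_single_right]; simp
  rw [this]; simp
lemma ibp {f g : Eu n → ℝ} (i : Fin n) (hf : ContDiff ℝ 1 f) (hg : ContDiff ℝ 1 g)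
    (h : HasCompactSupport f ∨ HasCompactSupport g) :
    ∫ x, f x * pd g i x = - ∫ x, pd f i x * g x := by
  have hi : ∀ a b : Eu n → ℝ, Continuous a → Continuous b → (HasCompactSupport a ∨ HasCompactSupport b) →
      Integrable (fun x => a x * b x) := by
    intro a b ha hb hc
    apply (ha.mul hb).integrable_of_hasCompactSupport
    rcases hc with hc | hc
    · exact hc.mul_right
    · exact hc.mul_left
  apply integral_mul_fderiv_eq_neg_fderiv_mul_of_integrable
  · exact hi _ _ (pd_continuous i hf) hg.continuous (h.imp (pd_compact i) id)
  · exact hi _ _ hf.continuous (pd_continuous i hg) (h.imp id (pd_compact i))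
  · exact hi _ _ hf.continuous hg.continuous h
  · exact fun x _ => hf.differentiable (by norm_num) x
  · exact fun x _ => hg.differentiable (by norm_num) x
lemma ibp_lapl {f g : Eu n → ℝ} (hf : ContDiff ℝ 1 f) (hg : ContDiff ℝ 2 g)
    (h : HasCompactSupport f ∨ HasCompactSupport g) :
    ∫ x, f x * lapl g x = - ∫ x, ∑ i, pd f i x * pd g i x := by
  have hi : ∀ a b : Eu n → ℝ, Continuous a → Continuous b → (HasCompactSupport a ∨ HasCompactSupport b) →
      Integrable (fun x => a x * b x) := by
    intro a b ha hb hc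
    apply (ha.mul hb).integrable_of_hasCompactSupport
    rcases hc with hc | hc
    · exact hc.mul_right
    · exact hc.mul_left
  simp_rw [lapl_pd, Finset.mul_sum]
  rw [integral_finsetSum, integral_finsetSum, ← Finset.sum_neg_distrib]
  · exact Finset.sum_congr rfl fun i _ => ibp i hf (pd_contDiff i hg) (h.imp id (pd_compact i))
  · exact fun i _ => hi _ _ (pd_continuous i hf) (pd_continuous i (hg.of_le (by norm_num))) (h.imp (pd_compact i) (pd_compact i))
  · exact fun i _ => hi _ _ hf.continuous (pd_continuous i (pd_contDiff i hg)) (h.imp id fun h => pd_compact i (pd_compact i h))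
/-- truncated function is globally smooth -/
lemma trunc_contDiff {v : Eu n → ℝ} (hc : Continuous v) (hv0 : ∀ x, 0 ≤ v x)
    (h2 : ∀ x, 0 < v x → ContDiffAt ℝ 2 v x) {δ : ℝ} (hδ : 0 < δ) :
    ContDiff ℝ 2 (fun x => HT δ (v x)) := by
  rw [contDiff_iff_contDiffAt]
  intro x
  rcases eq_or_lt_of_le (hv0 x) with h | h
  · have : (fun x => HT δ (v x)) =ᶠ[𝓝 x] fun _ => 0 := by
      have : ∀ᶠ y in 𝓝 x, v y < δ := hc.continuousAt.eventually_lt_const (by rw [← h]; exact hδ)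
      filter_upwards [this] with y hy using HT_zero hδ hy.le
    exact contDiffAt_const.congr_of_eventuallyEq this
  · exact ((HT_smooth δ).of_le two_le_top).contDiffAt.comp x (h2 x h)
lemma trunc_compact {v : Eu n → ℝ} (hs : HasCompactSupport v) {δ : ℝ} (hδ : 0 < δ) :
    HasCompactSupport (fun x => HT δ (v x)) :=
  hs.comp_left (g := HT δ) (HT_zero hδ hδ.le)
lemma trunc_lapl_ge {v : Eu n → ℝ} (hc : Continuous v) (hv0 : ∀ x, 0 ≤ v x)
    (h2 : ∀ x, 0 < v x → ContDiffAt ℝ 2 v x) {δ : ℝ} (hδ : 0 < δ) (x : Eu n) (K : ℝ) (hK : 0 ≤ K)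
    (h : 0 < v x → - lapl v x ≤ K) : - lapl (fun x => HT δ (v x)) x ≤ K := by
  rcases eq_or_lt_of_le (hv0 x) with h' | h'
  · have : (fun x => HT δ (v x)) =ᶠ[𝓝 x] fun _ => 0 := by
      have : ∀ᶠ y in 𝓝 x, v y < δ := hc.continuousAt.eventually_lt_const (by rw [← h']; exact hδ)
      filter_upwards [this] with y hy using HT_zero hδ hy.le
    rw [lapl_congr this]; simp [lapl, hK]
  · rw [lapl_comp ((HT_smooth δ).of_le two_le_top) (h2 x h')]
    have h1 := HT_deriv2 hδ (v x)
    have h3 : 0 ≤ deriv (deriv (HT δ)) (v x) * ∑ i, pd v i x ^ 2 := mul_nonneg h1 (Finset.sum_nonneg fun i _ => sq_nonneg _)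
    have h4 : deriv (HT δ) (v x) = Real.smoothTransition (v x / δ - 1) := by rw [HT_deriv' hδ]
    have h5 := Real.smoothTransition.nonneg (v x / δ - 1)
    have h6 := Real.smoothTransition.le_one (v x / δ - 1)
    rw [h4]
    have := h h'
    nlinarith
lemma aff_fderiv {f : Eu n → ℝ} (x0 : Eu n) (t : ℝ) (y : Eu n)
    (hf : DifferentiableAt ℝ f (x0 + t • y)) :
    HasFDerivAt (fun y => f (x0 + t • y)) (t • fderiv ℝ f (x0 + t • y)) y := by
  have h1 : HasFDerivAt (fun y : Eu n => x0 + t • y) (t • ContinuousLinearMap.id ℝ (Eu n)) y :=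
    ((hasFDerivAt_id y).const_smul t).const_add x0
  have := hf.hasFDerivAt.comp y h1
  refine this.congr_fderiv ?_
  ext z; simp
lemma pd_aff {f : Eu n → ℝ} (i : Fin n) (x0 : Eu n) (t : ℝ) (y : Eu n)
    (hf : DifferentiableAt ℝ f (x0 + t • y)) :
    pd (fun y => f (x0 + t • y)) i y = t * pd f i (x0 + t • y) := by
  unfold pd; rw [(aff_fderiv x0 t y hf).fderiv]; rfl
lemma lapl_aff {f : Eu n → ℝ} (x0 : Eu n) (t : ℝ) (y : Eu n)
    (hf : ContDiffAt ℝ 2 f (x0 + t • y)) :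
    lapl (fun y => f (x0 + t • y)) y = t ^ 2 * lapl f (x0 + t • y) := by
  rw [lapl_pd, lapl_pd, Finset.mul_sum]
  refine Finset.sum_congr rfl fun i _ => ?_
  have hc : ContinuousAt (fun y : Eu n => x0 + t • y) y := by fun_prop
  have hvd : ∀ᶠ y in 𝓝 y, DifferentiableAt ℝ f (x0 + t • y) := by
    have := hc.eventually (hf.eventually (by simp))
    filter_upwards [this] with y hy using hy.differentiableAt (by norm_num)
  have e : pd (fun y => f (x0 + t • y)) i =ᶠ[𝓝 y] fun y => t * (pd f i (x0 + t • y)) := by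
    filter_upwards [hvd] with z hz using pd_aff i x0 t z hz
  have hd := (pd_contDiffAt i hf).differentiableAt one_ne_zero
  rw [pd_congr i e, pd_mul i (by fun_prop) (aff_fderiv x0 t y hd).differentiableAt, pd_aff i x0 t y hd]
  simp only [pd, fderiv_fun_const]
  simp; ring
/-- potential weight -/
def PPw (y : Eu n) : ℝ := hT (3 * (1 - ‖y‖ ^ 2))
/-- density weight -/
def rrw (y : Eu n) : ℝ := 6 * Real.smoothTransition (3 * (1 - ‖y‖ ^ 2) - 1)
lemma PPw_smooth : ContDiff ℝ (⊤ : ℕ∞) (PPw (n := n)) := by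
  unfold PPw
  exact hT_smooth.comp (contDiff_const.mul (contDiff_const.sub (contDiff_norm_sq ℝ)))
lemma rrw_cont : Continuous (rrw (n := n)) := by
  unfold rrw
  exact continuous_const.mul (Real.smoothTransition.continuous.comp (by fun_prop))
lemma rrw_nonneg (y : Eu n) : 0 ≤ rrw y := mul_nonneg (by norm_num) (Real.smoothTransition.nonneg _)
lemma rrw_le (y : Eu n) : rrw y ≤ 6 := by
  have := Real.smoothTransition.le_one (3 * (1 - ‖y‖ ^ 2) - 1)
  unfold rrw; linarith
lemma rrw_zero {y : Eu n} (h : 1 ≤ ‖y‖) : rrw y = 0 := by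
  unfold rrw; rw [Real.smoothTransition.zero_of_nonpos, mul_zero]; nlinarith
lemma PPw_zero {y : Eu n} (h : 1 ≤ ‖y‖) : PPw y = 0 := by
  unfold PPw; rw [hT_zero]; nlinarith
lemma cs_of_ball {f : Eu n → ℝ} (h : ∀ y, 1 ≤ ‖y‖ → f y = 0) : HasCompactSupport f := by
  apply HasCompactSupport.intro (isCompact_closedBall (0:Eu n) 1)
  intro x hx
  apply h
  simp at hx; exact hx.le
lemma pd_normsq (i : Fin n) (y : Eu n) : pd (fun y : Eu n => ‖y‖ ^ 2) i y = 2 * y i := by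
  unfold pd
  rw [fderiv_norm_sq_apply]
  simp [EuclideanSpace.inner_single_right]
lemma pd_PPw (i : Fin n) (y : Eu n) : pd PPw i y = - (rrw y * y i) := by
  have hd : Differentiable ℝ (fun y : Eu n => ‖y‖ ^ 2) := (contDiff_norm_sq ℝ (n := 1)).differentiable one_ne_zero
  have : PPw (n := n) = fun y => (fun t => hT (3 * (1 - t))) ((fun y : Eu n => ‖y‖^2) y) := rfl
  have h2 : HasDerivAt (fun t => hT (3 * (1 - t))) (Real.smoothTransition (3 * (1 - ‖y‖ ^ 2) - 1) * (3 * (-1))) (‖y‖ ^ 2) := by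
    have h3 : HasDerivAt (fun t : ℝ => 3 * (1 - t)) (3 * (-1)) (‖y‖ ^ 2) := ((hasDerivAt_id _).const_sub 1).const_mul 3
    exact (hT_deriv (3 * (1 - ‖y‖ ^ 2))).comp (‖y‖^2) h3
  rw [this, pd_comp i h2.differentiableAt (hd y), h2.deriv, pd_normsq]
  unfold rrw; ring
lemma rrw_int_pos : 0 < ∫ y : Eu n, rrw y := by
  apply (rrw_cont).integral_pos_of_hasCompactSupport_nonneg_nonzero (cs_of_ball fun y h => rrw_zero h) rrw_nonneg (x := 0)
  unfold rrw; rw [Real.smoothTransition.one_of_one_le] <;> norm_num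
lemma PPw_int_nonneg : 0 ≤ ∫ y : Eu n, PPw y := integral_nonneg fun _ => hT_nonneg _
lemma mv_core {f : Eu n → ℝ} (hf : ContDiff ℝ 2 f) (hs : HasCompactSupport f) (x0 : Eu n)
    {r K : ℝ} (hr : 0 < r) (hK : ∀ y ∈ ball x0 r, - lapl f y ≤ K) :
    f x0 * ∫ y : Eu n, rrw y ≤ (∫ y, f (x0 + r • y) * rrw y) + K * r ^ 2 / 2 * ∫ y : Eu n, PPw y := by
  obtain ⟨M, hM⟩ := (hs.fderiv ℝ).exists_bound_of_continuous (hf.continuous_fderiv (by norm_num))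
  have hrc : HasCompactSupport (rrw (n := n)) := cs_of_ball fun y h => rrw_zero h
  have hder : ∀ t : ℝ, HasDerivAt (fun t : ℝ => ∫ y, f (x0 + t • y) * rrw y)
      (∫ y, fderiv ℝ f (x0 + t • y) y * rrw y) t := by
    intro t
    refine (hasDerivAt_integral_of_dominated_loc_of_deriv_le (F := fun t y => f (x0 + t • y) * rrw y)
      (F' := fun t y => fderiv ℝ f (x0 + t • y) y * rrw y) (bound := fun y => M * ‖y‖ * rrw y)
      (s := Set.univ) univ_mem ?_ ?_ ?_ ?_ ?_ ?_).2
    · refine Eventually.of_forall fun t => Continuous.aestronglyMeasurable ?_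
      exact (hf.continuous.comp (by fun_prop)).mul rrw_cont
    · apply Continuous.integrable_of_hasCompactSupport
      · exact (hf.continuous.comp (by fun_prop)).mul rrw_cont
      · exact hrc.mul_left
    · apply Continuous.aestronglyMeasurable
      refine Continuous.mul ?_ rrw_cont
      exact ((hf.continuous_fderiv (by norm_num)).comp (by fun_prop)).clm_apply continuous_id
    · refine Eventually.of_forall fun y t _ => ?_
      rw [norm_mul, Real.norm_of_nonneg (rrw_nonneg y)]
      refine mul_le_mul_of_nonneg_right ?_ (rrw_nonneg y)
      exact (ContinuousLinearMap.le_opNorm _ _).trans (mul_le_mul_of_nonneg_right (hM _) (norm_nonneg _))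
    · apply Continuous.integrable_of_hasCompactSupport
      · exact (by fun_prop : Continuous fun y : Eu n => M * ‖y‖).mul rrw_cont
      · exact hrc.mul_left
    · refine Eventually.of_forall fun y t _ => ?_
      refine HasDerivAt.mul_const ?_ _
      have h1 : HasDerivAt (fun t : ℝ => x0 + t • y) y t := by
        simpa using ((hasDerivAt_id t).smul_const y).const_add x0
      exact (hf.differentiable (by norm_num) _).hasFDerivAt.comp_hasDerivAt t h1
  have hval : ∀ t : ℝ, 0 < t → t < r → - (K * t * ∫ y : Eu n, PPw y) ≤ ∫ y, fderiv ℝ f (x0 + t • y) y * rrw y := by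
    intro t ht htr
    have hg : ContDiff ℝ 2 (fun y => f (x0 + t • y)) := hf.comp (by fun_prop)
    have hP : HasCompactSupport (PPw (n := n)) := cs_of_ball fun y h => PPw_zero h
    have h1 := ibp_lapl (f := PPw) (g := fun y => f (x0 + t • y)) (PPw_smooth.of_le (by exact_mod_cast le_top)) hg (Or.inl hP)
    have h2 : (∫ x, ∑ i, pd PPw i x * pd (fun y => f (x0 + t • y)) i x) = - (t * ∫ y, fderiv ℝ f (x0 + t • y) y * rrw y) := by
      rw [← integral_const_mul, ← integral_neg]
      congr 1; ext y
      rw [fderiv_apply_eq, Finset.sum_mul, Finset.mul_sum, ← Finset.sum_neg_distrib]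
      refine Finset.sum_congr rfl fun i _ => ?_
      rw [pd_PPw, pd_aff i x0 t y (hf.differentiable (by norm_num) _)]; ring
    rw [h2, neg_neg] at h1
    have h3 : - (K * t ^ 2) * ∫ y : Eu n, PPw y ≤ ∫ y, PPw y * lapl (fun y => f (x0 + t • y)) y := by
      rw [← integral_const_mul]
      apply integral_mono
      · exact (continuous_const.mul PPw_smooth.continuous).integrable_of_hasCompactSupport hP.mul_left
      · exact (PPw_smooth.continuous.mul (lapl_continuous hg)).integrable_of_hasCompactSupport hP.mul_right
      · intro y
        simp only
        rcases le_or_gt 1 ‖y‖ with hy | hy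
        · rw [PPw_zero hy]; simp
        · rw [lapl_aff x0 t y hf.contDiffAt]
          have h4 := hK (x0 + t • y) (by
            rw [mem_ball, dist_eq_norm]; simp only [add_sub_cancel_left, norm_smul, Real.norm_of_nonneg ht.le]
            nlinarith [norm_nonneg y])
          have h5 : 0 ≤ PPw y := hT_nonneg _
          have h6 : 0 ≤ PPw y * t ^ 2 := by positivity
          nlinarith
    rw [h1] at h3
    have h7 : t * (- (K * t * ∫ y : Eu n, PPw y)) ≤ t * ∫ y, fderiv ℝ f (x0 + t • y) y * rrw y := by nlinarith
    exact le_of_mul_le_mul_left h7 ht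
  set I := ∫ y : Eu n, PPw y
  have hG : ∀ t : ℝ, HasDerivAt (fun t : ℝ => (∫ y, f (x0 + t • y) * rrw y) + K * I / 2 * t ^ 2)
      ((∫ y, fderiv ℝ f (x0 + t • y) y * rrw y) + K * I / 2 * (2 * t)) t := by
    intro t
    exact (hder t).add (by simpa using ((hasDerivAt_pow 2 t).const_mul (K * I / 2)))
  have hm : MonotoneOn (fun t : ℝ => (∫ y, f (x0 + t • y) * rrw y) + K * I / 2 * t ^ 2) (Set.Icc 0 r) := by
    apply monotoneOn_of_deriv_nonneg (convex_Icc 0 r)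
    · exact fun t _ => (hG t).continuousAt.continuousWithinAt
    · exact fun t _ => (hG t).differentiableAt.differentiableWithinAt
    · intro t ht
      rw [interior_Icc] at ht
      rw [(hG t).deriv]
      have := hval t ht.1 ht.2
      linarith
  have := hm ⟨le_refl _, hr.le⟩ ⟨hr.le, le_refl _⟩ hr.le
  simp only [zero_smul, add_zero, integral_const_mul] at this
  linarith
lemma f_le_t {s t f : ℝ} (hs : 1 < s) (ht : 0 < t) (hf : 0 ≤ f) : f ≤ t + t ^ (1 - s) * f ^ s := by
  rcases le_or_gt f t with h | h
  · have : 0 ≤ t ^ (1-s) * f ^ s := by positivity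
    linarith
  · have hf' : 0 < f := ht.trans h
    have : f ≤ t ^ (1 - s) * f ^ s := by
      have h1 : f ^ (1-s) ≤ t ^ (1 - s) := rpow_le_rpow_of_nonpos ht h.le (by linarith)
      calc f = f ^ (1 - s) * f ^ s := by rw [← rpow_add hf']; simp
        _ ≤ _ := by gcongr
    linarith
lemma integral_ball_aff (hn : 3 ≤ n) {g : Eu n → ℝ} (x0 : Eu n) {r : ℝ} (hr : 0 < r) :
    ∫ y, g (x0 + r • y) = r ^ (-(n:ℝ)) * ∫ y, g y := by
  have h1 := Measure.integral_comp_smul (volume : Measure (Eu n)) (fun y => g (x0 + y)) r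
  rw [h1, integral_add_left_eq_self g x0]
  simp only [finrank_euclideanSpace, Fintype.card_fin, smul_eq_mul]
  rw [abs_of_pos (by positivity), rpow_neg hr.le, rpow_natCast]
lemma sob_gt (hn : 3 ≤ n) : 2 < sob n := by
  have := p_gt hn
  unfold sob; linarith
lemma exists_mv (hn : 3 ≤ n) : ∃ C > 0, ∀ (v : Eu n → ℝ) (x0 : Eu n) (r K t M : ℝ), 0 < r → 0 ≤ K → 0 < t → 0 ≤ M →
    Continuous v → HasCompactSupport v → (∀ x, 0 ≤ v x) → (∀ x, 0 < v x → ContDiffAt ℝ 2 v x) →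
    (∀ y ∈ ball x0 r, 0 < v y → - lapl v y ≤ K) →
    (∫⁻ y in ball x0 r, oR (v y ^ sob n)) ≤ oR M →
    v x0 ≤ t + C * (t ^ (1 - sob n) * r ^ (-(n:ℝ)) * M + K * r ^ 2) := by
  have hI := rrw_int_pos (n := n)
  have hP := PPw_int_nonneg (n := n)
  set I := ∫ y : Eu n, rrw y with hIdef
  set J := ∫ y : Eu n, PPw y with hJdef
  have hs1 : 1 < sob n := by linarith [sob_gt hn]
  have hs0 : 0 < sob n := by linarith
  refine ⟨6 / I + J / I, by positivity, ?_⟩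
  intro v x0 r K t M hr hK ht hM hc hcs hv0 h2 hlap hint
  have hrc : HasCompactSupport (rrw (n := n)) := cs_of_ball fun y h => rrw_zero h
  have hvs : Continuous (fun y => v y ^ sob n) := hc.rpow_const fun _ => Or.inr hs0.le
  have hvsc : HasCompactSupport (fun y => v y ^ sob n) :=
    hcs.comp_left (g := fun t : ℝ => t ^ sob n) (Real.zero_rpow hs0.ne')
  have hvsi : Integrable (fun y => v y ^ sob n) := hvs.integrable_of_hasCompactSupport hvsc
  -- integral bound
  have hMb : ∫ y in ball x0 r, v y ^ sob n ≤ M := by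
    rw [← ofReal_integral_eq_lintegral_ofReal hvsi.integrableOn (Eventually.of_forall fun y => rpow_nonneg (hv0 y) _)] at hint
    exact (ENNReal.ofReal_le_ofReal_iff hM).1 hint
  have h6 : ∫ y, v (x0 + r • y) ^ sob n * rrw y ≤ 6 * (r ^ (-(n:ℝ)) * M) := by
    have hind : ∀ y, v (x0 + r • y) ^ sob n * rrw y ≤ 6 * (ball x0 r).indicator (fun y => v y ^ sob n) (x0 + r • y) := by
      intro y
      rcases le_or_gt 1 ‖y‖ with hy | hy
      · rw [rrw_zero hy, mul_zero]
        refine mul_nonneg (by norm_num) (Set.indicator_nonneg (fun z _ => rpow_nonneg (hv0 z) _) _)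
      · rw [Set.indicator_of_mem]
        · have := rrw_le y
          have h3 : 0 ≤ v (x0 + r • y) ^ sob n := rpow_nonneg (hv0 _) _
          nlinarith
        · rw [mem_ball, dist_eq_norm]; simp only [add_sub_cancel_left, norm_smul, Real.norm_of_nonneg hr.le]
          nlinarith
    have hie : Integrable (fun y => (ball x0 r).indicator (fun y => v y ^ sob n) (x0 + r • y)) := by
      have : Integrable (fun y => (ball x0 r).indicator (fun y => v y ^ sob n) (x0 + y)) :=
        (hvsi.indicator measurableSet_ball).comp_add_left x0
      exact this.comp_smul hr.ne'
    calc _ ≤ ∫ y, 6 * (ball x0 r).indicator (fun y => v y ^ sob n) (x0 + r • y) := by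
          apply integral_mono _ (hie.const_mul 6) hind
          apply Continuous.integrable_of_hasCompactSupport
          · exact (hvs.comp (by fun_prop : Continuous fun y => x0 + r • y)).mul rrw_cont
          · exact hrc.mul_left
      _ = 6 * (r ^ (-(n:ℝ)) * ∫ y in ball x0 r, v y ^ sob n) := by
          rw [integral_const_mul, integral_ball_aff hn x0 hr, integral_indicator measurableSet_ball]
      _ ≤ _ := by gcongr
  have key : ∀ δ : ℝ, 0 < δ → v x0 ≤ 2 * δ + (t + (6 / I + J / I) * (t ^ (1 - sob n) * r ^ (-(n:ℝ)) * M + K * r ^ 2)) := by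
    intro δ hδ
    have h3 := mv_core (trunc_contDiff hc hv0 h2 hδ) (trunc_compact hcs hδ) x0 hr
      (K := K) (fun y hy => trunc_lapl_ge hc hv0 h2 hδ y K hK (hlap y hy))
    rw [← hIdef, ← hJdef] at h3
    have h4 : (v x0 - 2 * δ) * I ≤ HT δ (v x0) * I := mul_le_mul_of_nonneg_right (HT_ge hδ _) hI.le
    have h5 : ∫ y, HT δ (v (x0 + r • y)) * rrw y ≤ t * I + t ^ (1 - sob n) * (6 * (r ^ (-(n:ℝ)) * M)) := by
      calc _ ≤ ∫ y, (t * rrw y + t ^ (1 - sob n) * (v (x0 + r • y) ^ sob n * rrw y)) := by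
            apply integral_mono
            · apply Continuous.integrable_of_hasCompactSupport
              · exact ((HT_smooth δ).continuous.comp (hc.comp (by fun_prop : Continuous fun y => x0 + r • y))).mul rrw_cont
              · exact hrc.mul_left
            · apply Continuous.integrable_of_hasCompactSupport
              · exact (continuous_const.mul rrw_cont).add (continuous_const.mul ((hvs.comp (by fun_prop : Continuous fun y => x0 + r • y)).mul rrw_cont))
              · exact (hrc.mul_left).add (hrc.mul_left.mul_left)
            · intro y
              simp only
              have h7 := (HT_le hδ (hv0 (x0 + r • y))).trans (f_le_t hs1 ht (hv0 (x0 + r • y)))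
              have := mul_le_mul_of_nonneg_right h7 (rrw_nonneg y)
              linarith
        _ = t * I + t ^ (1 - sob n) * ∫ y, v (x0 + r • y) ^ sob n * rrw y := by
            rw [integral_add, integral_const_mul, integral_const_mul]
            · exact (continuous_const.mul rrw_cont).integrable_of_hasCompactSupport hrc.mul_left
            · exact (continuous_const.mul ((hvs.comp (by fun_prop : Continuous fun y => x0 + r • y)).mul rrw_cont)).integrable_of_hasCompactSupport hrc.mul_left.mul_left
        _ ≤ _ := by gcongr
    have h8 : (v x0 - 2 * δ - t) * I ≤ (6 + J) * (t ^ (1 - sob n) * r ^ (-(n:ℝ)) * M + K * r ^ 2) := by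
      have a1 : 0 ≤ t ^ (1 - sob n) * r ^ (-(n:ℝ)) * M := by positivity
      have a2 : 0 ≤ K * r ^ 2 := by positivity
      have a3 := mul_nonneg hP a1
      have a4 := mul_nonneg hP a2
      nlinarith
    have h9 : v x0 - 2 * δ - t ≤ (6 / I + J / I) * (t ^ (1 - sob n) * r ^ (-(n:ℝ)) * M + K * r ^ 2) := by
      rw [← add_div, div_mul_eq_mul_div, le_div_iff₀ hI]; exact h8
    linarith
  refine le_of_forall_pos_le_add fun e he => ?_
  have := key (e/2) (by positivity)
  linarith
lemma lapl_comp_at {H : ℝ → ℝ} {v : Eu n → ℝ} {x : Eu n}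
    (hH : ContDiffAt ℝ 2 H (v x)) (hv : ContDiffAt ℝ 2 v x) :
    lapl (fun y => H (v y)) x = deriv H (v x) * lapl v x +
      deriv (deriv H) (v x) * ∑ i, pd v i x ^ 2 := by
  rw [lapl_pd, lapl_pd, Finset.mul_sum, Finset.mul_sum, ← Finset.sum_add_distrib]
  refine Finset.sum_congr rfl fun i _ => ?_
  have hH1 : DifferentiableAt ℝ (deriv H) (v x) := by
    have := (hH.fderiv_right (m := 1) (by norm_num)).differentiableAt one_ne_zero
    have e : deriv H = fun y => fderiv ℝ H y 1 := by ext y; simp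
    rw [e]; exact this.clm_apply (differentiableAt_const _)
  have hvd : ∀ᶠ y in 𝓝 x, DifferentiableAt ℝ v y := by
    have := hv.eventually (by simp)
    filter_upwards [this] with y hy using hy.differentiableAt (by norm_num)
  have hHd : ∀ᶠ y in 𝓝 x, DifferentiableAt ℝ H (v y) := by
    have := hv.continuousAt.eventually (hH.eventually (by simp))
    filter_upwards [this] with y hy using hy.differentiableAt (by norm_num)
  have e : pd (fun y => H (v y)) i =ᶠ[𝓝 x] fun y => deriv H (v y) * pd v i y := by
    filter_upwards [hvd, hHd] with y hy hy'
    exact pd_comp i hy' hy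
  rw [pd_congr i e, pd_mul (f := fun y => deriv H (v y)), pd_comp i hH1 hvd.self_of_nhds]
  · ring
  · exact hH1.comp x hvd.self_of_nhds
  · exact (pd_contDiffAt i hv).differentiableAt (by norm_num)
lemma lapl_normsq (x : Eu n) : lapl (fun y : Eu n => ‖y‖ ^ 2) x = 2 * n := by
  rw [lapl_pd]
  have : ∀ i : Fin n, pd (pd (fun y : Eu n => ‖y‖ ^ 2) i) i x = 2 := by
    intro i
    have e : pd (fun y : Eu n => ‖y‖ ^ 2) i = fun y => 2 * (EuclideanSpace.proj i : Eu n →L[ℝ] ℝ) y := by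
      ext y; rw [pd_normsq]; rfl
    rw [e]; unfold pd
    rw [fderiv_const_mul (ContinuousLinearMap.differentiableAt _), ContinuousLinearMap.fderiv]
    simp
  simp [this]; ring
lemma lapl_rpow (σ : ℝ) {x : Eu n} (hx : x ≠ 0) :
    lapl (fun y : Eu n => ‖y‖ ^ (-σ)) x = σ * (σ + 2 - n) * ‖x‖ ^ (-σ - 2) := by
  have hx0 : 0 < ‖x‖ := norm_pos_iff.2 hx
  have e : (fun y : Eu n => ‖y‖ ^ (-σ)) = fun y => (fun t : ℝ => t ^ (-σ/2)) ((fun y : Eu n => ‖y‖ ^ 2) y) := by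
    ext y
    simp only
    rw [← rpow_natCast, ← rpow_mul (norm_nonneg _)]
    congr 1; push_cast; ring
  have h2 : ‖x‖ ^ 2 ≠ 0 := by positivity
  rw [e, lapl_comp_at (H := fun t : ℝ => t ^ (-σ/2)) (v := fun y : Eu n => ‖y‖ ^ 2) (Real.contDiffAt_rpow_const_of_ne h2)
    (contDiff_norm_sq ℝ).contDiffAt, lapl_normsq]
  have d1 : ∀ (τ t : ℝ), t ≠ 0 → deriv (fun t : ℝ => t ^ τ) t = τ * t ^ (τ - 1) := fun τ t ht =>
    (Real.hasDerivAt_rpow_const (Or.inl ht)).deriv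
  have d2 : deriv (deriv (fun t : ℝ => t ^ (-σ/2))) (‖x‖ ^ 2) = (-σ/2) * ((-σ/2 - 1) * (‖x‖ ^ 2) ^ (-σ/2 - 1 - 1)) := by
    have : deriv (fun t : ℝ => t ^ (-σ/2)) =ᶠ[𝓝 (‖x‖^2)] fun t => (-σ/2) * t ^ (-σ/2-1) := by
      filter_upwards [isOpen_ne.mem_nhds h2] with t ht using d1 _ _ ht
    rw [this.deriv_eq, deriv_const_mul_field, d1 _ _ h2]
  rw [d1 _ _ h2, d2]
  have h3 : ∑ i, pd (fun y : Eu n => ‖y‖ ^ 2) i x ^ 2 = 4 * ‖x‖ ^ 2 := by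
    rw [EuclideanSpace.norm_sq_eq, Finset.mul_sum]
    refine Finset.sum_congr rfl fun i _ => ?_
    rw [pd_normsq]; simp; ring
  rw [h3]
  have hp : ∀ τ : ℝ, (‖x‖ ^ 2) ^ τ = ‖x‖ ^ (2 * τ) := by
    intro τ; rw [← rpow_natCast, ← rpow_mul (norm_nonneg _)]; norm_num
  rw [hp, hp]
  have e1 : ‖x‖ ^ (2 * (-σ/2 - 1)) = ‖x‖ ^ (-σ - 2) := by congr 1; ring
  have e2 : ‖x‖ ^ (2 * (-σ/2 - 1 - 1)) * ‖x‖ ^ 2 = ‖x‖ ^ (-σ - 2) := by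
    rw [← rpow_natCast, ← rpow_add hx0]; congr 1; push_cast; ring
  rw [e1]
  linear_combination (-σ/2) * (-σ/2 - 1) * 4 * e2
lemma rpow_norm_contDiffAt (σ : ℝ) {x : Eu n} (hx : x ≠ 0) :
    ContDiffAt ℝ 2 (fun y : Eu n => ‖y‖ ^ (-σ)) x :=
  (contDiffAt_norm ℝ hx).rpow_const_of_ne (norm_ne_zero_iff.2 hx)
lemma lapl_sub_mul {f g : Eu n → ℝ} {x : Eu n} (c : ℝ)
    (hf : ContDiffAt ℝ 2 f x) (hg : ContDiffAt ℝ 2 g x) :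
    lapl (fun y => f y - c * g y) x = lapl f x - c * lapl g x := by
  rw [lapl_pd, lapl_pd, lapl_pd, Finset.mul_sum, ← Finset.sum_sub_distrib]
  refine Finset.sum_congr rfl fun i _ => ?_
  have key : ∀ (a b : Eu n → ℝ) (y : Eu n), DifferentiableAt ℝ a y → DifferentiableAt ℝ b y →
      pd (fun y => a y - c * b y) i y = pd a i y - c * pd b i y := by
    intro a b y ha hb
    unfold pd
    have := (ha.hasFDerivAt.sub (hb.hasFDerivAt.const_mul c)).fderiv
    have e : fderiv ℝ (fun y => a y - c * b y) y = _ := this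
    rw [e]; rfl
  have e : pd (fun y => f y - c * g y) i =ᶠ[𝓝 x] fun y => pd f i y - c * pd g i y := by
    filter_upwards [hf.eventually (by simp), hg.eventually (by simp)] with y h1 h2
    exact key _ _ _ (h1.differentiableAt two_ne_zero) (h2.differentiableAt two_ne_zero)
  rw [pd_congr i e, key _ _ _ ((pd_contDiffAt i hf).differentiableAt one_ne_zero) ((pd_contDiffAt i hg).differentiableAt one_ne_zero)]
lemma lapl_nonpos_of_isLocalMax {f : Eu n → ℝ} {x : Eu n} (hf : ContDiffAt ℝ 2 f x)
    (hm : IsLocalMax f x) : lapl f x ≤ 0 := by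
  rw [lapl_pd]
  refine Finset.sum_nonpos fun i _ => ?_
  set e : Eu n := EuclideanSpace.single i 1
  have hl : ∀ t : ℝ, HasDerivAt (fun t : ℝ => x + t • e) e t := fun t => by
    simpa using ((hasDerivAt_id t).smul_const e).const_add x
  have hl0 : Tendsto (fun t : ℝ => x + t • e) (𝓝 0) (𝓝 x) := by
    have := (hl 0).continuousAt.tendsto
    simpa using this
  have hD : ∀ (g : Eu n → ℝ) (t : ℝ), DifferentiableAt ℝ g (x + t • e) →
      HasDerivAt (fun t : ℝ => g (x + t • e)) (pd g i (x + t • e)) t := by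
    intro g t hg
    exact hg.hasFDerivAt.comp_hasDerivAt t (hl t)
  set g : ℝ → ℝ := fun t => f (x + t • e) with hg
  have hd : deriv g =ᶠ[𝓝 0] fun t => pd f i (x + t • e) := by
    filter_upwards [hl0.eventually (hf.eventually (by simp))] with t ht
    exact (hD f t (ht.differentiableAt two_ne_zero)).deriv
  have hdd : deriv (deriv g) 0 = pd (pd f i) i x := by
    rw [hd.deriv_eq]
    have := (hD (pd f i) 0 (by simpa using (pd_contDiffAt i hf).differentiableAt one_ne_zero)).deriv
    simpa using this
  have hgm : IsLocalMax g 0 := by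
    have : ∀ᶠ t in 𝓝 (0:ℝ), f (x + t • e) ≤ f x := hl0.eventually hm
    filter_upwards [this] with t ht
    simpa [hg] using ht
  by_contra hcon
  push Not at hcon
  have hmin : IsLocalMin g 0 := by
    apply isLocalMin_of_deriv_deriv_pos (by rw [hdd]; exact hcon) hgm.deriv_eq_zero
    exact (hD f 0 (by simpa using hf.differentiableAt two_ne_zero)).continuousAt
  have hconst : g =ᶠ[𝓝 0] fun _ => g 0 := by
    filter_upwards [hgm, hmin] with t h1 h2 using le_antisymm h1 h2
  have h0 : deriv g =ᶠ[𝓝 0] fun _ => 0 := by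
    filter_upwards [eventually_eventually_nhds.2 hconst] with t ht
    have := Filter.EventuallyEq.deriv_eq ht
    simpa using this
  have := h0.deriv_eq
  rw [hdd] at this
  simp at this
  linarith
/-- maximum principle for quotients -/
lemma max_ratio {v b : Eu n → ℝ} {R : ℝ} (hR : 0 < R) (hc : Continuous v) (hs : HasCompactSupport v)
    (hv0 : ∀ x, 0 ≤ v x) (h2 : ∀ x, 0 < v x → ContDiffAt ℝ 2 v x)
    (hb : ∀ x, R ≤ ‖x‖ → ContDiffAt ℝ 2 b x) (hb0 : ∀ x, R ≤ ‖x‖ → 0 < b x) :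
    ∃ A, 0 ≤ A ∧ (∀ x, R ≤ ‖x‖ → v x ≤ A * b x) ∧ (A = 0 ∨ ∃ x0, R ≤ ‖x0‖ ∧ v x0 = A * b x0 ∧ 0 < v x0 ∧
      (R < ‖x0‖ → A * (- lapl b x0) ≤ - lapl v x0)) := by
  set S : Set (Eu n) := tsupport v ∩ {x | R ≤ ‖x‖} with hS
  have hSc : IsCompact S := hs.isCompact.inter_right (isClosed_le continuous_const continuous_norm)
  rcases S.eq_empty_or_nonempty with he | hne
  · refine ⟨0, le_refl _, fun x hx => ?_, Or.inl rfl⟩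
    have : x ∉ tsupport v := fun h => by
      have : x ∈ S := ⟨h, hx⟩
      rw [he] at this; exact this
    rw [image_eq_zero_of_notMem_tsupport this]; simp
  · obtain ⟨x0, hx0, hmax⟩ := hSc.exists_isMaxOn hne (f := fun x => v x / b x) (by
      intro x hx
      exact (hc.continuousAt.div (hb x hx.2).continuousAt (hb0 x hx.2).ne').continuousWithinAt)
    have hA0 : 0 ≤ v x0 / b x0 := div_nonneg (hv0 _) (hb0 _ hx0.2).le
    have hle : ∀ x, R ≤ ‖x‖ → v x ≤ v x0 / b x0 * b x := by
      intro x hx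
      by_cases h : x ∈ tsupport v
      · have : v x / b x ≤ v x0 / b x0 := hmax ⟨h, hx⟩
        rwa [div_le_iff₀ (hb0 x hx)] at this
      · rw [image_eq_zero_of_notMem_tsupport h]
        exact mul_nonneg hA0 (hb0 x hx).le
    refine ⟨v x0 / b x0, hA0, hle, ?_⟩
    rcases eq_or_lt_of_le (hv0 x0) with h0 | h0
    · left; rw [← h0]; simp
    · right
      have heq : v x0 = v x0 / b x0 * b x0 := by field_simp [(hb0 _ hx0.2).ne']
      refine ⟨x0, hx0.2, heq, h0, fun hlt => ?_⟩
      set A := v x0 / b x0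
      have hloc : IsLocalMax (fun y => v y - A * b y) x0 := by
        have : ∀ᶠ y in 𝓝 x0, R < ‖y‖ := continuous_norm.continuousAt.eventually_const_lt hlt
        filter_upwards [this] with y hy
        have := hle y hy.le
        linarith
      have := lapl_nonpos_of_isLocalMax ((h2 x0 h0).sub (contDiffAt_const.mul (hb x0 hx0.2))) hloc
      rw [lapl_sub_mul A (h2 x0 h0) (hb x0 hx0.2)] at this
      linarith
/-- profile of the bubble -/
def Bb (n : ℕ) (x : Eu n) : ℝ := (1 + ‖x‖ ^ 2) ^ (-(((n:ℝ) - 2) / 2))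
lemma Bb_pos (x : Eu n) : 0 < Bb n x := by unfold Bb; positivity
lemma Bb_cont : Continuous (Bb n) := by
  unfold Bb
  exact (by fun_prop : Continuous fun x : Eu n => 1 + ‖x‖ ^ 2).rpow_const fun x => Or.inl (by positivity)
lemma Bb_le_one (hn : 3 ≤ n) (x : Eu n) : Bb n x ≤ 1 := by
  have := al_pos hn
  unfold Bb
  apply rpow_le_one_of_one_le_of_nonpos
  · nlinarith [sq_nonneg ‖x‖]
  · linarith
lemma Bb_le (hn : 3 ≤ n) {x : Eu n} (hx : 0 < ‖x‖) : Bb n x ≤ ‖x‖ ^ (-((n:ℝ) - 2)) := by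
  have := al_pos hn
  have e : ‖x‖ ^ (-((n:ℝ) - 2)) = (‖x‖ ^ 2) ^ (-(((n:ℝ) - 2) / 2)) := by
    rw [← rpow_natCast, ← rpow_mul (norm_nonneg _)]; congr 1; push_cast; ring
  rw [e]; unfold Bb
  apply rpow_le_rpow_of_nonpos (by positivity) (by linarith) (by linarith)
lemma Bb_ge (hn : 3 ≤ n) {x : Eu n} (hx : 1 ≤ ‖x‖) : (2:ℝ) ^ (-(((n:ℝ) - 2) / 2)) * ‖x‖ ^ (-((n:ℝ) - 2)) ≤ Bb n x := by
  have := al_pos hn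
  have e : ‖x‖ ^ (-((n:ℝ) - 2)) = (‖x‖ ^ 2) ^ (-(((n:ℝ) - 2) / 2)) := by
    rw [← rpow_natCast, ← rpow_mul (norm_nonneg _)]; congr 1; push_cast; ring
  rw [e, ← Real.mul_rpow (by norm_num) (by positivity)]; unfold Bb
  apply rpow_le_rpow_of_nonpos (by positivity) (by nlinarith) (by linarith)
/-- majorant -/
def wm (v : Eu n → ℝ) (x : Eu n) : ℝ := max (v x) (Bb n x)
lemma wm_pos (v : Eu n → ℝ) (x : Eu n) : 0 < wm v x := lt_max_of_lt_right (Bb_pos x)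
structure Dec (n : ℕ) (C1 C2 : ℝ) (v : Eu n → ℝ) : Prop where
  cont : Continuous v
  cs : HasCompactSupport v
  nonneg : ∀ x, 0 ≤ v x
  le_one : ∀ x, v x ≤ 1
  c2 : ∀ x, 0 < v x → ContDiffAt ℝ 2 v x
  eqn : ∀ x, 0 < v x → ∀ Φ, 0 ≤ Φ → NN (fun z => oR (wm v z ^ pcrit n)) x ≤ oR Φ →
    - lapl v x ≤ C1 * Φ * (wm v x) ^ (pcrit n - 1)
  mass : ∫⁻ x, oR (wm v x ^ sob n) ≤ oR C2
lemma wm_meas {v : Eu n → ℝ} (hv : Continuous v) : Measurable (wm v) :=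
  (hv.max Bb_cont).measurable
set_option maxHeartbeats 1000000 in
lemma decay_claim (hn : 3 ≤ n) {C1 C2 A0 : ℝ} (hC1 : 0 < C1) (hC2 : 0 < C2) (hA0 : 0 < A0) :
    ∃ δ > 0, ∀ R : ℝ, 1 ≤ R → R ^ (-(((n:ℝ) - 2) / 2)) ≤ A0 → ∀ v, Dec n C1 C2 v →
    (∫⁻ x in {x : Eu n | R < ‖x‖}, oR (v x ^ sob n)) ≤ oR δ →
    ∀ x, R ≤ ‖x‖ → (‖x‖ - R) ^ (((n:ℝ) - 2) / 2) * v x ≤ A0 := by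
  have hα := al_pos hn
  have hp := p_pos hn
  have hp1 := p_gt hn
  have hαp := al_p hn
  have hαs := al_sob hn
  have hαp1 := al_p1 hn
  obtain ⟨Cn, hCn, hNN⟩ := exists_NN_le hn
  obtain ⟨Cm, hCm, hmv⟩ := exists_mv hn
  set α := (n:ℝ) - 2 with hαd
  set C3 := C1 * (Cn * (A0 ^ pcrit n + (C2 + 1) * 2 ^ (α / 2))) * A0 ^ (pcrit n - 1) with hC3
  have hC3p : 0 < C3 := by positivity
  set m1 := A0 * 2 ^ (-(α/2)) with hm1
  have hm1p : 0 < m1 := by positivity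
  obtain ⟨κ, hκ, hκ2, hκ3⟩ : ∃ κ > 0, κ ≤ 1/2 ∧ Cm * (C3 * κ ^ 2) ≤ m1 / 4 := by
    refine ⟨min (1/2) (m1 / 4 / (Cm * C3)), by positivity, min_le_left _ _, ?_⟩
    set κ := min (1/2) (m1 / 4 / (Cm * C3))
    have h1 : κ ≤ m1 / 4 / (Cm * C3) := min_le_right _ _
    have h0 : 0 < κ := by positivity
    have h2 : κ ≤ 1/2 := min_le_left _ _
    rw [le_div_iff₀ (by positivity)] at h1
    have : κ ^ 2 ≤ κ := by nlinarith
    have h4 : 0 < Cm * C3 := by positivity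
    nlinarith
  set δ := m1 / 4 / (Cm * ((m1/4) ^ (1 - sob n) * κ ^ (-(n:ℝ)))) with hδ
  have hδ0 : 0 < δ := by positivity
  have hδ1 : Cm * ((m1/4) ^ (1 - sob n) * κ ^ (-(n:ℝ))) * δ = m1 / 4 := by
    rw [hδ]; field_simp
  refine ⟨δ, hδ0, ?_⟩
  intro R hR hRA v hv htail
  have hphic : Continuous (fun x : Eu n => (max (‖x‖ - R) 0) ^ (α/2) * v x) := by
    refine Continuous.mul ?_ hv.cont
    exact (by fun_prop : Continuous fun x : Eu n => max (‖x‖ - R) 0).rpow_const fun x => Or.inr (by positivity)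
  have hphis : HasCompactSupport (fun x : Eu n => (max (‖x‖ - R) 0) ^ (α/2) * v x) := hv.cs.mul_left
  obtain ⟨x0, hx0⟩ := hphic.exists_forall_ge_of_hasCompactSupport hphis
  by_contra hcon
  push Not at hcon
  obtain ⟨x1, hx1, hx1'⟩ := hcon
  have hA : A0 < (max (‖x0‖ - R) 0) ^ (α/2) * v x0 := by
    have := hx0 x1
    rw [max_eq_left (by linarith)] at this
    linarith
  set d0 := max (‖x0‖ - R) 0 with hd0
  have hd0p : 0 < d0 := by
    rcases eq_or_lt_of_le (le_max_right (‖x0‖ - R) 0) with h | h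
    · rw [← hd0] at h
      rw [← h, Real.zero_rpow (by positivity)] at hA
      linarith
    · exact h
  have hd0e : d0 = ‖x0‖ - R := by
    rcases max_choice (‖x0‖ - R) 0 with h | h
    · exact h
    · rw [← hd0] at h; linarith
  set m := v x0 with hm
  have hmp : 0 < m := by
    rcases eq_or_lt_of_le (hv.nonneg x0) with h | h
    · rw [← hm] at h; rw [← h] at hA; simp at hA; linarith
    · exact h
  set ρ := (A0 / m) ^ (2/α) / 2 with hρ
  have hρp : 0 < ρ := by positivity
  have h2ρ : (2 * ρ) ^ (α / 2) = A0 / m := by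
    rw [hρ, mul_div_cancel₀ _ (two_ne_zero), ← rpow_mul (by positivity)]
    have : 2 / α * (α / 2) = 1 := by field_simp
    rw [this, rpow_one]
  have hρd : 2 * ρ < d0 := by
    have h1 : (2 * ρ) ^ (α/2) < d0 ^ (α/2) := by
      rw [h2ρ, div_lt_iff₀ hmp]; exact hA
    exact (rpow_lt_rpow_iff (by positivity) hd0p.le (by positivity)).1 h1
  have hmρ : m = m1 * ρ ^ (-(α/2)) := by
    rw [Real.mul_rpow (by norm_num) hρp.le] at h2ρ
    rw [hm1, rpow_neg (by norm_num), rpow_neg hρp.le]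
    have : A0 = m * (2 ^ (α/2) * ρ ^ (α/2)) := by rw [h2ρ]; field_simp
    rw [this]; field_simp
  set T := A0 * ρ ^ (-(α/2)) with hT
  have hTm : T = 2 ^ (α/2) * m := by
    rw [hmρ, hT, hm1, rpow_neg (by norm_num : (0:ℝ) ≤ 2)]; field_simp
  have hnear : ∀ y ∈ ball x0 ρ, R + d0 / 2 < ‖y‖ := by
    intro y hy
    rw [mem_ball, dist_eq_norm] at hy
    have := norm_sub_norm_le x0 y
    rw [norm_sub_rev] at this
    linarith
  have hwT : ∀ y ∈ ball x0 ρ, wm v y ≤ T := by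
    intro y hy
    have hy1 := hnear y hy
    refine max_le ?_ ?_
    · have h1 := hx0 y
      have h2 : (d0 / 2) ^ (α/2) ≤ (max (‖y‖ - R) 0) ^ (α/2) := by
        apply rpow_le_rpow (by positivity) _ (by positivity)
        exact le_max_of_le_left (by linarith)
      have h3 : (d0/2) ^ (α/2) * v y ≤ d0 ^ (α/2) * m := (mul_le_mul_of_nonneg_right h2 (hv.nonneg y)).trans h1
      rw [Real.div_rpow hd0p.le (by norm_num), div_mul_eq_mul_div, div_le_iff₀ (by positivity)] at h3
      rw [hTm]
      have h4 : 0 < d0 ^ (α/2) := by positivity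
      refine le_of_mul_le_mul_left (h3.trans (le_of_eq (by ring))) h4
    · have hyp : 0 < ‖y‖ := by linarith
      refine (Bb_le hn hyp).trans ?_
      rw [← hαd]
      have e : ‖y‖ ^ (-α) = ‖y‖ ^ (-(α/2)) * ‖y‖ ^ (-(α/2)) := by
        rw [← rpow_add hyp]; congr 1; ring
      rw [e, hT]
      have a1 : ‖y‖ ^ (-(α/2)) ≤ A0 :=
        (rpow_le_rpow_of_nonpos (by linarith) (by linarith) (by linarith)).trans hRA
      have a2 : ‖y‖ ^ (-(α/2)) ≤ ρ ^ (-(α/2)) :=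
        rpow_le_rpow_of_nonpos (by linarith) (by linarith) (by linarith)
      gcongr
  have hTp : 0 < T := by positivity
  have hTpow : T ^ pcrit n * ρ ^ 2 = A0 ^ pcrit n * ρ ^ (-(α/2)) := by
    rw [hT, Real.mul_rpow hA0.le (by positivity), ← rpow_mul hρp.le, ← rpow_natCast, mul_assoc, ← rpow_add hρp]
    congr 2; push_cast; linarith
  have hTpow1 : T ^ (pcrit n - 1) = A0 ^ (pcrit n - 1) * ρ ^ (-2:ℝ) := by
    rw [hT, Real.mul_rpow hA0.le (by positivity), ← rpow_mul hρp.le]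
    congr 2; linarith
  set Φ := Cn * (A0 ^ pcrit n + (C2 + 1) * 2 ^ (α / 2)) * ρ ^ (-(α/2)) with hΦ
  have hlap : ∀ y ∈ ball x0 (κ * ρ), 0 < v y → - lapl v y ≤ C3 * ρ ^ (-(α/2)) * ρ ^ (-2:ℝ) := by
    intro y hy hvy
    have hyb : ball y (ρ/2) ⊆ ball x0 ρ := by
      apply ball_subset_ball'
      rw [mem_ball] at hy
      have : κ * ρ ≤ 1/2 * ρ := by gcongr
      linarith
    have h1 := hNN (wm v) y (ρ/2) C2 T (by positivity) hC2.le hTp.le (fun z => (wm_pos v z).le) (wm_meas hv.cont) hv.mass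
      (fun z hz => hwT z (hyb hz))
    have h2 : Cn * (T ^ pcrit n * (ρ/2) ^ 2 + (C2 + 1) * (ρ/2) ^ (-(α/2))) ≤ Φ := by
      have e : (ρ/2) ^ (-(α/2)) = 2 ^ (α/2) * ρ ^ (-(α/2)) := by
        rw [Real.div_rpow hρp.le (by norm_num), rpow_neg (by norm_num : (0:ℝ) ≤ 2)]; field_simp
      have e2 : T ^ pcrit n * (ρ/2) ^ 2 ≤ A0 ^ pcrit n * ρ ^ (-(α/2)) := by
        rw [← hTpow]
        have : 0 < T ^ pcrit n := by positivity
        have h3 : (ρ / 2) ^ 2 ≤ ρ ^ 2 := pow_le_pow_left₀ (by positivity) (by linarith only [hρp]) 2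
        gcongr
      rw [e, hΦ, mul_assoc]
      refine mul_le_mul_of_nonneg_left ?_ hCn.le
      linarith
    have h3 := hv.eqn y hvy Φ (by positivity) (h1.trans (ENNReal.ofReal_le_ofReal h2))
    refine h3.trans ?_
    have h4 : wm v y ^ (pcrit n - 1) ≤ T ^ (pcrit n - 1) :=
      rpow_le_rpow (wm_pos v y).le (hwT y (hyb (mem_ball_self (by positivity)))) (by linarith)
    calc C1 * Φ * wm v y ^ (pcrit n - 1) ≤ C1 * Φ * T ^ (pcrit n - 1) := by gcongr
      _ = _ := by rw [hTpow1, hC3, hΦ]; ring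
  have hκρ : κ * ρ ≤ ρ := by
    have : κ * ρ ≤ 1/2 * ρ := by gcongr
    linarith
  have hmass : (∫⁻ y in ball x0 (κ * ρ), oR (v y ^ sob n)) ≤ oR δ := by
    refine le_trans (lintegral_mono_set ?_) htail
    intro y hy
    have : y ∈ ball x0 ρ := ball_subset_ball hκρ hy
    have := hnear y this
    simp only [Set.mem_setOf_eq]; linarith
  have hfin := hmv v x0 (κ * ρ) (C3 * ρ ^ (-(α/2)) * ρ ^ (-2:ℝ)) (m1/4 * ρ ^ (-(α/2))) δ (by positivity) (by positivity) (by positivity) hδ0.le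
    hv.cont hv.cs hv.nonneg hv.c2 hlap hmass
  rw [← hm] at hfin
  have e1 : (m1/4 * ρ ^ (-(α/2))) ^ (1 - sob n) * (κ * ρ) ^ (-(n:ℝ)) = (m1/4) ^ (1 - sob n) * κ ^ (-(n:ℝ)) * ρ ^ (-(α/2)) := by
    rw [Real.mul_rpow (by positivity) (by positivity), Real.mul_rpow hκ.le hρp.le, ← rpow_mul hρp.le]
    have : ρ ^ (-(α/2)) = ρ ^ (-(α/2) * (1 - sob n)) * ρ ^ (-(n:ℝ)) := by
      rw [← rpow_add hρp]; congr 1; linarith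
    rw [this]; ring
  have e2 : ρ ^ (-2:ℝ) * (κ * ρ) ^ 2 = κ ^ 2 := by
    rw [rpow_neg hρp.le]; norm_num; field_simp
  have e3 : C3 * ρ ^ (-(α/2)) * ρ ^ (-2:ℝ) * (κ * ρ) ^ 2 = C3 * κ ^ 2 * ρ ^ (-(α/2)) := by
    rw [mul_assoc, e2]; ring
  rw [e1, e3, hmρ] at hfin
  set X := ρ ^ (-(α/2)) with hX
  have hXp : 0 < X := by positivity
  have hfin2 : m1 * X ≤ (m1/4 + m1 / 4 + m1/4) * X := by
    calc m1 * X ≤ _ := hfin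
      _ = (m1/4 + Cm * ((m1/4) ^ (1 - sob n) * κ ^ (-(n:ℝ))) * δ + Cm * (C3 * κ ^ 2)) * X := by ring
      _ ≤ _ := by rw [hδ1]; gcongr
  have := le_of_mul_le_mul_right hfin2 hXp
  linarith
lemma decay_small (hn : 3 ≤ n) {C1 C2 a : ℝ} (hC1 : 0 < C1) (hC2 : 0 < C2) (ha : 0 < a) :
    ∃ δ > 0, ∃ Rm ≥ 1, ∀ R : ℝ, Rm ≤ R → ∀ v, Dec n C1 C2 v →
    (∫⁻ x in {x : Eu n | R < ‖x‖}, oR (v x ^ sob n)) ≤ oR δ →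
    ∀ x, 2 * R ≤ ‖x‖ → wm v x ^ (pcrit n - 1) ≤ a * ‖x‖ ^ (-2:ℝ) := by
  have hα := al_pos hn
  have hp1 := p_gt hn
  have hαp1 := al_p1 hn
  set A0 := (a / 4) ^ (1 / (pcrit n - 1)) with hA0
  have hA0p : 0 < A0 := by positivity
  have hA0e : A0 ^ (pcrit n - 1) = a / 4 := by
    rw [hA0, ← rpow_mul (by positivity), one_div, inv_mul_cancel₀ (by linarith), rpow_one]
  obtain ⟨δ, hδ, H⟩ := decay_claim hn hC1 hC2 hA0p
  set α := (n:ℝ) - 2 with hαd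
  refine ⟨δ, hδ, max 1 (max (A0 ^ (-(2/α))) (a ^ (-(1/2:ℝ)))), le_max_left _ _, ?_⟩
  intro R hR v hv ht x hx
  have hR1 : 1 ≤ R := (le_max_left _ _).trans hR
  have hR2 : A0 ^ (-(2/α)) ≤ R := (le_max_left _ _).trans ((le_max_right _ _).trans hR)
  have hR3 : a ^ (-(1/2:ℝ)) ≤ R := (le_max_right _ _).trans ((le_max_right _ _).trans hR)
  have hRA : R ^ (-(α/2)) ≤ A0 := by
    calc R ^ (-(α/2)) ≤ (A0 ^ (-(2/α))) ^ (-(α/2)) := rpow_le_rpow_of_nonpos (by positivity) hR2 (by linarith)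
      _ = A0 := by
        rw [← rpow_mul hA0p.le]
        have : -(2/α) * -(α/2) = 1 := by field_simp
        rw [this, rpow_one]
  have hRa : R ^ (-2:ℝ) ≤ a := by
    calc R ^ (-2:ℝ) ≤ (a ^ (-(1/2:ℝ))) ^ (-2:ℝ) := rpow_le_rpow_of_nonpos (by positivity) hR3 (by norm_num)
      _ = a := by
        rw [← rpow_mul ha.le]; norm_num
  have hx0 : 0 < ‖x‖ := by linarith
  have h1 := H R hR1 hRA v hv ht x (by linarith)
  have hxR : ‖x‖ / 2 ≤ ‖x‖ - R := by linarith
  have h2 : (‖x‖/2) ^ (α/2) * v x ≤ A0 :=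
    (mul_le_mul_of_nonneg_right (rpow_le_rpow (by positivity) hxR (by positivity)) (hv.nonneg x)).trans h1
  unfold wm
  rcases max_choice (v x) (Bb n x) with h | h
  · rw [h]
    have h3 : ((‖x‖/2) ^ (α/2) * v x) ^ (pcrit n - 1) ≤ a / 4 := by
      rw [← hA0e]; exact rpow_le_rpow (mul_nonneg (by positivity) (hv.nonneg x)) h2 (by linarith)
    rw [Real.mul_rpow (by positivity) (hv.nonneg x), ← rpow_mul (by positivity)] at h3
    have e : α / 2 * (pcrit n - 1) = 2 := by linarith
    rw [e] at h3
    rw [rpow_neg hx0.le]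
    norm_num at h3 ⊢
    rw [← div_eq_mul_inv, le_div_iff₀ (by positivity)]
    linarith
  · rw [h]
    have h3 : Bb n x ^ (pcrit n - 1) ≤ (‖x‖ ^ (-α)) ^ (pcrit n - 1) :=
      rpow_le_rpow (Bb_pos x).le (Bb_le hn hx0) (by linarith)
    refine h3.trans ?_
    rw [← rpow_mul hx0.le]
    have e : -α * (pcrit n - 1) = -2 + -2 := by linarith
    rw [e, rpow_add hx0]
    have h4 : ‖x‖ ^ (-2:ℝ) ≤ a := (rpow_le_rpow_of_nonpos (by linarith) (by linarith) (by norm_num)).trans hRa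
    gcongr
lemma NN_le_ae {f g : Eu n → ENNReal} (h : ∀ᵐ z, f z ≤ g z) (x : Eu n) : NN f x ≤ NN g x :=
  lintegral_mono_ae (h.mono fun z hz => by gcongr)
lemma NN_const_mul {f : Eu n → ENNReal} (c : ENNReal) (hf : Measurable f) (x : Eu n) : NN (fun z => c * f z) x = c * NN f x := by
  unfold NN
  rw [← lintegral_const_mul _ (by fun_prop)]
  simp only [mul_assoc]
set_option maxHeartbeats 1000000 in
lemma exists_decay (hn : 3 ≤ n) {C1 C2 : ℝ} (hC1 : 0 < C1) (hC2 : 0 < C2) :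
    ∃ δ > 0, ∃ Rm ≥ 1, ∀ R : ℝ, Rm ≤ R → ∃ C > 0, ∀ v, Dec n C1 C2 v →
    (∫⁻ x in {x : Eu n | R < ‖x‖}, oR (v x ^ sob n)) ≤ oR δ →
    ∀ x, v x ≤ C * Bb n x := by
  have hα := al_pos hn
  have hn3 : (3:ℝ) ≤ n := by exact_mod_cast hn
  have hp := p_pos hn
  have hp1 := p_gt hn
  have hαp := al_p hn
  set α := (n:ℝ) - 2 with hαd
  set θ := α * ((n:ℝ) + 1) / (n + 2) with hθ
  have hθ0 : 0 < θ := by positivity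
  have hθ1 : θ < α := by
    rw [hθ, div_lt_iff₀ (by positivity)]; nlinarith
  have hθp : θ * pcrit n = n + 1 := by
    have : θ * pcrit n = (α * pcrit n) * (n + 1) / (n+2) := by rw [hθ]; ring
    rw [this, hαp]; field_simp
  obtain ⟨Cθ, hCθ, hNN⟩ := exists_NN_weight hn hθ0 hθ1
  set g := θ * (α - θ) with hg
  have hg0 : 0 < g := mul_pos hθ0 (by linarith)
  obtain ⟨a, ha, ha1, ha2⟩ : ∃ a > 0, a ≤ 1 ∧ C1 * Cθ * a ≤ g / 2 := by
    refine ⟨min 1 (g / 2 / (C1 * Cθ)), by positivity, min_le_left _ _, ?_⟩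
    have := min_le_right 1 (g / 2 / (C1 * Cθ))
    rwa [le_div_iff₀' (by positivity)] at this
  obtain ⟨δ, hδ, Rm, hRm, H⟩ := decay_small hn hC1 hC2 ha
  refine ⟨δ, hδ, Rm, hRm, fun R hR => ?_⟩
  set R' := 2 * R with hR'
  have hR'1 : 1 ≤ R' := by linarith
  have hR'0 : 0 < R' := by linarith
  set Q := R' ^ (2 + θ) with hQ
  have hQ1 : 1 ≤ Q := Real.one_le_rpow hR'1 (by linarith)
  set A' := 1 + Q with hA'
  set C3 := C1 * ((A' + Q) * Cθ) * A' ^ (pcrit n - 1) with hC3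
  have hC3p : 0 < C3 := by positivity
  set A2 := 2 * C3 / (n - 1) + 2 * R' ^ α with hA2
  have hn1 : 0 < (n:ℝ) - 1 := by linarith
  have hA2p : 0 < A2 := by positivity
  refine ⟨A2 * 2 ^ (α/2) + (1 + R' ^ 2) ^ (α/2), by positivity, ?_⟩
  intro v hv htail
  have hsm := H R hR v hv htail
  have hne : ∀ x : Eu n, R' ≤ ‖x‖ → x ≠ 0 := fun x hx => norm_pos_iff.1 (by linarith)
  have hwle : ∀ x, wm v x ≤ 1 := fun x => max_le (hv.le_one x) (Bb_le_one hn x)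
  have hae : ∀ᵐ z : Eu n, z ≠ 0 := by
    haveI : Nonempty (Fin n) := ⟨⟨0, by omega⟩⟩
    exact MeasureTheory.Measure.ae_ne volume 0
  -- NN estimate
  have hNNw : ∀ A : ℝ, 1 ≤ A → (∀ x, R' ≤ ‖x‖ → v x ≤ A * ‖x‖ ^ (-θ)) → ∀ x : Eu n, x ≠ 0 →
      NN (fun z => oR (wm v z ^ pcrit n)) x ≤ oR ((a * A + Q) * Cθ * ‖x‖ ^ (-θ)) := by
    intro A hA hvA x hx
    have hpt : ∀ z : Eu n, z ≠ 0 → wm v z ^ pcrit n ≤ (a * A + Q) * ‖z‖ ^ (-(2+θ)) := by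
      intro z hz
      have hz0 : 0 < ‖z‖ := norm_pos_iff.2 hz
      rcases le_or_gt R' ‖z‖ with h | h
      · have h1 := hsm z h
        have h2 : wm v z ≤ A * ‖z‖ ^ (-θ) := by
          refine max_le (hvA z h) ((Bb_le hn hz0).trans ?_)
          have : ‖z‖ ^ (-α) ≤ ‖z‖ ^ (-θ) := rpow_le_rpow_of_exponent_le (by linarith) (by linarith)
          have h3 : 0 < ‖z‖ ^ (-θ) := by positivity
          calc ‖z‖ ^ (-α) ≤ 1 * ‖z‖ ^ (-θ) := by linarith
            _ ≤ _ := by gcongr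
        have e : wm v z ^ pcrit n = wm v z ^ (pcrit n - 1) * wm v z := by
          rw [rpow_sub_one (wm_pos v z).ne']; field_simp [(wm_pos v z).ne']
        have e2 : ‖z‖ ^ (-(2+θ)) = ‖z‖ ^ (-2:ℝ) * ‖z‖ ^ (-θ) := by
          rw [← rpow_add hz0]; congr 1; ring
        rw [e, e2]
        calc _ ≤ (a * ‖z‖ ^ (-2:ℝ)) * (A * ‖z‖ ^ (-θ)) := by
              apply mul_le_mul h1 h2 (wm_pos v z).le (by positivity)
          _ = a * A * (‖z‖ ^ (-2:ℝ) * ‖z‖ ^ (-θ)) := by ring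
          _ ≤ _ := by gcongr; linarith
      · have h1 : wm v z ^ pcrit n ≤ 1 := rpow_le_one (wm_pos v z).le (hwle z) hp.le
        have h2 : 1 ≤ Q * ‖z‖ ^ (-(2+θ)) := by
          rw [rpow_neg hz0.le, ← div_eq_mul_inv, le_div_iff₀ (by positivity), one_mul]
          exact rpow_le_rpow hz0.le h.le (by linarith)
        have h3 : 0 ≤ a * A * ‖z‖ ^ (-(2+θ)) := by positivity
        linarith
    have hG : 0 ≤ a * A + Q := by positivity
    calc _ ≤ NN (fun z => oR (a * A + Q) * oR (‖z‖ ^ (-(2+θ)))) x := by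
          apply NN_le_ae
          filter_upwards [hae] with z hz
          rw [← ENNReal.ofReal_mul hG]
          exact ENNReal.ofReal_le_ofReal (hpt z hz)
      _ = oR (a * A + Q) * NN (fun z => oR (‖z‖ ^ (-(2+θ)))) x :=
          NN_const_mul _ (by fun_prop) x
      _ ≤ oR (a * A + Q) * oR (Cθ * ‖x‖ ^ (-θ)) := by
          gcongr; exact hNN x hx
      _ = _ := by rw [← ENNReal.ofReal_mul hG]; congr 1; ring
  -- step 2
  have step2 : ∀ x, R' ≤ ‖x‖ → v x ≤ A' * ‖x‖ ^ (-θ) := by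
    obtain ⟨A, hA0, hAle, hAc⟩ := max_ratio (b := fun y : Eu n => ‖y‖ ^ (-θ)) hR'0 hv.cont hv.cs hv.nonneg hv.c2
      (fun x hx => rpow_norm_contDiffAt θ (hne x hx)) (fun x hx => by
        have : 0 < ‖x‖ := by linarith
        positivity)
    have hAA : A ≤ A' := by
      rcases hAc with h | ⟨x0, hx0, hvx, hvp, hint⟩
      · rw [h]; positivity
      · have hx0p : 0 < ‖x0‖ := by linarith
        rcases eq_or_lt_of_le hx0 with he | hlt
        · have h1 := hv.le_one x0
          rw [hvx, ← he, rpow_neg hR'0.le, ← div_eq_mul_inv, div_le_iff₀ (by positivity), one_mul] at h1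
          have h2 : R' ^ θ ≤ Q := rpow_le_rpow_of_exponent_le hR'1 (by linarith)
          linarith
        · have h1 := hint hlt
          rw [lapl_rpow θ (hne x0 hx0)] at h1
          have hm1 : 1 ≤ max A 1 := le_max_right _ _
          have h2 := hNNw (max A 1) hm1 (fun x hx => (hAle x hx).trans (by
            have : 0 < ‖x‖ := by linarith
            gcongr; exact le_max_left _ _)) x0 (hne x0 hx0)
          have h3 := hv.eqn x0 hvp _ (by positivity) h2
          have h4 := hsm x0 hx0
          have e2 : ‖x0‖ ^ (-θ - 2) = ‖x0‖ ^ (-θ) * ‖x0‖ ^ (-2:ℝ) := by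
            rw [← rpow_add hx0p]; congr 1
          set X := ‖x0‖ ^ (-θ) * ‖x0‖ ^ (-2:ℝ) with hX
          have hXp : 0 < X := by positivity
          have h5 : C1 * ((a * max A 1 + Q) * Cθ * ‖x0‖ ^ (-θ)) * wm v x0 ^ (pcrit n - 1)
              ≤ (C1 * Cθ * a * (a * max A 1 + Q)) * X := by
            calc _ ≤ C1 * ((a * max A 1 + Q) * Cθ * ‖x0‖ ^ (-θ)) * (a * ‖x0‖ ^ (-2:ℝ)) := by gcongr
              _ = _ := by rw [hX]; ring
          have h6 : A * g * X ≤ (C1 * Cθ * a * (a * max A 1 + Q)) * X := by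
            refine le_trans (le_of_eq ?_) (h1.trans (h3.trans h5))
            rw [e2, hg]
            have : θ + 2 - (n:ℝ) = -(α - θ) := by rw [hαd]; ring
            rw [this]; ring
          have h7 := le_of_mul_le_mul_right h6 hXp
          have h8 : A * g ≤ g / 2 * (max A 1 + Q) := by
            refine h7.trans ?_
            have : a * max A 1 + Q ≤ max A 1 + Q := by nlinarith
            gcongr
          have h9 : A ≤ (max A 1 + Q) / 2 := by
            refine le_of_mul_le_mul_right (h8.trans (le_of_eq (by ring)) : A * g ≤ (max A 1 + Q) / 2 * g) hg0
          rcases max_choice A 1 with h | h <;> rw [h] at h9 <;> linarith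
    intro x hx
    have : 0 < ‖x‖ := by linarith
    exact (hAle x hx).trans (by gcongr)
  have hA'1 : 1 ≤ A' := by linarith
  -- step 3
  have hlap3 : ∀ x, R' ≤ ‖x‖ → 0 < v x → - lapl v x ≤ C3 * ‖x‖ ^ (-(n:ℝ) - 1) := by
    intro x hx hvx
    have hx0 : 0 < ‖x‖ := by linarith
    have h1 := hv.eqn x hvx _ (by positivity) (hNNw A' hA'1 step2 x (hne x hx))
    refine h1.trans ?_
    have h2 : wm v x ≤ A' * ‖x‖ ^ (-θ) := by
      refine max_le (step2 x hx) ((Bb_le hn hx0).trans ?_)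
      have : ‖x‖ ^ (-α) ≤ ‖x‖ ^ (-θ) := rpow_le_rpow_of_exponent_le (by linarith) (by linarith)
      have h3 : 0 < ‖x‖ ^ (-θ) := by positivity
      calc ‖x‖ ^ (-α) ≤ 1 * ‖x‖ ^ (-θ) := by linarith
        _ ≤ _ := by gcongr
    have h3 : wm v x ^ (pcrit n - 1) ≤ A' ^ (pcrit n - 1) * ‖x‖ ^ (-θ * (pcrit n - 1)) := by
      rw [rpow_mul hx0.le, ← Real.mul_rpow (by positivity) (by positivity)]
      exact rpow_le_rpow (wm_pos v x).le h2 (by linarith)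
    have e : ‖x‖ ^ (-(n:ℝ) - 1) = ‖x‖ ^ (-θ) * ‖x‖ ^ (-θ * (pcrit n - 1)) := by
      rw [← rpow_add hx0]; congr 1; linarith
    have h4 : a * A' + Q ≤ A' + Q := by nlinarith
    calc _ ≤ C1 * ((A' + Q) * Cθ * ‖x‖ ^ (-θ)) * (A' ^ (pcrit n - 1) * ‖x‖ ^ (-θ * (pcrit n - 1))) := by
          have := (rpow_pos_of_pos (wm_pos v x) (pcrit n - 1)).le
          gcongr
      _ = _ := by rw [e, hC3]; ring
  have hbge : ∀ x : Eu n, R' ≤ ‖x‖ → ‖x‖ ^ (-α) / 2 ≤ ‖x‖ ^ (-α) - 1/2 * ‖x‖ ^ (-(α+1)) := by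
    intro x hx
    have : ‖x‖ ^ (-(α+1)) ≤ ‖x‖ ^ (-α) := rpow_le_rpow_of_exponent_le (by linarith) (by linarith)
    linarith
  have step3 : ∀ x, R' ≤ ‖x‖ → v x ≤ A2 * ‖x‖ ^ (-α) := by
    obtain ⟨A, hA0, hAle, hAc⟩ := max_ratio (b := fun y : Eu n => ‖y‖ ^ (-α) - 1/2 * ‖y‖ ^ (-(α+1))) hR'0 hv.cont hv.cs hv.nonneg hv.c2
      (fun x hx => (rpow_norm_contDiffAt α (hne x hx)).sub (contDiffAt_const.mul (rpow_norm_contDiffAt (α+1) (hne x hx)))) (fun x hx => by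
        have : 0 < ‖x‖ := by linarith
        have h2 : 0 < ‖x‖ ^ (-α) := by positivity
        linarith [hbge x hx])
    have hAA : A ≤ A2 := by
      rcases hAc with h | ⟨x0, hx0, hvx, hvp, hint⟩
      · rw [h]; positivity
      · have hx0p : 0 < ‖x0‖ := by linarith
        rcases eq_or_lt_of_le hx0 with he | hlt
        · have h1 := hv.le_one x0
          rw [hvx] at h1
          have h2 : A * (‖x0‖ ^ (-α) / 2) ≤ 1 := (mul_le_mul_of_nonneg_left (hbge x0 hx0) hA0).trans h1
          rw [← he, rpow_neg hR'0.le] at h2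
          have h3 : 0 < R' ^ α := by positivity
          have h4 : A ≤ 2 * R' ^ α := by
            have : A * ((R' ^ α)⁻¹ / 2) = A / (2 * R' ^ α) := by field_simp
            rw [this, div_le_iff₀ (by positivity)] at h2
            linarith
          have h5 : 0 ≤ 2 * C3 / (n - 1) := by positivity
          linarith
        · have h1 := hint hlt
          rw [lapl_sub_mul (1/2) (rpow_norm_contDiffAt α (hne x0 hx0)) (rpow_norm_contDiffAt (α+1) (hne x0 hx0)),
            lapl_rpow α (hne x0 hx0), lapl_rpow (α+1) (hne x0 hx0)] at h1
          have h3 := hlap3 x0 hx0 hvp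
          have e1 : α + 2 - (n:ℝ) = 0 := by rw [hαd]; ring
          have e2 : α + 1 + 2 - (n:ℝ) = 1 := by rw [hαd]; ring
          have e3 : -(α + 1) - 2 = -(n:ℝ) - 1 := by rw [hαd]; ring
          have e4 : α + 1 = n - 1 := by rw [hαd]; ring
          rw [e1, e2, e3, e4] at h1
          set X := ‖x0‖ ^ (-(n:ℝ) - 1)
          have hXp : 0 < X := by positivity
          have h6 : A * ((n - 1) / 2) * X ≤ C3 * X := by linarith
          have h7 := le_of_mul_le_mul_right h6 hXp
          have h8 : A ≤ 2 * C3 / (n - 1) := by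
            rw [le_div_iff₀ hn1]; linarith
          have h5 : 0 ≤ 2 * R' ^ α := by positivity
          linarith
    intro x hx
    have : 0 < ‖x‖ := by linarith
    have h1 := hAle x hx
    have h2 : ‖x‖ ^ (-α) - 1/2 * ‖x‖ ^ (-(α+1)) ≤ ‖x‖ ^ (-α) := by
      have : 0 < ‖x‖ ^ (-(α+1)) := by positivity
      linarith
    refine h1.trans ((mul_le_mul_of_nonneg_left h2 hA0).trans ?_)
    gcongr
  intro x
  have hB := Bb_pos x
  rcases le_or_gt R' ‖x‖ with h | h
  · have h1 := step3 x h
    have h2 := Bb_ge hn (le_trans hR'1 h)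
    have h3 : ‖x‖ ^ (-α) ≤ 2 ^ (α/2) * Bb n x := by
      rw [rpow_neg (by norm_num : (0:ℝ) ≤ 2), inv_mul_le_iff₀ (by positivity)] at h2
      exact h2
    have h4 : A2 * ‖x‖ ^ (-α) ≤ A2 * (2 ^ (α/2) * Bb n x) := by gcongr
    have h5 : 0 ≤ (1 + R' ^ 2) ^ (α/2) * Bb n x := by positivity
    nlinarith
  · have h1 := hv.le_one x
    have h2 : 1 ≤ (1 + R' ^ 2) ^ (α/2) * Bb n x := by
      unfold Bb
      rw [rpow_neg (by positivity), ← div_eq_mul_inv, le_div_iff₀ (by positivity), one_mul]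
      apply rpow_le_rpow (by positivity) _ (by positivity)
      have := norm_nonneg x
      nlinarith
    have h5 : 0 ≤ A2 * 2 ^ (α/2) * Bb n x := by positivity
    linarith
/-- bounded measurable nonnegative with bounded support -/
structure BS (f : Eu n → ℝ) : Prop where
  meas : Measurable f
  nonneg : ∀ x, 0 ≤ f x
  bdd : ∃ M R, 0 ≤ M ∧ (∀ x, f x ≤ M) ∧ ∀ x, R ≤ ‖x‖ → f x = 0
lemma BS.of_cont {f : Eu n → ℝ} (hc : Continuous f) (hs : HasCompactSupport f) (h0 : ∀ x, 0 ≤ f x) : BS f := by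
  obtain ⟨M, hM⟩ := hs.exists_bound_of_continuous hc
  obtain ⟨R, hR⟩ := hs.isCompact.isBounded.subset_closedBall (0 : Eu n)
  refine ⟨hc.measurable, h0, M, R + 1, (norm_nonneg _).trans (hM 0), fun x => (le_abs_self _).trans (hM x), ?_⟩
  intro x hx
  apply image_eq_zero_of_notMem_tsupport
  intro h
  have := hR h
  simp at this
  linarith
lemma BS.integrable {f : Eu n → ℝ} (h : BS f) : Integrable f := by
  obtain ⟨M, R, hM, h1, h2⟩ := h.bdd
  have h3 : IntegrableOn (fun _ : Eu n => M) (ball (0:Eu n) R) volume := integrableOn_const measure_ball_lt_top.ne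
  have := h3.integrable_indicator measurableSet_ball
  refine this.mono' h.meas.aestronglyMeasurable (Eventually.of_forall fun x => ?_)
  rw [Real.norm_of_nonneg (h.nonneg x)]
  by_cases hx : x ∈ ball (0:Eu n) R
  · rw [Set.indicator_of_mem hx]; exact h1 x
  · rw [Set.indicator_of_notMem hx]
    simp at hx
    rw [h2 x hx]
lemma BS.mul {f g : Eu n → ℝ} (h : BS f) (hg : Measurable g) (hg0 : ∀ x, 0 ≤ g x) {K : ℝ} (hK : ∀ x, g x ≤ K) :
    BS (fun x => f x * g x) := by
  obtain ⟨M, R, hM, h1, h2⟩ := h.bdd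
  refine ⟨h.meas.mul hg, fun x => mul_nonneg (h.nonneg x) (hg0 x), M * K, R, mul_nonneg hM ((hg0 0).trans (hK 0)), ?_, ?_⟩
  · intro x; exact mul_le_mul (h1 x) (hK x) (hg0 x) hM
  · intro x hx; rw [h2 x hx, zero_mul]
lemma BS.rpow {f : Eu n → ℝ} (h : BS f) {q : ℝ} (hq : 0 < q) : BS (fun x => f x ^ q) := by
  obtain ⟨M, R, hM, h1, h2⟩ := h.bdd
  refine ⟨h.meas.pow_const q, fun x => rpow_nonneg (h.nonneg x) _, M ^ q, R, by positivity, ?_, ?_⟩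
  · intro x; exact rpow_le_rpow (h.nonneg x) (h1 x) hq.le
  · intro x hx; rw [h2 x hx, Real.zero_rpow hq.ne']
lemma BS.NN_le (hn : 3 ≤ n) {f : Eu n → ℝ} (h : BS f) :
    ∃ K, 0 ≤ K ∧ ∀ x, NN (fun z => oR (f z)) x ≤ oR K := by
  have hα := al_pos hn
  obtain ⟨M, R, hM, h1, h2⟩ := h.bdd
  obtain ⟨C, hC, hin⟩ := exists_lint_in hn (σ := (n:ℝ) - 2) (by linarith)
  set I := ∫ x, f x with hI
  have hI0 : 0 ≤ I := integral_nonneg h.nonneg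
  refine ⟨M * C + I, by positivity, fun x => ?_⟩
  have hfm := h.meas
  unfold NN
  have hk : Measurable fun z : Eu n => oR (‖x - z‖ ^ (-((n:ℝ) - 2))) := by fun_prop
  rw [← lintegral_add_compl _ (measurableSet_ball (x := x) (ε := 1)), ENNReal.ofReal_add (by positivity) hI0]
  refine add_le_add ?_ ?_
  · calc _ ≤ ∫⁻ z in ball x 1, oR M * oR (‖x - z‖ ^ (-((n:ℝ) - 2))) := by
          refine lintegral_mono fun z => ?_
          exact mul_le_mul_left (ENNReal.ofReal_le_ofReal (h1 z)) _
      _ = oR M * ∫⁻ z in ball x 1, oR (‖x - z‖ ^ (-((n:ℝ) - 2))) :=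
          lintegral_const_mul _ hk
      _ ≤ oR M * oR (C * 1 ^ ((n:ℝ) - ((n:ℝ) - 2))) := by
          gcongr; exact hin 1 one_pos x
      _ = _ := by rw [← ENNReal.ofReal_mul hM]; simp
  · rw [hI, ofReal_integral_eq_lintegral_ofReal h.integrable (Eventually.of_forall h.nonneg)]
    calc _ ≤ ∫⁻ z in (ball x 1)ᶜ, oR (f z) := by
          refine setLIntegral_mono' measurableSet_ball.compl fun z hz => ?_
          have : oR (‖x - z‖ ^ (-((n:ℝ) - 2))) ≤ 1 := by
            rw [ENNReal.ofReal_le_one]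
            apply rpow_le_one_of_one_le_of_nonpos _ (by linarith)
            simp only [Set.mem_compl_iff, mem_ball, dist_eq_norm, not_lt] at hz
            rw [norm_sub_rev]; exact hz
          calc _ ≤ oR (f z) * 1 := by gcongr
            _ = _ := mul_one _
      _ ≤ _ := setLIntegral_le_lintegral _ _
/-- real Newtonian-type potential -/
def Np (f : Eu n → ℝ) (x : Eu n) : ℝ := (NN (fun z => oR (f z)) x).toReal
lemma Np_nonneg (f : Eu n → ℝ) (x : Eu n) : 0 ≤ Np f x := ENNReal.toReal_nonneg
lemma Np_meas {f : Eu n → ℝ} (hf : Measurable f) : Measurable (Np f) :=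
  (NN_meas (by fun_prop)).ennreal_toReal
lemma BS.ofReal_Np (hn : 3 ≤ n) {f : Eu n → ℝ} (h : BS f) (x : Eu n) :
    oR (Np f x) = NN (fun z => oR (f z)) x := by
  obtain ⟨K, hK, h1⟩ := h.NN_le hn
  exact ENNReal.ofReal_toReal ((h1 x).trans_lt ENNReal.ofReal_lt_top).ne
lemma BS.Np_le (hn : 3 ≤ n) {f : Eu n → ℝ} (h : BS f) : ∃ K, 0 ≤ K ∧ ∀ x, Np f x ≤ K := by
  obtain ⟨K, hK, h1⟩ := h.NN_le hn
  refine ⟨K, hK, fun x => ?_⟩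
  exact ENNReal.toReal_le_of_le_ofReal hK (h1 x)
lemma BS.mul_Np (hn : 3 ≤ n) {f g : Eu n → ℝ} (hf : BS f) (hg : BS g) : BS (fun x => f x * Np g x) := by
  obtain ⟨K, hK, h1⟩ := hg.Np_le hn
  exact hf.mul (Np_meas hg.meas) (Np_nonneg g) h1
lemma BS.DD_eq (hn : 3 ≤ n) {f g : Eu n → ℝ} (hf : BS f) (hg : BS g) :
    DD (fun z => oR (f z)) (fun z => oR (g z)) = oR (∫ x, f x * Np g x) := by
  rw [ofReal_integral_eq_lintegral_ofReal (hf.mul_Np hn hg).integrable (Eventually.of_forall (hf.mul_Np hn hg).nonneg)]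
  unfold DD
  congr 1; ext x
  rw [ENNReal.ofReal_mul (hf.nonneg x), hg.ofReal_Np hn]
lemma rz_eq {Ω : Set (Eu n)} (hΩ : MeasurableSet Ω) {g : Eu n → ℝ} (hg : Measurable g) (hg0 : ∀ x, 0 ≤ g x)
    (hz : ∀ x, x ∉ Ω → g x = 0) (x : Eu n) : rz Ω g x = Np g x := by
  unfold rz rzk Np NN
  rw [integral_eq_lintegral_of_nonneg_ae]
  · congr 1
    rw [← lintegral_indicator hΩ]
    congr 1; ext z
    by_cases h : z ∈ Ω
    · rw [Set.indicator_of_mem h, div_eq_mul_inv, ENNReal.ofReal_mul (hg0 z), rpow_neg (norm_nonneg _)]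
    · rw [Set.indicator_of_notMem h]; simp [hz z h]
  · exact Eventually.of_forall fun z => div_nonneg (hg0 z) (by positivity)
  · exact (by fun_prop : Measurable fun z => g z / ‖x - z‖ ^ ((n:ℝ) - 2)).aestronglyMeasurable
lemma hartree_eq (hn : 3 ≤ n) {Ω : Set (Eu n)} (hΩ : MeasurableSet Ω) {g : Eu n → ℝ} (hg : BS g)
    (hz : ∀ x, x ∉ Ω → g x = 0) : ∫ x in Ω, rz Ω g x * g x = ∫ x, g x * Np g x := by
  rw [← integral_indicator hΩ]
  congr 1; ext x
  by_cases h : x ∈ Ω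
  · rw [Set.indicator_of_mem h, rz_eq hΩ hg.meas hg.nonneg hz, mul_comm]
  · rw [Set.indicator_of_notMem h, hz x h, zero_mul]
lemma DD_pos (hn : 3 ≤ n) {g : Eu n → ℝ} (hg : BS g) (hc : Continuous g) (hne : ∃ x, g x ≠ 0) :
    0 < ∫ x, g x * Np g x := by
  haveI : Nonempty (Fin n) := ⟨⟨0, by omega⟩⟩
  have hnae : ¬ (g =ᵐ[volume] fun _ => (0:ℝ)) := by
    intro h
    obtain ⟨x, hx⟩ := hne
    have := Continuous.ae_eq_iff_eq volume hc continuous_const |>.1 h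
    exact hx (congrFun this x)
  have hNp : ∀ x, Np g x ≠ 0 := by
    intro x hx
    have h0 : NN (fun z => oR (g z)) x = 0 := by rw [← hg.ofReal_Np hn, hx]; simp
    unfold NN at h0
    rw [lintegral_eq_zero_iff (by have := hg.meas; fun_prop)] at h0
    apply hnae
    filter_upwards [h0, MeasureTheory.Measure.ae_ne volume x] with z hz hzx
    simp only [Pi.zero_apply, mul_eq_zero, ENNReal.ofReal_eq_zero] at hz
    rcases hz with hz | hz
    · exact le_antisymm hz (hg.nonneg z)
    · have : 0 < ‖x - z‖ ^ (-((n:ℝ) - 2)) := by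
        have : 0 < ‖x - z‖ := norm_pos_iff.2 (sub_ne_zero.2 (Ne.symm hzx))
        positivity
      linarith
  have h1 := (hg.mul_Np hn hg)
  rw [integral_pos_iff_support_of_nonneg h1.nonneg h1.integrable]
  rw [pos_iff_ne_zero]
  intro h0
  apply hnae
  have h2 : (fun x => g x * Np g x) =ᵐ[volume] 0 := by
    rw [Filter.EventuallyEq, ae_iff]; exact h0
  filter_upwards [h2] with x hx
  simp only [Pi.zero_apply, mul_eq_zero] at hx
  exact hx.resolve_right (hNp x)
/-- abstract positive solution extended by zero -/
structure PS (u : Eu n → ℝ) (q : ℝ) : Prop where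
  cont : Continuous u
  cs : HasCompactSupport u
  nonneg : ∀ x, 0 ≤ u x
  c2 : ∀ x, 0 < u x → ContDiffAt ℝ 2 u x
  eqn : ∀ x, 0 < u x → - lapl u x = Np (fun z => u z ^ q) x * u x ^ (q - 1)
lemma cont_ext {Ω : Set (Eu n)} (hΩ : IsOpen Ω) {u : Eu n → ℝ} (hc : ContinuousOn u (closure Ω))
    (hz : ∀ x ∈ Ωᶜ, u x = 0) : Continuous u := by
  have h : ContinuousOn u (closure Ω ∪ Ωᶜ) :=
    hc.union_of_isClosed (continuousOn_const.congr hz) isClosed_closure hΩ.isClosed_compl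
  refine continuousOn_univ.1 (h.mono fun x _ => ?_)
  by_cases hx : x ∈ Ω
  · exact Or.inl (subset_closure hx)
  · exact Or.inr hx
lemma PS.bs {u : Eu n → ℝ} {q : ℝ} (h : PS u q) : BS u := BS.of_cont h.cont h.cs h.nonneg
lemma IsSol.ps {Ω : Set (Eu n)} (hΩ : IsOpen Ω) (hb : IsBounded Ω) {ε : ℝ} {u : Eu n → ℝ}
    (h : IsSol Ω ε u) (hq : 0 < pcrit n - ε) : PS u (pcrit n - ε) ∧ ∀ x, 0 < u x ↔ x ∈ Ω := by
  obtain ⟨h1, h2, h3, h4, h5⟩ := h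
  have hiff : ∀ x, 0 < u x ↔ x ∈ Ω := fun x => ⟨fun hx => by
    by_contra hc; rw [h5 x hc] at hx; exact lt_irrefl _ hx, h4 x⟩
  have hnn : ∀ x, 0 ≤ u x := fun x => by
    by_cases hx : x ∈ Ω
    · exact (h4 x hx).le
    · rw [h5 x hx]
  have hc := cont_ext hΩ h2 h5
  refine ⟨⟨hc, ?_, hnn, fun x hx => (h1 x ((hiff x).1 hx)).contDiffAt (hΩ.mem_nhds ((hiff x).1 hx)), ?_⟩, hiff⟩
  · apply HasCompactSupport.intro hb.isCompact_closure
    intro x hx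
    exact h5 x fun hx' => hx (subset_closure hx')
  · intro x hx
    rw [h3 x ((hiff x).1 hx), rz_eq hΩ.measurableSet (hc.measurable.pow_const _) (fun z => rpow_nonneg (hnn z) _)
      (fun z hz => by rw [h5 z hz, Real.zero_rpow hq.ne'])]
    congr 2; ring
/-- The Hartree energy -/
def Dq (q : ℝ) (u : Eu n → ℝ) : ℝ := ∫ x, u x ^ q * Np (fun z => u z ^ q) x
lemma PS.flux {u : Eu n → ℝ} {q : ℝ} (h : PS u q) {δ : ℝ} (hδ : 0 < δ) :
    Integrable (fun x => Real.smoothTransition (u x / (2*δ) - 1) * ∑ i, pd u i x ^ 2) ∧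
    ∫ x, Real.smoothTransition (u x / (2*δ) - 1) * ∑ i, pd u i x ^ 2 =
      ∫ x, HT (2*δ) (u x) * (Np (fun z => u z ^ q) x * u x ^ (q - 1)) := by
  have h2δ : 0 < 2 * δ := by positivity
  have hF := trunc_contDiff h.cont h.nonneg h.c2 hδ
  have hG := trunc_contDiff h.cont h.nonneg h.c2 h2δ
  have hGc := trunc_compact h.cs h2δ
  have hG1 := hG.of_le one_le_two
  have hF1 := hF.of_le one_le_two
  have e1 : ∀ x, HT (2*δ) (u x) * lapl (fun y => HT δ (u y)) x =
      - (HT (2*δ) (u x) * (Np (fun z => u z ^ q) x * u x ^ (q - 1))) := by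
    intro x
    rcases le_or_gt (u x) (2*δ) with hx | hx
    · rw [HT_zero h2δ hx]; ring
    · have hx0 : 0 < u x := h2δ.trans hx
      rw [lapl_comp ((HT_smooth δ).of_le two_le_top) (h.c2 x hx0), HT_deriv' hδ, ← h.eqn x hx0]
      have : (fun t => Real.smoothTransition (t / δ - 1)) =ᶠ[𝓝 (u x)] fun _ => 1 := by
        filter_upwards [lt_mem_nhds hx] with t ht
        apply Real.smoothTransition.one_of_one_le
        have : 2 ≤ t / δ := by rw [le_div_iff₀ hδ]; exact ht.le
        linarith
      have h3 := this.eq_of_nhds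
      simp only at h3 ⊢
      rw [this.deriv_eq, h3]; simp
  have e2 : ∀ x, ∑ i, pd (fun y => HT (2*δ) (u y)) i x * pd (fun y => HT δ (u y)) i x =
      Real.smoothTransition (u x / (2*δ) - 1) * ∑ i, pd u i x ^ 2 := by
    intro x
    rw [Finset.mul_sum]
    refine Finset.sum_congr rfl fun i _ => ?_
    rcases eq_or_lt_of_le (h.nonneg x) with h' | h'
    · have : (fun x => HT (2*δ) (u x)) =ᶠ[𝓝 x] fun _ => 0 := by
        have : ∀ᶠ y in 𝓝 x, u y < 2*δ := h.cont.continuousAt.eventually_lt_const (by rw [← h']; exact h2δ)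
        filter_upwards [this] with y hy using HT_zero h2δ hy.le
      rw [pd_congr i this, ← h', Real.smoothTransition.zero_of_nonpos (by simp)]
      simp [pd]
    · rw [pd_comp i (HT_deriv h2δ _).differentiableAt ((h.c2 x h').differentiableAt two_ne_zero),
        pd_comp i (HT_deriv hδ _).differentiableAt ((h.c2 x h').differentiableAt two_ne_zero), HT_deriv' hδ, HT_deriv' h2δ]
      simp only
      rcases le_or_gt (u x) (2*δ) with hx | hx
      · rw [Real.smoothTransition.zero_of_nonpos (x := u x / (2*δ) - 1)]
        · ring
        · have : u x / (2*δ) ≤ 1 := by rw [div_le_one h2δ]; exact hx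
          linarith
      · rw [Real.smoothTransition.one_of_one_le (x := u x / δ - 1)]
        · ring
        · have : 2 ≤ u x / δ := by rw [le_div_iff₀ hδ]; exact hx.le
          linarith
  have key := ibp_lapl hG1 hF (Or.inl hGc)
  simp only [e1, e2] at key
  rw [integral_neg] at key
  refine ⟨?_, by linarith⟩
  have : Integrable (fun x => ∑ i, pd (fun y => HT (2*δ) (u y)) i x * pd (fun y => HT δ (u y)) i x) :=
    integrable_finsetSum _ fun i _ => ((pd_continuous i hG1).mul (pd_continuous i hF1)).integrable_of_hasCompactSupport
      (pd_compact i hGc).mul_right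
  simpa only [e2] using this
lemma PS.bsq {u : Eu n → ℝ} {q : ℝ} (h : PS u q) (hq : 1 < q) :
    BS fun z => u z ^ q := h.bs.rpow (by linarith)
lemma PS.bs1 (hn : 3 ≤ n) {u : Eu n → ℝ} {q : ℝ} (h : PS u q) (hq : 1 < q) :
    BS fun x => Np (fun z => u z ^ q) x * u x ^ (q - 1) := by
  have := (h.bs.rpow (q := q - 1) (by linarith)).mul_Np hn (h.bsq hq)
  simpa only [mul_comm] using this
lemma rpow_split {t q : ℝ} (ht : 0 ≤ t) (hq : 1 < q) : t * t ^ (q - 1) = t ^ q := by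
  rcases ht.eq_or_lt with h | h
  · rw [← h, zero_mul, Real.zero_rpow (by linarith)]
  · rw [← rpow_one_add' ht (by linarith)]; congr 1; ring
lemma PS.energy (hn : 3 ≤ n) {u : Eu n → ℝ} {q : ℝ} (h : PS u q) (hq : 1 < q) :
    ∫ x in {x | 0 < u x}, ‖gradient u x‖ ^ 2 = Dq q u := by
  set J := ∫ x, Np (fun z => u z ^ q) x * u x ^ (q - 1) with hJ
  have hb1 := h.bs1 hn hq
  have hub := h.bs
  have hD : Dq q u = ∫ x, u x * (Np (fun z => u z ^ q) x * u x ^ (q - 1)) := by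
    unfold Dq; congr 1; ext x
    rw [← rpow_split (h.nonneg x) hq]; ring
  obtain ⟨M, R, hM0, hM, -⟩ := h.bs.bdd
  have hub1 : BS fun x => u x * (Np (fun z => u z ^ q) x * u x ^ (q - 1)) := by
    simpa only [mul_comm] using hb1.mul h.bs.meas h.nonneg hM
  let d : ℕ → ℝ := fun k => 1 / ((k:ℝ) + 1)
  have hd : ∀ k, 0 < d k := fun k => Nat.one_div_pos_of_nat
  let K : ℕ → Eu n → ℝ := fun k x => Real.smoothTransition (u x / (2*d k) - 1) * ∑ i, pd u i x ^ 2
  have hGb : ∀ k, BS fun x => HT (2*d k) (u x) * (Np (fun z => u z ^ q) x * u x ^ (q - 1)) := by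
    intro k
    have h2 : 0 < 2 * d k := by have := hd k; positivity
    have := hb1.mul (((HT_smooth (2*d k)).continuous.comp h.cont).measurable) (fun x => HT_nonneg h2 _)
      (K := M) (fun x => (HT_le h2 (h.nonneg x)).trans (hM x))
    simpa only [mul_comm, Function.comp] using this
  have hK0 : ∀ k x, 0 ≤ K k x := fun k x => mul_nonneg (Real.smoothTransition.nonneg _) (Finset.sum_nonneg fun i _ => sq_nonneg _)
  have hval : ∀ k, ∫⁻ x, oR (K k x) =
      oR (∫ x, HT (2*d k) (u x) * (Np (fun z => u z ^ q) x * u x ^ (q - 1))) := by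
    intro k
    rw [← (h.flux (hd k)).2, ofReal_integral_eq_lintegral_ofReal (h.flux (hd k)).1 (Eventually.of_forall (hK0 k))]
  have hKm : ∀ k, Measurable (K k) := by
    intro k
    refine Measurable.mul ?_ (Finset.measurable_sum _ fun i _ => ?_)
    · exact (Real.smoothTransition.continuous.comp (by have := h.cont; fun_prop)).measurable
    · exact (measurable_fderiv_apply_const ℝ u _).pow_const 2
  have hdt : Tendsto d atTop (𝓝 0) := tendsto_one_div_add_atTop_nhds_zero_nat
  let Kinf : Eu n → ℝ := Set.indicator {x | 0 < u x} fun x => ∑ i, pd u i x ^ 2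
  have hlim : ∀ x, Tendsto (fun k => K k x) atTop (𝓝 (Kinf x)) := by
    intro x
    rcases eq_or_lt_of_le (h.nonneg x) with h' | h'
    · have : ∀ k, K k x = 0 := by
        intro k
        simp only [K]
        rw [← h', Real.smoothTransition.zero_of_nonpos (by simp), zero_mul]
      simp only [this]
      have : Kinf x = 0 := Set.indicator_of_notMem (by simp [← h']) _
      rw [this]; exact tendsto_const_nhds
    · have : Kinf x = ∑ i, pd u i x ^ 2 := Set.indicator_of_mem (by exact h') _
      rw [this]
      apply tendsto_const_nhds.congr'
      filter_upwards [hdt.eventually_lt_const (show 0 < u x / 4 by positivity)] with k hk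
      simp only [K]
      rw [Real.smoothTransition.one_of_one_le, one_mul]
      have : 2 ≤ u x / (2 * d k) := by
        rw [le_div_iff₀ (by have := hd k; positivity)]; linarith
      linarith
  have hmono : ∀ x, Monotone fun k => oR (K k x) := by
    intro x k l hkl
    apply ENNReal.ofReal_le_ofReal
    refine mul_le_mul_of_nonneg_right (Real.smoothTransition.monotone ?_) (Finset.sum_nonneg fun i _ => sq_nonneg _)
    have h1 : d l ≤ d k := Nat.one_div_le_one_div hkl
    have h2 := hd l
    have : u x / (2 * d k) ≤ u x / (2 * d l) := by
      apply div_le_div_of_nonneg_left (h.nonneg x) (by positivity); linarith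
    linarith
  have t1 : Tendsto (fun k => ∫⁻ x, oR (K k x)) atTop (𝓝 (∫⁻ x, oR (Kinf x))) :=
    lintegral_tendsto_of_tendsto_of_monotone (fun k => (hKm k).ennreal_ofReal.aemeasurable)
      (Eventually.of_forall hmono) (Eventually.of_forall fun x => (ENNReal.continuous_ofReal.tendsto _).comp (hlim x))
  have t2 : Tendsto (fun k => ∫ x, HT (2*d k) (u x) * (Np (fun z => u z ^ q) x * u x ^ (q - 1))) atTop (𝓝 (Dq q u)) := by
    refine tendsto_of_tendsto_of_tendsto_of_le_of_le (g := fun k => Dq q u - (4 * d k) * J) (h := fun _ => Dq q u) ?_ tendsto_const_nhds ?_ ?_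
    · have : Tendsto (fun k => Dq q u - (4 * d k) * J) atTop (𝓝 (Dq q u - (4 * 0) * J)) :=
        ((hdt.const_mul 4).mul_const J).const_sub _
      simpa using this
    · intro k
      have h2 : 0 < 2 * d k := by have := hd k; positivity
      simp only
      rw [hD, hJ, ← integral_const_mul, ← integral_sub hub1.integrable (hb1.integrable.const_mul _)]
      refine integral_mono (hub1.integrable.sub (hb1.integrable.const_mul _)) (hGb k).integrable fun x => ?_
      simp only
      rw [← sub_mul]
      refine mul_le_mul_of_nonneg_right ?_ (hb1.nonneg x)
      have := HT_ge h2 (u x); linarith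
    · intro k
      have h2 : 0 < 2 * d k := by have := hd k; positivity
      simp only
      rw [hD]
      refine integral_mono (hGb k).integrable hub1.integrable fun x => ?_
      exact mul_le_mul_of_nonneg_right (HT_le h2 (h.nonneg x)) (hb1.nonneg x)
  have t3 := (ENNReal.continuous_ofReal.tendsto _).comp t2
  simp only [hval] at t1
  have huniq := tendsto_nhds_unique t1 t3
  have hO : MeasurableSet {x | 0 < u x} := (isOpen_lt continuous_const h.cont).measurableSet
  rw [← integral_indicator hO]
  have e : (Set.indicator {x | 0 < u x} fun x => ‖gradient u x‖ ^ 2) = Kinf := by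
    simp only [Kinf, norm_grad_sq]
  rw [e, integral_eq_lintegral_of_nonneg_ae, huniq]
  · apply ENNReal.toReal_ofReal
    rw [hD]; exact integral_nonneg hub1.nonneg
  · exact Eventually.of_forall fun x => Set.indicator_nonneg (fun x _ => Finset.sum_nonneg fun i _ => sq_nonneg _) x
  · exact (measurable_of_tendsto_metrizable hKm (tendsto_pi_nhds.2 hlim)).aestronglyMeasurable
lemma Dq_nonneg {q : ℝ} {u : Eu n → ℝ} (h0 : ∀ x, 0 ≤ u x) : 0 ≤ Dq q u :=
  integral_nonneg fun x => mul_nonneg (rpow_nonneg (h0 x) _) (Np_nonneg _ _)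
lemma PS.enRatio (hn : 3 ≤ n) {u : Eu n → ℝ} {q : ℝ} (h : PS u q) (hq : 1 < q) :
    enRatio {x | 0 < u x} q u = Dq q u ^ (1 - 1 / q) := by
  unfold _root_.enRatio
  rw [h.energy hn hq]
  have e : ∀ x, |u x| = u x := fun x => abs_of_nonneg (h.nonneg x)
  simp only [e]
  rw [hartree_eq hn (isOpen_lt continuous_const h.cont).measurableSet (h.bsq hq)]
  · change Dq q u / (Dq q u) ^ (1/q) = _
    have h0 := Dq_nonneg (q := q) h.nonneg
    have hq1 : 1 / q < 1 := by rw [div_lt_one (by linarith)]; exact hq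
    rcases h0.eq_or_lt with h' | h'
    · rw [← h', Real.zero_rpow (by linarith : 1 - 1/q ≠ 0)]; simp
    · rw [rpow_sub h', rpow_one]
  · intro x hx
    have : u x = 0 := le_antisymm (not_lt.1 hx) (h.nonneg x)
    rw [this, Real.zero_rpow (by linarith)]
/-- right-hand side of the cutoff energy -/
def Xe (q : ℝ) (u η : Eu n → ℝ) : ℝ :=
  ∫ x, (η x ^ 2 * (u x ^ q * Np (fun z => u z ^ q) x) + u x ^ 2 * ∑ i, pd η i x ^ 2)
lemma PS.Xe_int (hn : 3 ≤ n) {u η : Eu n → ℝ} {q : ℝ} (h : PS u q) (hq : 1 < q) (hη : ContDiff ℝ 2 η)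
    (h1 : ∀ x, |η x| ≤ 1) :
    Integrable (fun x => η x ^ 2 * (u x ^ q * Np (fun z => u z ^ q) x)) ∧ Integrable (fun x => u x ^ 2 * ∑ i, pd η i x ^ 2) := by
  have hη1 := hη.of_le one_le_two
  constructor
  · have := ((h.bsq hq).mul_Np hn (h.bsq hq)).mul (g := fun x => η x ^ 2) (K := 1)
      ((hη.continuous.pow 2).measurable) (fun x => sq_nonneg _) (fun x => by
        rw [← sq_abs]; exact pow_le_one₀ (abs_nonneg _) (h1 x))
    have := this.integrable
    simpa only [mul_comm] using this
  · apply Continuous.integrable_of_hasCompactSupport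
    · exact (h.cont.pow 2).mul (continuous_finsetSum _ fun i _ => (pd_continuous i hη1).pow 2)
    · have : HasCompactSupport (fun x => u x ^ 2) := h.cs.comp_left (g := fun t => t ^ 2) (by norm_num)
      exact this.mul_right
lemma PS.cut (hn : 3 ≤ n) {u η : Eu n → ℝ} {q : ℝ} (h : PS u q) (hq : 1 < q) (hη : ContDiff ℝ 2 η)
    (h1 : ∀ x, |η x| ≤ 1) {δ : ℝ} (hδ : 0 < δ) :
    ∫ x, ∑ i, pd (fun y => η y * HT δ (u y)) i x ^ 2 ≤ Xe q u η := by
  set w : Eu n → ℝ := fun x => HT δ (u x) with hw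
  have hw2 : ContDiff ℝ 2 w := trunc_contDiff h.cont h.nonneg h.c2 hδ
  have hwc : HasCompactSupport w := trunc_compact h.cs hδ
  have hη1 := hη.of_le one_le_two
  have hw1 := hw2.of_le one_le_two
  have hg1 : ContDiff ℝ 1 (fun y => (η y * η y) * w y) := (hη1.mul hη1).mul hw1
  have dη := hη.differentiable two_ne_zero
  have dw := hw2.differentiable two_ne_zero
  have e : ∀ x, ∑ i, pd (fun y => η y * w y) i x ^ 2 =
      ∑ i, pd (fun y => (η y * η y) * w y) i x * pd w i x + w x ^ 2 * ∑ i, pd η i x ^ 2 := by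
    intro x
    rw [Finset.mul_sum, ← Finset.sum_add_distrib]
    refine Finset.sum_congr rfl fun i _ => ?_
    rw [pd_mul i (dη x) (dw x), pd_mul (f := fun y => η y * η y) i ((dη x).mul (dη x)) (dw x), pd_mul i (dη x) (dη x)]
    ring
  have key := ibp_lapl hg1 hw2 (Or.inr hwc)
  have hw0 : ∀ x, 0 ≤ w x := fun x => HT_nonneg hδ _
  have hwu : ∀ x, w x ≤ u x := fun x => HT_le hδ (h.nonneg x)
  have i1 : Integrable fun x => ∑ i, pd (fun y => (η y * η y) * w y) i x * pd w i x :=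
    integrable_finsetSum _ fun i _ => ((pd_continuous i hg1).mul (pd_continuous i hw1)).integrable_of_hasCompactSupport
      (pd_compact i hwc).mul_left
  have i2 : Integrable fun x => w x ^ 2 * ∑ i, pd η i x ^ 2 := by
    apply Continuous.integrable_of_hasCompactSupport
    · exact (hw1.continuous.pow 2).mul (continuous_finsetSum _ fun i _ => (pd_continuous i hη1).pow 2)
    · have : HasCompactSupport (fun x => w x ^ 2) := hwc.comp_left (g := fun t => t ^ 2) (by norm_num)
      exact this.mul_right
  have i3 : Integrable fun x => η x * η x * w x * lapl w x := by
    apply Continuous.integrable_of_hasCompactSupport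
    · exact ((hη.continuous.mul hη.continuous).mul hw1.continuous).mul (lapl_continuous hw2)
    · exact (hwc.mul_left (f := fun x => η x * η x)).mul_right
  obtain ⟨j1, j2⟩ := h.Xe_int hn hq hη h1
  change ∫ x, ∑ i, pd (fun y => η y * w y) i x ^ 2 ≤ _
  simp only [e]
  rw [integral_add i1 i2, ← neg_eq_iff_eq_neg.2 key, ← integral_neg]
  unfold Xe
  rw [integral_add j1 j2]
  refine add_le_add (integral_mono i3.neg j1 fun x => ?_) (integral_mono i2 j2 fun x => ?_)
  · have a1 : - lapl w x ≤ Np (fun z => u z ^ q) x * u x ^ (q - 1) :=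
      trunc_lapl_ge h.cont h.nonneg h.c2 hδ x _ ((h.bs1 hn hq).nonneg x) fun hx => (h.eqn x hx).le
    have a2 : 0 ≤ Np (fun z => u z ^ q) x * u x ^ (q - 1) := (h.bs1 hn hq).nonneg x
    calc _ = η x ^ 2 * (w x * (- lapl w x)) := by ring
      _ ≤ η x ^ 2 * (u x * (Np (fun z => u z ^ q) x * u x ^ (q - 1))) := by
          refine mul_le_mul_of_nonneg_left ?_ (sq_nonneg _)
          exact (mul_le_mul_of_nonneg_left a1 (hw0 x)).trans (mul_le_mul_of_nonneg_right (hwu x) a2)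
      _ = _ := by rw [← rpow_split (h.nonneg x) hq]; ring
  · refine mul_le_mul_of_nonneg_right (pow_le_pow_left₀ (hw0 x) (hwu x) 2) (Finset.sum_nonneg fun i _ => sq_nonneg _)
/-- Dirichlet energy -/
def En (f : Eu n → ℝ) : ℝ := ∫ x, ∑ i, pd f i x ^ 2
lemma En_nonneg (f : Eu n → ℝ) : 0 ≤ En f :=
  integral_nonneg fun x => Finset.sum_nonneg fun i _ => sq_nonneg _
lemma En_int {f : Eu n → ℝ} (h1 : ContDiff ℝ 1 f) (h2 : HasCompactSupport f) :
    Integrable fun x => ∑ i, pd f i x ^ 2 := by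
  refine integrable_finsetSum _ fun i _ => ?_
  have h3 : HasCompactSupport (fun x => pd f i x ^ 2) := (pd_compact i h2).comp_left (g := fun t => t ^ 2) (by norm_num)
  have h4 : Continuous (fun x => pd f i x ^ 2) := (pd_continuous i h1).pow 2
  exact h4.integrable_of_hasCompactSupport h3
lemma exists_sobolev (hn : 3 ≤ n) : ∃ C > 0, ∀ f : Eu n → ℝ, ContDiff ℝ 1 f → HasCompactSupport f →
    ∫⁻ x, oR (|f x| ^ sob n) ≤ oR (C * En f ^ (sob n / 2)) := by
  have hs := sob_pos hn
  have hα := al_pos hn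
  set K := SNormLESNormFDerivOfEqConst ℝ (volume : Measure (Eu n)) 2 with hK
  refine ⟨((K:ℝ) + 1) ^ sob n, by positivity, fun f h1 h2 => ?_⟩
  have e1 : ((sob n).toNNReal : ℝ)⁻¹ = ((2:NNReal):ℝ)⁻¹ - (Module.finrank ℝ (Eu n) : ℝ)⁻¹ := by
    have := al_sob hn
    have hn0 : (0:ℝ) < n := by linarith
    have : sob n = 2 * n / ((n:ℝ) - 2) := by field_simp; linarith
    rw [finrank_euclideanSpace_fin]
    rw [Real.coe_toNNReal _ hs.le, this, NNReal.coe_ofNat]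
    field_simp
  have key := eLpNorm_le_eLpNorm_fderiv_of_eq (μ := (volume : Measure (Eu n))) h1 h2 (p := 2) (p' := (sob n).toNNReal)
    (by norm_num) (by rw [finrank_euclideanSpace_fin]; omega) e1
  rw [eLpNorm_eq_lintegral_rpow_enorm_toReal (by simpa using hs) (by simp),
    eLpNorm_eq_lintegral_rpow_enorm_toReal (by simp) (by simp)] at key
  have e2 : ∫⁻ x, ‖fderiv ℝ f x‖ₑ ^ ((2:NNReal) : ENNReal).toReal = oR (En f) := by
    unfold En
    rw [ofReal_integral_eq_lintegral_ofReal (En_int h1 h2) (Eventually.of_forall fun x => Finset.sum_nonneg fun i _ => sq_nonneg _)]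
    congr 1; ext x
    rw [← norm_grad_sq]
    have : ‖gradient f x‖ = ‖fderiv ℝ f x‖ := by unfold gradient; exact LinearIsometryEquiv.norm_map _ _
    rw [this, ← ofReal_norm]
    simp [ENNReal.ofReal_pow]
  have e3 : ∀ x, ‖f x‖ₑ ^ ((sob n).toNNReal : ENNReal).toReal = oR (|f x| ^ sob n) := by
    intro x
    rw [← ofReal_norm, Real.norm_eq_abs]
    simp [ENNReal.ofReal_rpow_of_nonneg, hs.le]
  simp only [e3] at key
  rw [e2] at key
  have e4 : ((sob n).toNNReal : ENNReal).toReal = sob n := by simp [hs.le]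
  rw [e4] at key
  have k2 := ENNReal.rpow_le_rpow key hs.le
  rw [← ENNReal.rpow_mul, one_div_mul_cancel hs.ne', ENNReal.rpow_one] at k2
  refine k2.trans ?_
  have e5 : (((2:NNReal)) : ENNReal).toReal = 2 := by simp
  rw [e5, ENNReal.ofReal_rpow_of_nonneg (En_nonneg f) (by norm_num), ← ENNReal.ofReal_coe_nnreal,
    ← ENNReal.ofReal_mul (by positivity), ENNReal.ofReal_rpow_of_nonneg (mul_nonneg (by positivity) (rpow_nonneg (En_nonneg f) _)) hs.le]
  apply ENNReal.ofReal_le_ofReal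
  rw [Real.mul_rpow (by positivity) (rpow_nonneg (En_nonneg f) _), ← rpow_mul (En_nonneg f)]
  rw [show 1 / 2 * sob n = sob n / 2 by ring]
  refine mul_le_mul_of_nonneg_right ?_ (rpow_nonneg (En_nonneg f) _)
  apply rpow_le_rpow (by positivity) _ hs.le
  exact le_add_of_nonneg_right zero_le_one
lemma DD_fatou {a : ℕ → Eu n → ℝ} {b : Eu n → ℝ} (ha : ∀ k, Measurable (a k)) (hb : Measurable b)
    (h : ∀ x, Tendsto (fun k => a k x) atTop (𝓝 (b x))) {c : ℕ → ℝ} {d : ℝ} (hc : Tendsto c atTop (𝓝 d))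
    (hD : ∀ k, DD (fun z => oR (a k z)) (fun z => oR (a k z)) ≤ oR (c k)) :
    DD (fun z => oR (b z)) (fun z => oR (b z)) ≤ oR d := by
  have hpr : ∀ f : Eu n → ℝ, Measurable f → DD (fun z => oR (f z)) (fun z => oR (f z)) =
      ∫⁻ q : Eu n × Eu n, oR (f q.1) * (oR (f q.2) * oR (‖q.1 - q.2‖ ^ (-((n:ℝ) - 2))))
        ∂(volume.prod volume) := by
    intro f hf
    rw [DD_eq (by fun_prop), lintegral_prod _ (by fun_prop)]
  rw [hpr b hb]
  have hlim : ∀ q : Eu n × Eu n, Tendsto (fun k => oR (a k q.1) * (oR (a k q.2) * oR (‖q.1 - q.2‖ ^ (-((n:ℝ) - 2)))))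
      atTop (𝓝 (oR (b q.1) * (oR (b q.2) * oR (‖q.1 - q.2‖ ^ (-((n:ℝ) - 2)))))) := by
    intro q
    refine ENNReal.Tendsto.mul ((ENNReal.continuous_ofReal.tendsto _).comp (h _)) (Or.inr (by finiteness)) ?_ (Or.inr (by finiteness))
    exact ENNReal.Tendsto.mul ((ENNReal.continuous_ofReal.tendsto _).comp (h _)) (Or.inr (by finiteness)) tendsto_const_nhds (Or.inr (by finiteness))
  have e : ∀ q : Eu n × Eu n, oR (b q.1) * (oR (b q.2) * oR (‖q.1 - q.2‖ ^ (-((n:ℝ) - 2)))) =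
      liminf (fun k => oR (a k q.1) * (oR (a k q.2) * oR (‖q.1 - q.2‖ ^ (-((n:ℝ) - 2))))) atTop :=
    fun q => (hlim q).liminf_eq.symm
  simp only [e]
  refine (lintegral_liminf_le fun k => ?_).trans ?_
  · have := ha k; fun_prop
  · simp only [← hpr _ (ha _)]
    refine (liminf_le_liminf (Eventually.of_forall hD)).trans ?_
    exact ((ENNReal.continuous_ofReal.tendsto _).comp hc).liminf_eq.le
lemma lint_fatou {a : ℕ → Eu n → ℝ} {b : Eu n → ℝ} (ha : ∀ k, Measurable (a k))
    (h : ∀ x, Tendsto (fun k => a k x) atTop (𝓝 (b x))) {d : ENNReal}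
    (hD : ∀ k, ∫⁻ x, oR (a k x) ≤ d) : ∫⁻ x, oR (b x) ≤ d := by
  have e : ∀ x, oR (b x) = liminf (fun k => oR (a k x)) atTop :=
    fun x => ((ENNReal.continuous_ofReal.tendsto _).comp (h x)).liminf_eq.symm
  simp only [e]
  refine (lintegral_liminf_le fun k => (ha k).ennreal_ofReal).trans ?_
  refine (liminf_le_liminf (Eventually.of_forall hD)).trans ?_
  simp
lemma exists_moll {f : Eu n → ℝ} (h1 : ContDiff ℝ 1 f) (h2 : HasCompactSupport f) :
    ∃ g : ℕ → Eu n → ℝ, (∀ k, ContDiff ℝ (⊤:ℕ∞) (g k)) ∧ (∀ k, HasCompactSupport (g k)) ∧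
      (∀ x, Tendsto (fun k => g k x) atTop (𝓝 (f x))) ∧ Tendsto (fun k => En (g k)) atTop (𝓝 (En f)) := by
  obtain ⟨R, hR⟩ := h2.isCompact.isBounded.subset_closedBall (0 : Eu n)
  let φ : ℕ → ContDiffBump (0 : Eu n) := fun k => ⟨1/((k:ℝ)+1)/2, 1/((k:ℝ)+1), by positivity, by
    have : (0:ℝ) < 1/((k:ℝ)+1) := by positivity
    linarith⟩
  have hφ : Tendsto (fun k => (φ k).rOut) atTop (𝓝 0) := tendsto_one_div_add_atTop_nhds_zero_nat
  have hφ1 : ∀ k, (φ k).rOut ≤ 1 := fun k => by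
    change 1/((k:ℝ)+1) ≤ 1
    rw [div_le_one (by positivity)]; linarith [(Nat.cast_nonneg k : (0:ℝ) ≤ k)]
  let L := ContinuousLinearMap.lsmul ℝ ℝ (E := ℝ)
  let g : ℕ → Eu n → ℝ := fun k => MeasureTheory.convolution ((φ k).normed volume) f L volume
  have hloc : ∀ k, LocallyIntegrable ((φ k).normed volume) volume := fun k =>
    ((φ k).continuous_normed).locallyIntegrable
  have hzero : ∀ h : Eu n → ℝ, (∀ x, x ∉ tsupport f → h x = 0) → ∀ k x, x ∉ closedBall (0:Eu n) (R+1) →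
      MeasureTheory.convolution ((φ k).normed volume) h L volume x = 0 := by
    intro h hh k x hx
    have h0 : ∀ y ∈ ball x (φ k).rOut, h y = 0 := by
      intro y hy
      apply hh
      intro hy2
      have a := hR hy2
      simp only [mem_closedBall, mem_ball, dist_zero_right, not_le] at a hx hy
      have := dist_triangle x y 0
      simp only [dist_zero_right] at this
      rw [dist_comm] at this
      linarith [hφ1 k]
    have := ContDiffBump.normed_convolution_eq_right (μ := volume) (φ := φ k) (g := h) (x₀ := x) (by
      intro y hy; rw [h0 y hy, h0 x (mem_ball_self (φ k).rOut_pos)])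
    rw [this, h0 x (mem_ball_self (φ k).rOut_pos)]
  have hpd : ∀ k i x, pd (g k) i x = MeasureTheory.convolution ((φ k).normed volume) (pd f i) L volume x := by
    intro k i x
    have a := h2.hasFDerivAt_convolution_right L (hloc k) h1 x
    unfold pd
    rw [a.fderiv, convolution_precompR_apply L (hloc k) (h2.fderiv ℝ) (h1.continuous_fderiv one_ne_zero)]
  have hcs : ∀ k, HasCompactSupport (g k) := fun k =>
    HasCompactSupport.intro (isCompact_closedBall (0:Eu n) (R+1)) (fun x hx => hzero f (fun x hx => image_eq_zero_of_notMem_tsupport hx) k x hx)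
  have hsm : ∀ k, ContDiff ℝ (⊤:ℕ∞) (g k) := fun k =>
    (φ k).hasCompactSupport_normed.contDiff_convolution_left L (φ k).contDiff_normed h1.continuous.locallyIntegrable
  refine ⟨g, hsm, hcs, fun x => ContDiffBump.convolution_tendsto_right_of_continuous hφ h1.continuous x, ?_⟩
  have hb : ∀ i, ∃ M, ∀ x, ‖pd f i x‖ ≤ M := fun i =>
    (pd_compact i h2).exists_bound_of_continuous (pd_continuous i h1)
  choose M hM using hb
  have hpd0 : ∀ i x, x ∉ tsupport f → pd f i x = 0 := by
    intro i x hx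
    exact image_eq_zero_of_notMem_tsupport fun h => hx (tsupport_fderiv_apply_subset ℝ _ h)
  unfold En
  refine tendsto_integral_of_dominated_convergence ((closedBall (0:Eu n) (R+1)).indicator fun _ => ∑ i, (3 * M i)^2) ?_ ?_ ?_ ?_
  · intro k
    exact (En_int ((hsm k).of_le (one_le_two.trans two_le_top)) (hcs k)).aestronglyMeasurable
  · have h3 : IntegrableOn (fun _ : Eu n => ∑ i, (3 * M i)^2) (closedBall (0:Eu n) (R+1)) volume :=
      integrableOn_const measure_closedBall_lt_top.ne
    exact h3.integrable_indicator measurableSet_closedBall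
  · intro k
    refine Eventually.of_forall fun x => ?_
    rw [Real.norm_of_nonneg (Finset.sum_nonneg fun i _ => sq_nonneg _)]
    by_cases hx : x ∈ closedBall (0:Eu n) (R+1)
    · rw [Set.indicator_of_mem hx]
      refine Finset.sum_le_sum fun i _ => ?_
      rw [hpd]
      have a := ContDiffBump.dist_normed_convolution_le (μ := volume) (φ := φ k) (g := pd f i) (x₀ := x) (ε := 2 * M i)
        (pd_continuous i h1).aestronglyMeasurable (fun y _ => by
          rw [dist_eq_norm]; exact (norm_sub_le _ _).trans (by linarith [hM i x, hM i y]))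
      rw [← sq_abs]
      refine pow_le_pow_left₀ (abs_nonneg _) ?_ 2
      rw [dist_eq_norm] at a
      have b := norm_sub_norm_le (MeasureTheory.convolution ((φ k).normed volume) (pd f i) L volume x) (pd f i x)
      rw [← Real.norm_eq_abs]
      linarith [hM i x]
    · rw [Set.indicator_of_notMem hx]
      refine (Finset.sum_eq_zero fun i _ => ?_).le
      rw [hpd, hzero _ (hpd0 i) k x hx]; norm_num
  · refine Eventually.of_forall fun x => ?_
    refine tendsto_finsetSum _ fun i _ => ?_
    simp only [hpd]
    exact (ContDiffBump.convolution_tendsto_right_of_continuous hφ (pd_continuous i h1) x).pow 2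
lemma one_le_top' : (1 : WithTop ℕ∞) ≤ ((⊤ : ℕ∞) : WithTop ℕ∞) := one_le_two.trans two_le_top
lemma BS.abs {f : Eu n → ℝ} (hc : Continuous f) (hs : HasCompactSupport f) : BS (fun x => |f x|) :=
  BS.of_cont hc.abs (hs.comp_left (g := fun t => |t|) (by simp)) fun x => abs_nonneg _
lemma exists_hls_sob (hn : 3 ≤ n) : ∃ C > 0, ∀ f : Eu n → ℝ, ContDiff ℝ 1 f → HasCompactSupport f →
    Dq (pcrit n) (fun x => |f x|) ^ (1 / pcrit n) ≤ C * En f := by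
  have hs := sob_pos hn
  have hp := p_pos hn
  obtain ⟨C1, hC1, h1⟩ := exists_sobolev hn
  obtain ⟨C2, hC2, h2⟩ := exists_HLS hn
  refine ⟨(C2 * (C1 ^ (1 / sob n)) ^ (2 * pcrit n)) ^ (1 / pcrit n), by positivity, fun f hf hfc => ?_⟩
  set C3 := (C2 * (C1 ^ (1 / sob n)) ^ (2 * pcrit n)) ^ (1 / pcrit n) with hC3
  have hC3p : 0 < C3 := by positivity
  have hbs := BS.abs hf.continuous hfc
  rw [← div_le_iff₀' hC3p]
  refine le_of_forall_gt_imp_ge_of_dense fun E hE => ?_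
  have hE0 : 0 < E := (En_nonneg f).trans_lt hE
  rw [div_le_iff₀' hC3p]
  set A := C1 ^ (1 / sob n) * E ^ ((1:ℝ)/2) with hA
  have hA0 : 0 < A := by positivity
  have hm : ∫⁻ x, oR (|f x| ^ sob n) ≤ oR (A ^ sob n) := by
    refine (h1 f hf hfc).trans (ENNReal.ofReal_le_ofReal ?_)
    rw [hA, Real.mul_rpow (by positivity) (by positivity), ← rpow_mul hC1.le, ← rpow_mul hE0.le,
      one_div_mul_cancel hs.ne', rpow_one, show 1 / 2 * sob n = sob n / 2 by ring]
    have := rpow_le_rpow (En_nonneg f) hE.le (show 0 ≤ sob n / 2 by positivity)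
    exact mul_le_mul_of_nonneg_left this hC1.le
  have hD := h2 (fun x => |f x|) (fun x => |f x|) A A hA0 hA0 hbs.nonneg hbs.nonneg hbs.meas hbs.meas hm hm
  rw [(hbs.rpow hp).DD_eq hn (hbs.rpow hp), ENNReal.ofReal_le_ofReal_iff (by positivity)] at hD
  change Dq (pcrit n) (fun x => |f x|) ≤ _ at hD
  have h0 : 0 ≤ Dq (pcrit n) (fun x => |f x|) := Dq_nonneg hbs.nonneg
  refine (rpow_le_rpow h0 hD (by positivity)).trans (le_of_eq ?_)
  rw [← rpow_add hA0, ← two_mul, hA, Real.mul_rpow (x := C1 ^ (1 / sob n)) (by positivity) (by positivity), ← mul_assoc,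
    Real.mul_rpow (y := (E ^ ((1:ℝ)/2)) ^ (2 * pcrit n)) (by positivity) (by positivity), ← rpow_mul hE0.le, ← rpow_mul hE0.le, ← hC3,
    show (1:ℝ) / 2 * (2 * pcrit n) * (1 / pcrit n) = 1 by field_simp, rpow_one]
lemma CHLS_den (hn : 3 ≤ n) {f : Eu n → ℝ} (hf : Continuous f) (hfc : HasCompactSupport f) :
    ∫ x, rz Set.univ (fun z => |f z| ^ pcrit n) x * |f x| ^ pcrit n = Dq (pcrit n) fun x => |f x| := by
  have := hartree_eq hn MeasurableSet.univ ((BS.abs hf hfc).rpow (p_pos hn)) (by simp)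
  rwa [Measure.restrict_univ] at this
lemma En_eq (f : Eu n → ℝ) : ∫ x, ‖gradient f x‖ ^ 2 = En f := by simp only [norm_grad_sq, En]
lemma Dq_pos (hn : 3 ≤ n) {f : Eu n → ℝ} (hf : Continuous f) (hfc : HasCompactSupport f) (h0 : f ≠ 0) :
    0 < Dq (pcrit n) fun x => |f x| := by
  have hp := p_pos hn
  refine DD_pos hn ((BS.abs hf hfc).rpow hp) (hf.abs.rpow_const fun x => Or.inr hp.le) ?_
  obtain ⟨x, hx⟩ := Function.ne_iff.1 h0
  exact ⟨x, (rpow_pos_of_pos (abs_pos.2 hx) _).ne'⟩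
lemma exists_bump (n : ℕ) : ∃ f : Eu n → ℝ, ContDiff ℝ (⊤:ℕ∞) f ∧ HasCompactSupport f ∧ f ≠ 0 := by
  let φ : ContDiffBump (0 : Eu n) := ⟨1, 2, one_pos, one_lt_two⟩
  refine ⟨φ, φ.contDiff, φ.hasCompactSupport, fun h => ?_⟩
  have h1 : φ 0 = 1 := φ.one_of_mem_closedBall (by simp [φ.rIn_pos.le])
  rw [h] at h1; simp at h1
lemma CHLS_pos (hn : 3 ≤ n) : 0 < CHLS n := by
  obtain ⟨C, hC, h⟩ := exists_hls_sob hn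
  refine (show (0:ℝ) < 1 / C by positivity).trans_le ?_
  unfold CHLS
  refine le_csInf ?_ ?_
  · obtain ⟨f, h1, h2, h3⟩ := exists_bump n
    exact ⟨_, f, h1, h2, h3, rfl⟩
  · rintro c ⟨f, h1, h2, h3, rfl⟩
    rw [CHLS_den hn h1.continuous h2, En_eq, div_le_div_iff₀ hC (rpow_pos_of_pos (Dq_pos hn h1.continuous h2 h3) _), one_mul, mul_comm]
    exact h f (h1.of_le one_le_top') h2
lemma Sbest_pos (hn : 3 ≤ n) : 0 < Sbest n := by
  have hs := sob_pos hn
  have hα := al_pos hn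
  have e1 : 2 * (n:ℝ) / ((n:ℝ) - 2) = sob n := by have := al_sob hn; field_simp; linarith
  have hn0 : (0:ℝ) < n := by linarith
  have e2 : ((n:ℝ) - 2) / n = 2 / sob n := by have := al_sob hn; field_simp; linarith
  obtain ⟨C, hC, h⟩ := exists_sobolev hn
  refine (show (0:ℝ) < 1 / C ^ (2 / sob n) by positivity).trans_le ?_
  unfold Sbest
  refine le_csInf ?_ ?_
  · obtain ⟨f, h1, h2, h3⟩ := exists_bump n
    exact ⟨_, f, h1, h2, h3, rfl⟩
  · rintro c ⟨f, h1, h2, h3, rfl⟩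
    rw [e1, e2, En_eq]
    have hbs := (BS.abs h1.continuous h2).rpow hs
    have hpos : 0 < ∫ x, |f x| ^ sob n := by
      obtain ⟨x, hx⟩ := Function.ne_iff.1 h3
      refine Continuous.integral_pos_of_hasCompactSupport_nonneg_nonzero (x := x) (h1.continuous.abs.rpow_const fun x => Or.inr hs.le) ?_ hbs.nonneg
        (rpow_pos_of_pos (abs_pos.2 hx) _).ne'
      exact h2.comp_left (g := fun t => |t| ^ sob n) (by simp [hs.ne'])
    have h4 := h f (h1.of_le one_le_top') h2
    have hE := En_nonneg f
    rw [← ofReal_integral_eq_lintegral_ofReal hbs.integrable (Eventually.of_forall hbs.nonneg),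
      ENNReal.ofReal_le_ofReal_iff (by positivity)] at h4
    rw [div_le_div_iff₀ (by positivity) (by positivity), one_mul]
    refine (rpow_le_rpow hpos.le h4 (by positivity)).trans (le_of_eq ?_)
    rw [Real.mul_rpow hC.le (by positivity), ← rpow_mul hE, show sob n / 2 * (2 / sob n) = 1 by field_simp, rpow_one, mul_comm]
lemma ctilde_pos (hn : 3 ≤ n) : 0 < ctilde n ((n:ℝ) - 2) := by
  have hS := Sbest_pos hn
  have hα := al_pos hn
  have hn0 : (0:ℝ) < n := by linarith
  have hC : 0 < Cnmu n ((n:ℝ) - 2) := by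
    unfold Cnmu
    have a1 := Real.Gamma_pos_of_pos (show 0 < ((n:ℝ) - ((n:ℝ) - 2)) / 2 by linarith)
    have a2 := Real.Gamma_pos_of_pos (show 0 < (n:ℝ) - ((n:ℝ) - 2) / 2 by linarith)
    have a3 := Real.Gamma_pos_of_pos hn0
    have a4 := Real.Gamma_pos_of_pos (show 0 < (n:ℝ) / 2 by linarith)
    positivity
  unfold ctilde
  positivity
lemma CHLS_smooth (hn : 3 ≤ n) {f : Eu n → ℝ} (h1 : ContDiff ℝ (⊤:ℕ∞) f) (h2 : HasCompactSupport f) :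
    DD (fun z => oR (|f z| ^ pcrit n)) (fun z => oR (|f z| ^ pcrit n)) ≤
      oR ((En f / CHLS n) ^ pcrit n) := by
  have hp := p_pos hn
  have hS := CHLS_pos hn
  have hbs := (BS.abs h1.continuous h2).rpow hp
  by_cases h0 : f = 0
  · simp [h0, DD, hp.ne']
  rw [hbs.DD_eq hn hbs]
  apply ENNReal.ofReal_le_ofReal
  change Dq (pcrit n) (fun x => |f x|) ≤ _
  have hD := Dq_pos hn h1.continuous h2 h0
  have hle : CHLS n ≤ En f / Dq (pcrit n) (fun x => |f x|) ^ (1 / pcrit n) := by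
    refine csInf_le ⟨0, ?_⟩ ⟨f, h1, h2, h0, by rw [CHLS_den hn h1.continuous h2, En_eq]⟩
    rintro c ⟨g, g1, g2, g3, rfl⟩
    rw [CHLS_den hn g1.continuous g2, En_eq]
    exact div_nonneg (En_nonneg g) (rpow_nonneg (Dq_nonneg fun x => abs_nonneg _) _)
  rw [le_div_iff₀ (by positivity)] at hle
  have h3 : Dq (pcrit n) (fun x => |f x|) ^ (1 / pcrit n) ≤ En f / CHLS n := by
    rw [le_div_iff₀ hS, mul_comm]; exact hle
  have h4 := rpow_le_rpow (by positivity) h3 hp.le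
  rwa [← rpow_mul hD.le, one_div_mul_cancel hp.ne', rpow_one] at h4
lemma CHLS_C1 (hn : 3 ≤ n) {f : Eu n → ℝ} (h1 : ContDiff ℝ 1 f) (h2 : HasCompactSupport f) :
    DD (fun z => oR (|f z| ^ pcrit n)) (fun z => oR (|f z| ^ pcrit n)) ≤
      oR ((En f / CHLS n) ^ pcrit n) := by
  have hp := p_pos hn
  obtain ⟨g, g1, g2, g3, g4⟩ := exists_moll h1 h2
  refine DD_fatou (a := fun k z => |g k z| ^ pcrit n) (fun k => ((g1 k).continuous.abs.rpow_const fun x => Or.inr hp.le).measurable)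
    (h1.continuous.abs.rpow_const fun x => Or.inr hp.le).measurable (fun x => ?_) (c := fun k => (En (g k) / CHLS n) ^ pcrit n) ?_
    (fun k => CHLS_smooth hn (g1 k) (g2 k))
  · exact (g3 x).abs.rpow_const (Or.inr hp.le)
  · exact (g4.div_const _).rpow_const (Or.inr hp.le)
lemma Xe_nonneg {u η : Eu n → ℝ} {q : ℝ} (hu : ∀ x, 0 ≤ u x) : 0 ≤ Xe q u η :=
  integral_nonneg fun x => add_nonneg (mul_nonneg (sq_nonneg _) (mul_nonneg (rpow_nonneg (hu x) _) (Np_nonneg _ _)))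
    (mul_nonneg (sq_nonneg _) (Finset.sum_nonneg fun i _ => sq_nonneg _))
lemma exists_cut (hn : 3 ≤ n) : ∃ Cs > 0, ∀ (u η : Eu n → ℝ) (q : ℝ), PS u q → 1 < q → ContDiff ℝ 2 η →
    (∀ x, 0 ≤ η x) → (∀ x, η x ≤ 1) →
    DD (fun z => oR ((η z * u z) ^ pcrit n)) (fun z => oR ((η z * u z) ^ pcrit n)) ≤
      oR ((Xe q u η / CHLS n) ^ pcrit n) ∧
    ∫⁻ z, oR ((η z * u z) ^ sob n) ≤ oR (Cs * Xe q u η ^ (sob n / 2)) := by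
  have hp := p_pos hn
  have hs := sob_pos hn
  have hS := CHLS_pos hn
  obtain ⟨Cs, hCs, hsob⟩ := exists_sobolev hn
  refine ⟨Cs, hCs, fun u η q hu hq hη h0 h1 => ?_⟩
  have ha : ∀ x, |η x| ≤ 1 := fun x => by rw [abs_of_nonneg (h0 x)]; exact h1 x
  let d : ℕ → ℝ := fun k => 1 / ((k:ℝ) + 1)
  have hd : ∀ k, 0 < d k := fun k => Nat.one_div_pos_of_nat
  have hdt : Tendsto d atTop (𝓝 0) := tendsto_one_div_add_atTop_nhds_zero_nat
  let w : ℕ → Eu n → ℝ := fun k y => η y * HT (d k) (u y)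
  have hw1 : ∀ k, ContDiff ℝ 1 (w k) := fun k => (hη.mul (trunc_contDiff hu.cont hu.nonneg hu.c2 (hd k))).of_le one_le_two
  have hw2 : ∀ k, HasCompactSupport (w k) := fun k => (trunc_compact hu.cs (hd k)).mul_left
  have hw0 : ∀ k x, |w k x| = w k x := fun k x => abs_of_nonneg (mul_nonneg (h0 x) (HT_nonneg (hd k) _))
  have hlim : ∀ x, Tendsto (fun k => w k x) atTop (𝓝 (η x * u x)) := by
    intro x
    refine Tendsto.const_mul _ ?_
    refine tendsto_of_tendsto_of_tendsto_of_le_of_le (g := fun k => u x - 2 * d k) (h := fun _ => u x) ?_ tendsto_const_nhds ?_ ?_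
    · simpa using (hdt.const_mul 2).const_sub (u x)
    · intro k; exact HT_ge (hd k) _
    · intro k; exact HT_le (hd k) (hu.nonneg x)
  have hEX : ∀ k, En (w k) ≤ Xe q u η := fun k => hu.cut hn hq hη ha (hd k)
  have hX0 : 0 ≤ Xe q u η := Xe_nonneg hu.nonneg
  constructor
  · refine DD_fatou (a := fun k z => (w k z) ^ pcrit n) (fun k => ((hw1 k).continuous.rpow_const fun x => Or.inr hp.le).measurable)
      ((hη.continuous.mul hu.cont).rpow_const fun x => Or.inr hp.le).measurable (fun x => (hlim x).rpow_const (Or.inr hp.le))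
      (c := fun k => (Xe q u η / CHLS n) ^ pcrit n) tendsto_const_nhds fun k => ?_
    have := CHLS_C1 hn (hw1 k) (hw2 k)
    simp only [hw0] at this
    refine this.trans (ENNReal.ofReal_le_ofReal ?_)
    exact rpow_le_rpow (div_nonneg (En_nonneg _) hS.le) (div_le_div_of_nonneg_right (hEX k) hS.le) hp.le
  · refine lint_fatou (a := fun k z => (w k z) ^ sob n) (fun k => ((hw1 k).continuous.rpow_const fun x => Or.inr hs.le).measurable)
      (fun x => (hlim x).rpow_const (Or.inr hs.le)) fun k => ?_
    have := hsob _ (hw1 k) (hw2 k)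
    simp only [hw0] at this
    refine this.trans (ENNReal.ofReal_le_ofReal ?_)
    exact mul_le_mul_of_nonneg_left (rpow_le_rpow (En_nonneg _) (hEX k) (by positivity)) hCs.le
lemma dicho {p ζ c : ℝ} (hp : 1 < p) (hζ : 0 < ζ) (hc : 0 < c) : ∃ κ > 0, κ ≤ 1 ∧ ∀ d y1 y2 : ℝ, 0 ≤ y1 → 0 ≤ y2 →
    d ≤ y1 ^ p + y2 ^ p + κ → y1 + y2 ≤ d + κ → d ≤ 1 + κ → c ≤ y1 → y2 ≤ ζ := by
  set ω := min (min ζ c) 1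
  have hω : 0 < ω := by positivity
  have h1 : ω ≤ ζ := (min_le_left _ _).trans (min_le_left _ _)
  have h2 : ω ≤ c := (min_le_left _ _).trans (min_le_right _ _)
  have h3 : ω ≤ 1 := min_le_right _ _
  have hb : 0 < 1 - ω / 2 := by linarith
  set g := 1 - (1 - ω / 2) ^ (p - 1) with hg
  have hg0 : 0 < g := by
    have := rpow_lt_one hb.le (by linarith : 1 - ω / 2 < 1) (by linarith : 0 < p - 1)
    linarith
  have hg1 : g ≤ 1 := by
    have := rpow_nonneg hb.le (p - 1); linarith
  refine ⟨min (ω / 4) (g * c / 4), by positivity, (min_le_left _ _).trans (by linarith), fun d y1 y2 a1 a2 k1 k2 k3 k4 => ?_⟩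
  set κ := min (ω / 4) (g * c / 4)
  have q1 : κ ≤ ω / 4 := min_le_left _ _
  have q2 : κ ≤ g * c / 4 := min_le_right _ _
  by_contra hcon
  push Not at hcon
  have hy1 : y1 ≤ 1 - ω / 2 := by linarith
  have hy2 : y2 ≤ 1 - ω / 2 := by linarith
  have e : ∀ y, 0 ≤ y → y ≤ 1 - ω / 2 → y ^ p ≤ y * (1 - g) := by
    intro y hy hy'
    rw [← rpow_split hy hp]
    refine mul_le_mul_of_nonneg_left ?_ hy
    have := rpow_le_rpow hy hy' (by linarith : 0 ≤ p - 1)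
    linarith
  have b1 := e y1 a1 hy1
  have b2 := e y2 a2 hy2
  have b3 : g * c ≤ g * (y1 + y2) := mul_le_mul_of_nonneg_left (by linarith) hg0.le
  have b4 : 0 < g * c := by positivity
  linarith [mul_sub y1 1 g, mul_sub y2 1 g, mul_add g y1 y2]
lemma rpow_q_le {t p ε : ℝ} (ht : 0 ≤ t) (hp : 1 < p) (hε : 0 < ε) (hq : 1 < p - ε) : t ^ (p - ε) ≤ t ^ p + ε := by
  have h := Real.geom_mean_le_arith_mean2_weighted (w₁ := (p-ε)/p) (w₂ := ε/p) (p₁ := t ^ p) (p₂ := 1)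
    (by positivity) (by positivity) (by positivity) zero_le_one (by field_simp; ring)
  rw [← rpow_mul ht, Real.one_rpow, mul_one, mul_one, mul_div_cancel₀ _ (by linarith : p ≠ 0)] at h
  have h1 : (p-ε)/p * t ^ p ≤ 1 * t ^ p := by
    refine mul_le_mul_of_nonneg_right ?_ (by positivity)
    rw [div_le_one (by linarith)]; linarith
  have h2 : ε / p ≤ ε := div_le_self hε.le hp.le
  linarith
/-- radial cutoff -/
def chi (x0 : Eu n) (ρ : ℝ) (x : Eu n) : ℝ := Real.smoothTransition (ρ⁻¹ ^ 2 * ‖x - x0‖ ^ 2 - 1)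
lemma chi_nonneg (x0 : Eu n) (ρ : ℝ) (x : Eu n) : 0 ≤ chi x0 ρ x := Real.smoothTransition.nonneg _
lemma chi_le (x0 : Eu n) (ρ : ℝ) (x : Eu n) : chi x0 ρ x ≤ 1 := Real.smoothTransition.le_one _
lemma chi_zero {x0 : Eu n} {ρ : ℝ} {x : Eu n} (hρ : 0 < ρ) (h : ‖x - x0‖ ≤ ρ) : chi x0 ρ x = 0 := by
  apply Real.smoothTransition.zero_of_nonpos
  rw [← mul_pow]
  have : ρ⁻¹ * ‖x - x0‖ ≤ 1 := by rw [inv_mul_le_iff₀ hρ]; linarith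
  linarith [pow_le_one₀ (n := 2) (by positivity) this]
lemma chi_arg {x0 : Eu n} {ρ : ℝ} {x : Eu n} (hρ : 0 < ρ) (h : 2 * ρ ≤ ‖x - x0‖) : 4 ≤ ρ⁻¹ ^ 2 * ‖x - x0‖ ^ 2 := by
  rw [← mul_pow]
  have : 2 ≤ ρ⁻¹ * ‖x - x0‖ := by rw [le_inv_mul_iff₀ hρ]; linarith
  nlinarith
lemma chi_one {x0 : Eu n} {ρ : ℝ} {x : Eu n} (hρ : 0 < ρ) (h : 2 * ρ ≤ ‖x - x0‖) : chi x0 ρ x = 1 := by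
  apply Real.smoothTransition.one_of_one_le
  linarith [chi_arg hρ h]
lemma chi_smooth (x0 : Eu n) (ρ : ℝ) : ContDiff ℝ 2 (chi x0 ρ) := by
  unfold chi
  exact (Real.smoothTransition.contDiff.comp ((contDiff_const.mul ((contDiff_id.sub contDiff_const).norm_sq ℝ)).sub contDiff_const))
lemma exists_chi_grad (n : ℕ) : ∃ K > 0, ∀ (x0 : Eu n) (ρ : ℝ), 0 < ρ → ∀ x, ∑ i, pd (chi x0 ρ) i x ^ 2 ≤ K * ρ⁻¹ ^ 2 ∧
    (‖x - x0‖ < ρ ∨ 2 * ρ ≤ ‖x - x0‖ → ∑ i, pd (chi x0 ρ) i x ^ 2 = 0) := by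
  set ψ : ℝ → ℝ := fun t => Real.smoothTransition (t - 1) with hψ
  have hψd : Differentiable ℝ ψ := sT_smooth.differentiable (by simp)
  have hψc : Continuous (deriv ψ) := sT_smooth.continuous_deriv one_le_top'
  obtain ⟨M, hM⟩ := (isCompact_Icc (a := (0:ℝ)) (b := 4)).exists_bound_of_continuousOn hψc.continuousOn
  have hform : ∀ (x0 : Eu n) (ρ : ℝ) x, ∑ i, pd (chi x0 ρ) i x ^ 2 = (deriv ψ (ρ⁻¹ ^ 2 * ‖x - x0‖ ^ 2)) ^ 2 * (4 * (ρ⁻¹^2 * (ρ⁻¹ ^ 2 * ‖x - x0‖ ^ 2))) := by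
    intro x0 ρ x
    have hp : ∀ i, pd (chi x0 ρ) i x = deriv ψ (ρ⁻¹ ^ 2 * ‖x - x0‖ ^ 2) * (ρ⁻¹ ^ 2 * (2 * (x - x0) i)) := by
      intro i
      have hv : HasFDerivAt (fun y : Eu n => ρ⁻¹ ^ 2 * ‖y - x0‖ ^ 2) (ρ⁻¹ ^ 2 • (2 • (innerSL ℝ (x - x0)).comp (ContinuousLinearMap.id ℝ (Eu n)))) x :=
        (((hasFDerivAt_id x).sub_const x0).norm_sq).const_mul _
      have := pd_comp (H := ψ) (v := fun y : Eu n => ρ⁻¹ ^ 2 * ‖y - x0‖ ^ 2) i (hψd _) hv.differentiableAt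
      unfold chi
      rw [this]
      congr 1
      unfold pd
      rw [hv.fderiv]
      simp [EuclideanSpace.inner_single_right]
    simp only [hp, mul_pow]
    rw [← Finset.mul_sum, ← Finset.mul_sum, ← Finset.mul_sum, EuclideanSpace.norm_sq_eq]
    simp only [Real.norm_eq_abs, sq_abs]
    ring
  refine ⟨M ^ 2 * 16 + 1, by positivity, fun x0 ρ hρ x => ?_⟩
  have hz : ‖x - x0‖ < ρ ∨ 2 * ρ ≤ ‖x - x0‖ → deriv ψ (ρ⁻¹ ^ 2 * ‖x - x0‖ ^ 2) = 0 := by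
    rintro (h | h)
    · have h1 : ρ⁻¹ ^ 2 * ‖x - x0‖ ^ 2 < 1 := by
        rw [← mul_pow]
        exact pow_lt_one₀ (by positivity) (by rw [inv_mul_lt_iff₀ hρ]; linarith) two_ne_zero
      have : ψ =ᶠ[𝓝 (ρ⁻¹ ^ 2 * ‖x - x0‖ ^ 2)] fun _ => 0 := by
        filter_upwards [gt_mem_nhds h1] with t ht
        exact Real.smoothTransition.zero_of_nonpos (by linarith)
      rw [this.deriv_eq]; simp
    · have h1 := chi_arg hρ h
      have : ψ =ᶠ[𝓝 (ρ⁻¹ ^ 2 * ‖x - x0‖ ^ 2)] fun _ => 1 := by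
        filter_upwards [lt_mem_nhds (show 2 < ρ⁻¹ ^ 2 * ‖x - x0‖ ^ 2 by linarith)] with t ht
        exact Real.smoothTransition.one_of_one_le (by linarith)
      rw [this.deriv_eq]; simp
  rw [hform]
  refine ⟨?_, fun h => by rw [hz h]; ring⟩
  by_cases h : 2 * ρ ≤ ‖x - x0‖
  · rw [hz (Or.inr h)]; simp; positivity
  · push Not at h
    set t := ρ⁻¹ ^ 2 * ‖x - x0‖ ^ 2 with ht
    have ht0 : 0 ≤ t := by positivity
    have ht4 : t ≤ 4 := by
      have : ρ⁻¹ * ‖x - x0‖ ≤ 2 := by rw [inv_mul_le_iff₀ hρ]; linarith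
      rw [ht, ← mul_pow]
      have := pow_le_pow_left₀ (by positivity) this 2
      linarith
    have h1 := hM t ⟨ht0, ht4⟩
    rw [Real.norm_eq_abs] at h1
    have h2 : deriv ψ t ^ 2 ≤ M ^ 2 := by rw [← sq_abs]; exact pow_le_pow_left₀ (abs_nonneg _) h1 2
    have hr : 0 ≤ ρ⁻¹ ^ 2 := by positivity
    calc deriv ψ t ^ 2 * (4 * (ρ⁻¹ ^ 2 * t)) ≤ M ^ 2 * (4 * (ρ⁻¹ ^ 2 * 4)) := by gcongr
      _ ≤ _ := by linarith
/-- error from the gradient of the cutoff -/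
lemma exists_err (hn : 3 ≤ n) : ∃ C > 0, ∀ (u g : Eu n → ℝ) (x0 : Eu n) (r L τ m : ℝ), BS u → 0 < r → 0 < L → 0 < τ → 0 ≤ m →
    (∀ x, 0 ≤ g x) → (∀ x, g x ≤ r⁻¹ ^ 2) → (∀ x, ¬ (r ≤ ‖x - x0‖ ∧ ‖x - x0‖ < 2 * L * r) → g x = 0) → Measurable g →
    ∫⁻ x in {x | r ≤ ‖x - x0‖ ∧ ‖x - x0‖ < 2 * L * r}, oR (u x ^ sob n) ≤ oR m →
    ∫ x, u x ^ 2 * g x ≤ C * (τ ^ 2 * L ^ n) + τ ^ (2 - sob n) * m := by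
  have hα := al_pos hn
  have hs := sob_gt hn
  have has := al_sob hn
  haveI : Nonempty (Fin n) := ⟨⟨0, by omega⟩⟩
  set V := (volume (ball (0:Eu n) 1)).toReal with hV
  have hV0 : 0 < V := ENNReal.toReal_pos (measure_ball_pos _ _ one_pos).ne' measure_ball_lt_top.ne
  refine ⟨2 ^ n * V, by positivity, fun u g x0 r L τ m hu hr hL hτ hm g0 g1 g2 gm hA => ?_⟩
  set A := {x : Eu n | r ≤ ‖x - x0‖ ∧ ‖x - x0‖ < 2 * L * r} with hAd
  have hnm : Measurable fun x : Eu n => ‖x - x0‖ := by fun_prop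
  have hAm : MeasurableSet A := (measurableSet_le measurable_const hnm).inter (measurableSet_lt hnm measurable_const)
  have hAb : A ⊆ ball x0 (2 * L * r) := fun x hx => by rw [mem_ball, dist_eq_norm]; exact hx.2
  have hum := hu.meas
  have hrn : 0 < r ^ (-(n:ℝ)) := by positivity
  rw [← ENNReal.ofReal_le_ofReal_iff (by positivity), ofReal_integral_eq_lintegral_ofReal
    (BS.mul (by simpa using hu.rpow (q := 2) two_pos) gm g0 g1).integrable
    (Eventually.of_forall fun x => mul_nonneg (sq_nonneg _) (g0 x))]
  calc ∫⁻ x, oR (u x ^ 2 * g x) ≤ ∫⁻ x in A, (oR (τ ^ 2 * r ^ (-(n:ℝ))) + oR (τ ^ (2 - sob n)) * oR (u x ^ sob n)) := by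
        rw [← lintegral_indicator hAm]
        refine lintegral_mono fun x => ?_
        by_cases hx : x ∈ A
        · rw [Set.indicator_of_mem hx, ← ENNReal.ofReal_mul (by positivity), ← ENNReal.ofReal_add (by positivity) (by have := hu.nonneg x; positivity)]
          apply ENNReal.ofReal_le_ofReal
          have hu0 := hu.nonneg x
          have h1 : u x ^ 2 * g x ≤ u x ^ 2 * r⁻¹ ^ 2 := mul_le_mul_of_nonneg_left (g1 x) (sq_nonneg _)
          refine h1.trans ?_
          rcases le_or_gt (u x) (τ * r ^ (-(((n:ℝ)-2)/2))) with h | h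
          · have h2 := pow_le_pow_left₀ hu0 h 2
            have h3 : (τ * r ^ (-(((n:ℝ)-2)/2))) ^ 2 * r⁻¹ ^ 2 = τ ^ 2 * r ^ (-(n:ℝ)) := by
              rw [mul_pow, ← rpow_natCast (r ^ (-(((n:ℝ)-2)/2))), ← rpow_mul hr.le, ← rpow_neg_one r, ← rpow_natCast (r ^ (-1:ℝ)),
                ← rpow_mul hr.le, mul_assoc, ← rpow_add hr]
              congr 2; push_cast; ring
            have h4 : 0 ≤ τ ^ (2 - sob n) * u x ^ sob n := by positivity
            calc _ ≤ (τ * r ^ (-(((n:ℝ)-2)/2))) ^ 2 * r⁻¹ ^ 2 := by gcongr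
              _ ≤ _ := by rw [h3]; linarith
          · have hb : 0 < τ * r ^ (-(((n:ℝ)-2)/2)) := by positivity
            have hup : 0 < u x := hb.trans h
            have h2 := rpow_le_rpow_of_nonpos hb h.le (by linarith : 2 - sob n ≤ 0)
            have h3 : (τ * r ^ (-(((n:ℝ)-2)/2))) ^ (2 - sob n) = τ ^ (2 - sob n) * r ^ 2 := by
              rw [Real.mul_rpow hτ.le (by positivity), ← rpow_mul hr.le, ← rpow_natCast r 2]
              congr 2; push_cast; linarith
            rw [h3, rpow_sub hup, div_le_iff₀ (by positivity)] at h2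
            have h4 : u x ^ (2:ℝ) = u x ^ 2 := by exact_mod_cast rpow_natCast (u x) 2
            rw [h4] at h2
            have h5 : u x ^ 2 * r⁻¹ ^ 2 ≤ τ ^ (2 - sob n) * u x ^ sob n := by
              rw [inv_pow, ← div_eq_mul_inv, div_le_iff₀ (by positivity)]; linarith
            have : 0 ≤ τ ^ 2 * r ^ (-(n:ℝ)) := by positivity
            linarith
        · rw [g2 x hx]; simp
    _ = oR (τ ^ 2 * r ^ (-(n:ℝ))) * volume A + oR (τ ^ (2 - sob n)) * ∫⁻ x in A, oR (u x ^ sob n) := by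
        rw [lintegral_add_left measurable_const, lintegral_const, Measure.restrict_apply_univ, lintegral_const_mul _ (by fun_prop)]
    _ ≤ oR (τ ^ 2 * r ^ (-(n:ℝ))) * oR ((2 * L * r) ^ n * V) + oR (τ ^ (2 - sob n)) * oR m := by
        gcongr
        refine (measure_mono hAb).trans ?_
        rw [Measure.addHaar_ball _ _ (by positivity), finrank_euclideanSpace_fin, ENNReal.ofReal_mul (by positivity), hV, ENNReal.ofReal_toReal measure_ball_lt_top.ne]
    _ = _ := by
        rw [← ENNReal.ofReal_mul (by positivity), ← ENNReal.ofReal_mul (by positivity), ← ENNReal.ofReal_add (by positivity) (by positivity)]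
        congr 2
        rw [rpow_neg hr.le, rpow_natCast]
        field_simp
        rw [mul_pow, mul_pow]; ring
lemma ex_small {c κ γ : ℝ} (hc : 0 ≤ c) (hκ : 0 < κ) (hγ : 0 < γ) : ∃ t > 0, t ≤ 1 ∧ ∀ x, 0 ≤ x → x ≤ t → c * x ^ γ ≤ κ := by
  have h : 0 < κ / (c + κ) := by positivity
  refine ⟨(κ / (c + κ)) ^ γ⁻¹, by positivity, rpow_le_one h.le (by rw [div_le_one (by positivity)]; linarith) (by positivity), fun x hx h1 => ?_⟩
  have := rpow_le_rpow hx h1 hγ.le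
  rw [← rpow_mul h.le, inv_mul_cancel₀ hγ.ne', rpow_one] at this
  refine (mul_le_mul_of_nonneg_left this hc).trans ?_
  rw [← mul_div_assoc, div_le_iff₀ (by positivity)]; nlinarith
def UU (u : Eu n → ℝ) (x : Eu n) : ℝ := if 0 < u x then max (u x) 1 else 0
lemma UU_nonneg (u : Eu n → ℝ) (x : Eu n) : 0 ≤ UU u x := by
  unfold UU; split_ifs <;> positivity
lemma UU_ge (u : Eu n → ℝ) (x : Eu n) : u x ≤ UU u x := by
  unfold UU; split_ifs with h
  · exact le_max_left _ _
  · linarith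
lemma UU_meas {u : Eu n → ℝ} (h : Measurable u) : Measurable (UU u) :=
  Measurable.ite (measurableSet_lt measurable_const h) (h.max measurable_const) measurable_const
lemma UU_q {u : Eu n → ℝ} {x : Eu n} (h : 0 ≤ u x) {p q : ℝ} (hq : 0 < q) (hqp : q ≤ p) : u x ^ q ≤ UU u x ^ p := by
  have h2 := UU_ge u x
  rcases h.eq_or_lt with h1 | h1
  · rw [← h1, Real.zero_rpow hq.ne']; exact rpow_nonneg (UU_nonneg u x) _
  · have : 1 ≤ UU u x := by unfold UU; rw [if_pos h1]; exact le_max_right _ _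
    exact (rpow_le_rpow h h2 hq.le).trans (rpow_le_rpow_of_exponent_le this hqp)
lemma DD_split {f g1 g2 e G : Eu n → ENNReal} (hf : Measurable f) (h1 : Measurable g1) (h2 : Measurable g2) (he : Measurable e) (hG : Measurable G)
    (hle : ∀ z, f z ≤ g1 z + g2 z + e z) (k0 : ∀ z, f z ≤ G z) (k1 : ∀ z, g1 z ≤ G z) (k2 : ∀ z, g2 z ≤ G z) :
    DD f f ≤ DD g1 g1 + DD g2 g2 + oR 2 * DD g1 g2 + oR 3 * DD G e := by
  have ex : ∀ {h : Eu n → ENNReal}, Measurable h → (∀ z, h z ≤ G z) → DD f h ≤ DD g1 h + DD g2 h + DD G e := by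
    intro h hm hk
    refine (DD_mono hle fun z => le_refl (h z)).trans ?_
    rw [DD_add_left (f := fun z => g1 z + g2 z) (h1.add h2) hm, DD_add_left h1 hm, DD_symm he hm]
    gcongr
    exact DD_mono hk fun z => le_rfl
  refine (DD_mono (fun z => le_refl (f z)) hle).trans ?_
  rw [DD_add_right (g := fun z => g1 z + g2 z) hf (h1.add h2), DD_add_right hf h1]
  have a3 : DD f e ≤ DD G e := DD_mono k0 fun z => le_rfl
  refine (add_le_add (add_le_add (ex h1 k1) (ex h2 k2)) a3).trans (le_of_eq ?_)
  rw [DD_symm h2 h1, ENNReal.ofReal_ofNat, ENNReal.ofReal_ofNat]; ring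
set_option maxHeartbeats 1000000 in
lemma exists_step (hn : 3 ≤ n) {F κ : ℝ} (hF : 0 < F) (hκ : 0 < κ) : ∃ L m ε1 : ℝ, 4 ≤ L ∧ 0 < m ∧ 0 < ε1 ∧
    ∀ (u : Eu n → ℝ) (ε : ℝ) (x0 : Eu n) (r : ℝ), 0 < ε → ε < ε1 → 1 < pcrit n - ε → PS u (pcrit n - ε) → 0 < r →
    ∫⁻ x, oR (UU u x ^ sob n) ≤ oR F →
    ∫⁻ x in {x | r ≤ ‖x - x0‖ ∧ ‖x - x0‖ < 2 * L * r}, oR (UU u x ^ sob n) ≤ oR m →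
    Dq (pcrit n - ε) u ≤ (Xe (pcrit n - ε) u (fun x => 1 - chi x0 r x) / CHLS n) ^ pcrit n + (Xe (pcrit n - ε) u (chi x0 (L * r)) / CHLS n) ^ pcrit n + κ ∧
    Xe (pcrit n - ε) u (fun x => 1 - chi x0 r x) + Xe (pcrit n - ε) u (chi x0 (L * r)) ≤ Dq (pcrit n - ε) u + κ := by
  have hα := al_pos hn
  have hp := p_gt hn
  have hs := sob_pos hn
  obtain ⟨C1, hC1, hHLS⟩ := exists_HLS hn
  obtain ⟨C2, hC2, hcr⟩ := exists_cross hn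
  obtain ⟨C3, hC3, herr⟩ := exists_err hn
  obtain ⟨K, hK, hchi⟩ := exists_chi_grad n
  obtain ⟨Cs, hCs, hcut⟩ := exists_cut hn
  obtain ⟨t1, ht1, ht1', hL'⟩ := ex_small (c := 2 * (C2 * (F + C2) ^ 2)) (κ := κ / 3) (γ := ((n:ℝ) - 2) / 2) (by positivity) (by positivity) (by positivity)
  set L : ℝ := 4 * t1⁻¹ with hL
  have hL4 : 4 ≤ L := by have := (one_le_inv₀ ht1).2 ht1'; linarith
  have hL0 : 0 < L := by linarith
  have hLs : 2 * (C2 * (F + C2) ^ 2 * L ^ (-(((n:ℝ) - 2) / 2))) ≤ κ / 3 := by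
    have h1 := hL' L⁻¹ (by positivity) (by rw [hL, mul_inv, inv_inv]; linarith)
    rw [Real.inv_rpow hL0.le, ← rpow_neg hL0.le] at h1; linarith
  obtain ⟨τ, hτ, -, hτ'⟩ := ex_small (c := 2 * K * C3 * L ^ n) (κ := κ / 2) (γ := 2) (by positivity) (by positivity) (by positivity)
  have hτ2 := hτ' τ hτ.le le_rfl
  rw [show τ ^ (2:ℝ) = τ ^ 2 from by exact_mod_cast rpow_natCast τ 2] at hτ2
  obtain ⟨m1, hm1, -, hm1'⟩ := ex_small (c := 2 * K * τ ^ (2 - sob n)) (κ := κ / 2) (γ := 1) (by positivity) (by positivity) (by positivity)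
  obtain ⟨B, hB, -, hB'⟩ := ex_small (c := 3 * C1 * (F ^ (sob n)⁻¹) ^ pcrit n) (κ := κ / 3) (γ := pcrit n) (by positivity) (by positivity) (by linarith)
  obtain ⟨ε1, hε1, -, hε1'⟩ := ex_small (c := 3 * (C1 * ((F ^ (sob n)⁻¹) ^ pcrit n * (F ^ (sob n)⁻¹) ^ pcrit n))) (κ := κ / 3) (γ := 1) (by positivity) (by positivity) (by linarith)
  have hB2 := hB' B hB.le le_rfl
  set A0 := F ^ (sob n)⁻¹ with hA0
  have hA0' : 0 < A0 := by positivity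
  have hA0s : A0 ^ sob n = F := by rw [hA0, ← rpow_mul hF.le, inv_mul_cancel₀ hs.ne', rpow_one]
  refine ⟨L, min m1 (B ^ sob n), ε1, hL4, by positivity, hε1, fun u ε x0 r hε hεle hq hu hr hUF hUm => ?_⟩
  have hε2 := hε1' ε hε.le hεle.le
  set m := min m1 (B ^ sob n)
  have hm0 : 0 < m := by positivity
  have hm2 := hm1' m hm0.le (min_le_left _ _)
  rw [rpow_one] at hm2 hε2
  set q := pcrit n - ε with hqd
  set A := {x : Eu n | r ≤ ‖x - x0‖ ∧ ‖x - x0‖ < 2 * L * r} with hAd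
  have hnm : Measurable fun x : Eu n => ‖x - x0‖ := by fun_prop
  have hAm : MeasurableSet A := (measurableSet_le measurable_const hnm).inter (measurableSet_lt hnm measurable_const)
  have hLr : 0 < L * r := by positivity
  have h4r : 4 * r ≤ L * r := by gcongr
  set η1 : Eu n → ℝ := fun x => 1 - chi x0 r x with hη1
  set η2 : Eu n → ℝ := chi x0 (L * r) with hη2
  have s1 : ContDiff ℝ 2 η1 := contDiff_const.sub (chi_smooth x0 r)
  have s2 : ContDiff ℝ 2 η2 := chi_smooth x0 _
  have a1 : ∀ x, 0 ≤ η1 x := fun x => by simp only [hη1]; linarith [chi_le x0 r x]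
  have a1' : ∀ x, η1 x ≤ 1 := fun x => by simp only [hη1]; linarith [chi_nonneg x0 r x]
  have a2 : ∀ x, 0 ≤ η2 x := fun x => chi_nonneg x0 _ x
  have a2' : ∀ x, η2 x ≤ 1 := fun x => chi_le x0 _ x
  have z1 : ∀ x, 2 * r ≤ ‖x - x0‖ → η1 x = 0 := fun x hx => by simp only [hη1]; rw [chi_one hr hx, sub_self]
  have z2 : ∀ x, ‖x - x0‖ ≤ L * r → η2 x = 0 := fun x hx => chi_zero hLr hx
  have hum := hu.bs.meas
  have hUm' := UU_meas hum
  have hcu := hu.cont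
  have hη1c := s1.continuous
  have hη2c := s2.continuous
  have hXn1 : 0 ≤ Xe q u η1 := Xe_nonneg hu.nonneg
  have hXn2 : 0 ≤ Xe q u η2 := Xe_nonneg hu.nonneg
  have hS := CHLS_pos hn
  have ηle : ∀ {η : Eu n → ℝ}, (∀ x, 0 ≤ η x) → (∀ x, η x ≤ 1) → ∀ x, (η x * u x) ^ pcrit n ≤ UU u x ^ pcrit n := by
    intro η h h' x
    refine rpow_le_rpow (mul_nonneg (h x) (hu.nonneg x)) ?_ (by linarith)
    exact (mul_le_of_le_one_left (hu.nonneg x) (h' x)).trans (UU_ge u x)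
  constructor
  · set e : Eu n → ENNReal := fun z => oR ε * oR (UU u z ^ pcrit n) + oR ((A.indicator (UU u) z) ^ pcrit n) with he
    have hAU : Measurable (A.indicator (UU u)) := hUm'.indicator hAm
    have hAU0 : ∀ z, 0 ≤ A.indicator (UU u) z := fun z => Set.indicator_nonneg (fun x _ => UU_nonneg u x) z
    have key := DD_split (n := n) (f := fun z => oR (u z ^ q)) (g1 := fun z => oR ((η1 z * u z) ^ pcrit n))
      (g2 := fun z => oR ((η2 z * u z) ^ pcrit n)) (e := e) (G := fun z => oR (UU u z ^ pcrit n))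
      (by fun_prop) (by fun_prop) (by fun_prop) (by fun_prop) (by fun_prop) ?_
      (fun z => ENNReal.ofReal_le_ofReal (UU_q (hu.nonneg z) (by linarith) (by linarith)))
      (fun z => ENNReal.ofReal_le_ofReal (ηle a1 a1' z)) (fun z => ENNReal.ofReal_le_ofReal (ηle a2 a2' z))
    · rw [(hu.bsq hq).DD_eq hn (hu.bsq hq)] at key
      have d1 := (hcut u η1 q hu hq s1 a1 a1').1
      have d2 := (hcut u η2 q hu hq s2 a2 a2').1
      have d3 : DD (fun z => oR ((η1 z * u z) ^ pcrit n)) (fun z => oR ((η2 z * u z) ^ pcrit n)) ≤ oR (C2 * (F + C2) ^ 2 * L ^ (-(((n:ℝ) - 2) / 2))) := by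
        have hmono : ∀ {η : Eu n → ℝ}, (∀ x, 0 ≤ η x) → (∀ x, η x ≤ 1) → ∫⁻ z, oR ((η z * u z) ^ sob n) ≤ oR F := by
          intro η h h'
          refine (lintegral_mono fun z => ENNReal.ofReal_le_ofReal ?_).trans hUF
          refine rpow_le_rpow (mul_nonneg (h z) (hu.nonneg z)) ?_ (by linarith)
          exact (mul_le_of_le_one_left (hu.nonneg z) (h' z)).trans (UU_ge u z)
        refine hcr (fun z => η1 z * u z) (fun z => η2 z * u z) x0 r L F hr hL4 hF.le (fun z => mul_nonneg (a1 z) (hu.nonneg z)) (fun z => mul_nonneg (a2 z) (hu.nonneg z))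
          (by fun_prop) (by fun_prop) ?_ ?_ (hmono a1 a1') (hmono a2 a2')
        · intro z hz
          rw [mem_ball, dist_eq_norm, not_lt] at hz
          rw [z1 z hz, zero_mul]
        · intro z hz
          rw [mem_ball, dist_eq_norm] at hz
          rw [z2 z hz.le, zero_mul]
      have d4 : DD (fun z => oR (UU u z ^ pcrit n)) e ≤ oR (ε * (C1 * (A0 ^ pcrit n * A0 ^ pcrit n)) + C1 * (A0 ^ pcrit n * B ^ pcrit n)) := by
        have k1 := hHLS (UU u) (UU u) A0 A0 hA0' hA0' (UU_nonneg u) (UU_nonneg u) hUm' hUm' (by rwa [hA0s]) (by rwa [hA0s])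
        have k2 := hHLS (UU u) (A.indicator (UU u)) A0 B hA0' hB (UU_nonneg u) hAU0 hUm' hAU (by rwa [hA0s]) (by
          have : (fun z => oR (A.indicator (UU u) z ^ sob n)) = A.indicator fun z => oR (UU u z ^ sob n) := by
            ext z
            by_cases hz : z ∈ A
            · rw [Set.indicator_of_mem hz, Set.indicator_of_mem hz]
            · rw [Set.indicator_of_notMem hz, Set.indicator_of_notMem hz, Real.zero_rpow hs.ne', ENNReal.ofReal_zero]
          rw [this, lintegral_indicator hAm]
          exact hUm.trans (ENNReal.ofReal_le_ofReal (min_le_right _ _)))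
        rw [he, DD_add_right (by fun_prop) (by fun_prop), ENNReal.ofReal_add (by positivity) (by positivity), ENNReal.ofReal_mul hε.le]
        refine add_le_add ?_ k2
        rw [DD_symm (by fun_prop) (by fun_prop)]
        refine le_trans (le_of_eq ?_) (mul_le_mul_right k1 _)
        unfold DD
        rw [← lintegral_const_mul _ (by have := NN_meas (n := n) (f := fun z => oR (UU u z ^ pcrit n)) (by fun_prop); fun_prop)]
        simp only [mul_assoc]
      have y1 : 0 ≤ (Xe q u η1 / CHLS n) ^ pcrit n := by positivity
      have y2 : 0 ≤ (Xe q u η2 / CHLS n) ^ pcrit n := by positivity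
      have y3 : 0 ≤ C2 * (F + C2) ^ 2 * L ^ (-(((n:ℝ) - 2) / 2)) := by positivity
      have y4 : 0 ≤ ε * (C1 * (A0 ^ pcrit n * A0 ^ pcrit n)) + C1 * (A0 ^ pcrit n * B ^ pcrit n) := by positivity
      have fin := key.trans (add_le_add (add_le_add (add_le_add d1 d2) (mul_le_mul_right d3 _)) (mul_le_mul_right d4 _))
      rw [← ENNReal.ofReal_mul (by norm_num), ← ENNReal.ofReal_mul (by norm_num),
        ← ENNReal.ofReal_add y1 y2, ← ENNReal.ofReal_add (by positivity) (by positivity), ← ENNReal.ofReal_add (by positivity) (by positivity),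
        ENNReal.ofReal_le_ofReal_iff (by positivity)] at fin
      unfold Dq
      linarith only [fin, hLs, hB2, hε2]
    · intro z
      have hn1 : 0 ≤ η1 z * u z := mul_nonneg (a1 z) (hu.nonneg z)
      have hn2 : 0 ≤ η2 z * u z := mul_nonneg (a2 z) (hu.nonneg z)
      have hU0 := UU_nonneg u z
      have hAz := hAU0 z
      simp only [he]
      rw [← ENNReal.ofReal_mul hε.le, ← ENNReal.ofReal_add (by positivity) (by positivity), ← ENNReal.ofReal_add (by positivity) (by positivity), ← ENNReal.ofReal_add (by positivity) (by positivity)]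
      apply ENNReal.ofReal_le_ofReal
      have p1 : 0 ≤ (η1 z * u z) ^ pcrit n := by positivity
      have p2 : 0 ≤ (η2 z * u z) ^ pcrit n := by positivity
      have p3 : 0 ≤ ε * UU u z ^ pcrit n := by positivity
      have p4 : 0 ≤ A.indicator (UU u) z ^ pcrit n := by positivity
      by_cases hz : z ∈ A
      · have := UU_q (p := pcrit n) (hu.nonneg z) (by linarith : 0 < q) (by linarith)
        rw [Set.indicator_of_mem hz] at p4 ⊢
        linarith only [p1, p2, p3, this]
      · have hqp : u z ^ q ≤ u z ^ pcrit n + ε * UU u z ^ pcrit n := by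
          rcases (hu.nonneg z).eq_or_lt with h | h
          · rw [← h, Real.zero_rpow (by linarith), Real.zero_rpow (by linarith)]; linarith
          · have h1 : 1 ≤ UU u z := by unfold UU; rw [if_pos h]; exact le_max_right _ _
            have := rpow_q_le (hu.nonneg z) hp hε hq
            have h2 := Real.one_le_rpow h1 (by linarith : 0 ≤ pcrit n)
            have h3 := mul_le_mul_of_nonneg_left h2 hε.le
            linarith
        have hor : η1 z = 1 ∨ η2 z = 1 := by
          rw [hAd, Set.mem_setOf_eq, not_and_or, not_le, not_lt] at hz
          rcases hz with hz | hz
          · left; simp only [hη1]; rw [chi_zero hr hz.le, sub_zero]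
          · right; exact chi_one hLr (by linarith)
        rcases hor with h | h
        · rw [h, one_mul] at p1 ⊢; linarith only [p2, p4, hqp]
        · rw [h, one_mul] at p2 ⊢; linarith only [p1, p4, hqp]
  · obtain ⟨i1, j1⟩ := hu.Xe_int hn hq s1 fun x => by rw [abs_of_nonneg (a1 x)]; exact a1' x
    obtain ⟨i2, j2⟩ := hu.Xe_int hn hq s2 fun x => by rw [abs_of_nonneg (a2 x)]; exact a2' x
    have e0 : ∀ x, ∑ i, pd η1 i x ^ 2 = ∑ i, pd (chi x0 r) i x ^ 2 := by
      intro x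
      refine Finset.sum_congr rfl fun i _ => ?_
      have : pd η1 i x = - pd (chi x0 r) i x := by
        unfold pd; simp only [hη1]; rw [fderiv_const_sub]; rfl
      rw [this, neg_sq]
    have hpm : ∀ {η : Eu n → ℝ}, ContDiff ℝ 2 η → Measurable fun x => ∑ i, pd η i x ^ 2 := fun h =>
      (continuous_finsetSum _ fun i _ => (pd_continuous i (h.of_le one_le_two)).pow 2).measurable
    set g : Eu n → ℝ := fun x => (2 * K)⁻¹ * (∑ i, pd η1 i x ^ 2 + ∑ i, pd η2 i x ^ 2) with hg
    have herr' := herr u g x0 r L τ m hu.bs hr hL0 hτ hm0.le ?_ ?_ ?_ ?_ ?_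
    · have e1 : Xe q u η1 + Xe q u η2 = ∫ x, (η1 x ^ 2 * (u x ^ q * Np (fun z => u z ^ q) x) + η2 x ^ 2 * (u x ^ q * Np (fun z => u z ^ q) x)) + 2 * K * (u x ^ 2 * g x) := by
        unfold Xe
        refine (integral_add (i1.add j1) (i2.add j2)).symm.trans ?_
        congr 1; ext x; simp only [Pi.add_apply]; simp only [hg]; field_simp; ring
      have hgi : Integrable fun x => 2 * K * (u x ^ 2 * g x) := by
        refine (j1.add j2).congr (Eventually.of_forall fun x => ?_)
        simp only [hg, Pi.add_apply]; field_simp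
      have e4 := integral_add (i1.add i2) hgi
      simp only [Pi.add_apply, integral_const_mul] at e4
      rw [e1, e4]
      have e2 : ∫ x, (η1 x ^ 2 * (u x ^ q * Np (fun z => u z ^ q) x) + η2 x ^ 2 * (u x ^ q * Np (fun z => u z ^ q) x)) ≤ Dq q u := by
        refine integral_mono (i1.add i2) ((hu.bsq hq).mul_Np hn (hu.bsq hq)).integrable fun x => ?_
        have h0 : 0 ≤ u x ^ q * Np (fun z => u z ^ q) x := mul_nonneg (rpow_nonneg (hu.nonneg x) _) (Np_nonneg _ _)
        have h1 : η1 x ^ 2 + η2 x ^ 2 ≤ 1 := by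
          rcases le_total (2 * r) ‖x - x0‖ with h | h
          · rw [z1 x h]; have := pow_le_one₀ (n := 2) (a2 x) (a2' x); linarith
          · rw [z2 x (by linarith)]; have := pow_le_one₀ (n := 2) (a1 x) (a1' x); linarith
        have := mul_le_mul_of_nonneg_right h1 h0
        simp only; linarith
      have e3 := mul_le_mul_of_nonneg_left herr' (by positivity : 0 ≤ 2 * K)
      linarith only [e2, e3, hτ2, hm2]
    · intro x; simp only [hg]
      exact mul_nonneg (by positivity) (add_nonneg (Finset.sum_nonneg fun i _ => sq_nonneg _) (Finset.sum_nonneg fun i _ => sq_nonneg _))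
    · intro x
      have h1 := (hchi x0 r hr x).1
      have h2 := (hchi x0 (L * r) hLr x).1
      have h3 : (L * r)⁻¹ ^ 2 ≤ r⁻¹ ^ 2 := by
        gcongr; linarith
      have h4 := mul_le_mul_of_nonneg_left h3 hK.le
      simp only [hg]
      rw [e0, inv_mul_le_iff₀ (by positivity)]
      linarith only [h1, h2, h4]
    · intro x hx
      rw [not_and_or, not_le, not_lt] at hx
      simp only [hg]
      rw [e0, (hchi x0 r hr x).2 ?_, (hchi x0 (L * r) hLr x).2 ?_]
      · simp
      · rcases hx with h | h
        · left; linarith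
        · right; linarith
      · rcases hx with h | h
        · left; exact h
        · right; nlinarith
    · exact ((hpm s1).add (hpm s2)).const_mul _
    · refine (lintegral_mono fun x => ENNReal.ofReal_le_ofReal ?_).trans hUm
      exact rpow_le_rpow (hu.nonneg x) (UU_ge u x) hs.le
def E0 (n : ℕ) : ℝ := CHLS n ^ (1 - 1 / pcrit n)⁻¹
lemma E0_pos (hn : 3 ≤ n) : 0 < E0 n := by
  have := CHLS_pos hn; unfold E0; positivity
lemma E0_scale (hn : 3 ≤ n) {X : ℝ} (hX : 0 ≤ X) : (X / CHLS n) ^ pcrit n = E0 n * (X / E0 n) ^ pcrit n := by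
  have h := CHLS_pos hn
  have hE := E0_pos hn
  have hp := p_gt hn
  have h1 : CHLS n ^ pcrit n = E0 n ^ (pcrit n - 1) := by
    unfold E0; rw [← rpow_mul h.le]; congr 1
    have : pcrit n - 1 ≠ 0 := by linarith
    field_simp
  rw [Real.div_rpow hX h.le, Real.div_rpow hX hE.le, h1, rpow_sub_one hE.ne']
  field_simp
lemma Xe_one {q : ℝ} (u : Eu n → ℝ) : Xe q u (fun _ => 1) = Dq q u := by
  unfold Xe Dq
  congr 1; ext x
  simp [pd]
lemma pigeon {f : Eu n → ENNReal} {F m l r0 : ℝ} (x0 : Eu n) (hF : 0 < F) (hm : 0 < m) (hl : 1 < l) (hr : 0 < r0)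
    (hf : ∫⁻ x, f x ≤ oR F) {J : ℕ} (hJ : F < J * m) :
    ∃ j < J, ∫⁻ x in {x | l ^ j * r0 ≤ ‖x - x0‖ ∧ ‖x - x0‖ < l * (l ^ j * r0)}, f x ≤ oR m := by
  by_contra! hcon
  set A : ℕ → Set (Eu n) := fun j => {x | l ^ j * r0 ≤ ‖x - x0‖ ∧ ‖x - x0‖ < l * (l ^ j * r0)} with hA
  have hnm : Measurable fun x : Eu n => ‖x - x0‖ := by fun_prop
  have hAm : ∀ j, MeasurableSet (A j) := fun j => (measurableSet_le measurable_const hnm).inter (measurableSet_lt hnm measurable_const)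
  have hlt : ∀ i j, i < j → Disjoint (A i) (A j) := by
    intro i j hij
    rw [Set.disjoint_left]
    rintro x ⟨-, h1⟩ ⟨h2, -⟩
    have := pow_le_pow_right₀ hl.le (show i + 1 ≤ j from hij)
    have h3 := mul_le_mul_of_nonneg_right this hr.le
    rw [pow_succ] at h3; linarith
  have hd : Set.PairwiseDisjoint (↑(Finset.range J)) A := by
    intro i _ j _ hij
    rcases lt_or_gt_of_ne hij with h | h
    · exact hlt i j h
    · exact (hlt j i h).symm
  have h1 := lintegral_biUnion_finset (μ := volume) hd (fun b _ => hAm b) f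
  have h2 : ∑ j ∈ Finset.range J, oR m ≤ ∑ j ∈ Finset.range J, ∫⁻ x in A j, f x :=
    Finset.sum_le_sum fun j hj => (hcon j (Finset.mem_range.1 hj)).le
  rw [← h1, Finset.sum_const, Finset.card_range, nsmul_eq_mul, ← ENNReal.ofReal_natCast, ← ENNReal.ofReal_mul (by positivity)] at h2
  have h3 := (h2.trans (setLIntegral_le_lintegral _ _)).trans hf
  rw [ENNReal.ofReal_le_ofReal_iff hF.le] at h3
  linarith
lemma PS.mass (hn : 3 ≤ n) : ∃ Cs > 0, ∀ (u : Eu n → ℝ) (q : ℝ), PS u q → 1 < q →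
    ∫⁻ z, oR (u z ^ sob n) ≤ oR (Cs * Dq q u ^ (sob n / 2)) := by
  obtain ⟨Cs, hCs, h⟩ := exists_cut hn
  refine ⟨Cs, hCs, fun u q hu hq => ?_⟩
  have := (h u (fun _ => 1) q hu hq contDiff_const (fun _ => zero_le_one) (fun _ => le_rfl)).2
  simpa only [one_mul, Xe_one] using this
set_option maxHeartbeats 1000000 in
lemma exists_tail (hn : 3 ≤ n) {c0 δ V : ℝ} (hc0 : 0 < c0) (hδ : 0 < δ) (hV : 0 < V) : ∃ R κ ε1 : ℝ, 1 ≤ R ∧ 0 < κ ∧ 0 < ε1 ∧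
    ∀ (u : Eu n → ℝ) (ε : ℝ), 0 < ε → ε < ε1 → 1 < pcrit n - ε → PS u (pcrit n - ε) → volume {x | 0 < u x} ≤ oR V →
    Dq (pcrit n - ε) u ≤ E0 n * (1 + κ) → ∀ (x0 : Eu n) (r0 : ℝ), 0 < r0 →
    oR c0 ≤ ∫⁻ x in ball x0 r0, oR (u x ^ sob n) →
    ∫⁻ x in {x | R * r0 < ‖x - x0‖}, oR (u x ^ sob n) ≤ oR δ := by
  have hp := p_gt hn
  have hs := sob_pos hn
  have hE := E0_pos hn
  obtain ⟨Cs, hCs, hcut⟩ := exists_cut hn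
  obtain ⟨Cm, hCm, hmass⟩ := PS.mass hn
  obtain ⟨κ, hκ, hκ1, hdi⟩ := dicho (p := pcrit n) (ζ := (δ / Cs) ^ (2 / sob n) / E0 n) (c := (c0 / Cs) ^ (2 / sob n) / E0 n) hp (by positivity) (by positivity)
  set F := Cm * (2 * E0 n) ^ (sob n / 2) + V with hFd
  have hF : 0 < F := by positivity
  obtain ⟨L, m, ε1, hL, hm, hε1, hstep⟩ := exists_step hn hF (mul_pos hκ hE)
  obtain ⟨J, hJ⟩ := exists_nat_gt (F / m)
  rw [div_lt_iff₀ hm] at hJ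
  have hL1 : 1 < 2 * L := by linarith
  refine ⟨(2 * L) ^ J, κ, ε1, one_le_pow₀ hL1.le, hκ, hε1, fun u ε hε hε' hq hu hvol hD x0 r0 hr0 hc => ?_⟩
  set q := pcrit n - ε
  have hu0 := hu.nonneg
  have hum := hu.bs.meas
  have hD0 : 0 ≤ Dq q u := Dq_nonneg hu0
  have hUF : ∫⁻ x, oR (UU u x ^ sob n) ≤ oR F := by
    have hset : MeasurableSet {x | 0 < u x} := measurableSet_lt measurable_const hum
    calc ∫⁻ x, oR (UU u x ^ sob n) ≤ ∫⁻ x, (oR (u x ^ sob n) + {x | 0 < u x}.indicator (fun _ => (1:ENNReal)) x) := by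
          refine lintegral_mono fun x => ?_
          by_cases h : 0 < u x
          · rw [Set.indicator_of_mem (show x ∈ {x | 0 < u x} from h), ← ENNReal.ofReal_one, ← ENNReal.ofReal_add (by have := hu0 x; positivity) zero_le_one]
            apply ENNReal.ofReal_le_ofReal
            have : UU u x = max (u x) 1 := if_pos h
            rw [this]
            have h3 : 0 ≤ u x ^ sob n := by positivity
            rcases max_choice (u x) 1 with h2 | h2 <;> rw [h2]
            · linarith
            · rw [Real.one_rpow]; linarith
          · have : UU u x = 0 := if_neg h
            rw [this, Real.zero_rpow hs.ne']; simp
      _ = (∫⁻ x, oR (u x ^ sob n)) + volume {x | 0 < u x} := by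
          rw [lintegral_add_left (by fun_prop), lintegral_indicator_const hset, one_mul]
      _ ≤ oR (Cm * (2 * E0 n) ^ (sob n / 2)) + oR V := by
          refine add_le_add ((hmass u q hu hq).trans (ENNReal.ofReal_le_ofReal ?_)) hvol
          have : Dq q u ≤ 2 * E0 n := by nlinarith
          gcongr
      _ = _ := (ENNReal.ofReal_add (by positivity) hV.le).symm
  obtain ⟨j, hj, hjm⟩ := pigeon x0 hF hm hL1 hr0 hUF hJ
  set r := (2 * L) ^ j * r0 with hr
  have hr0' : 0 < r := by positivity
  have hrr : r0 ≤ r := by rw [hr]; exact le_mul_of_one_le_left hr0.le (one_le_pow₀ hL1.le)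
  obtain ⟨b1, b2⟩ := hstep u ε x0 r hε hε' hq hu hr0' hUF hjm
  have t1 := (hcut u (fun x => 1 - chi x0 r x) q hu hq (contDiff_const.sub (chi_smooth x0 r)) (fun x => by linarith [chi_le x0 r x]) (fun x => by linarith [chi_nonneg x0 r x])).2
  have t2 := (hcut u (chi x0 (L * r)) q hu hq (chi_smooth x0 _) (chi_nonneg x0 _) (chi_le x0 _)).2
  have hX1 : 0 ≤ Xe q u (fun x => 1 - chi x0 r x) := Xe_nonneg hu0
  have hX2 : 0 ≤ Xe q u (chi x0 (L * r)) := Xe_nonneg hu0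
  set X1 := Xe q u (fun x => 1 - chi x0 r x)
  set X2 := Xe q u (chi x0 (L * r))
  have hexp : ∀ {t : ℝ}, 0 ≤ t → (t ^ (2 / sob n)) ^ (sob n / 2) = t := fun h => by
    rw [← rpow_mul h, show 2 / sob n * (sob n / 2) = 1 by field_simp, rpow_one]
  rw [E0_scale hn hX1, E0_scale hn hX2] at b1
  have y2 := hdi (Dq q u / E0 n) (X1 / E0 n) (X2 / E0 n) (by positivity) (by positivity)
    (by rw [div_le_iff₀ hE]; linarith) (by rw [← add_div, div_le_iff₀ hE, add_mul, div_mul_cancel₀ _ hE.ne']; exact b2)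
    (by rw [div_le_iff₀ hE]; linarith) ?_
  · rw [div_le_div_iff_of_pos_right hE] at y2
    have y3 : Cs * X2 ^ (sob n / 2) ≤ δ := by
      have := rpow_le_rpow hX2 y2 (by positivity : 0 ≤ sob n / 2)
      rw [hexp (by positivity), le_div_iff₀ hCs] at this; linarith
    refine le_trans ?_ (t2.trans (ENNReal.ofReal_le_ofReal y3))
    rw [← lintegral_indicator (measurableSet_lt measurable_const (by fun_prop : Measurable fun x : Eu n => ‖x - x0‖))]
    refine lintegral_mono (Set.indicator_le fun x hx => ?_)
    have h1 : (2 * L) ^ J * r0 < ‖x - x0‖ := hx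
    have h2 : (2 * L) ^ (j + 1) * r0 ≤ (2 * L) ^ J * r0 := by gcongr; exacts [hL1.le, hj]
    rw [chi_one (by positivity) (by rw [pow_succ] at h2; rw [hr]; linarith), one_mul]
  · rw [div_le_div_iff_of_pos_right hE]
    have h1 : oR c0 ≤ oR (Cs * X1 ^ (sob n / 2)) := by
      refine (hc.trans ?_).trans t1
      rw [← lintegral_indicator measurableSet_ball]
      refine lintegral_mono (Set.indicator_le fun x hx => ?_)
      rw [mem_ball, dist_eq_norm] at hx
      rw [chi_zero hr0' (by linarith), sub_zero, one_mul]
    rw [ENNReal.ofReal_le_ofReal_iff (by positivity)] at h1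
    rw [← rpow_le_rpow_iff (by positivity) hX1 (by positivity : 0 < sob n / 2), hexp (by positivity), div_le_iff₀ hCs]
    linarith
lemma Dq_eventually (hn : 3 ≤ n) {u : ℝ → Eu n → ℝ} {Ω : Set (Eu n)} {ε1 : ℝ} (hε1 : 0 < ε1) (hp1 : ∀ ε ∈ Set.Ioo 0 ε1, 1 < pcrit n - ε)
    (hu : ∀ ε ∈ Set.Ioo 0 ε1, PS (u ε) (pcrit n - ε) ∧ ∀ x, 0 < u ε x ↔ x ∈ Ω)
    (ht : Tendsto (fun ε => enRatio Ω (pcrit n - ε) (u ε)) (𝓝[>] (0:ℝ)) (𝓝 (CHLS n))) :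
    Tendsto (fun ε => Dq (pcrit n - ε) (u ε)) (𝓝[>] (0:ℝ)) (𝓝 (E0 n)) := by
  have hp := p_gt hn
  have h0 : Tendsto (fun ε : ℝ => pcrit n - ε) (𝓝[>] (0:ℝ)) (𝓝 (pcrit n)) := by
    have : Tendsto (fun ε : ℝ => pcrit n - ε) (𝓝 (0:ℝ)) (𝓝 (pcrit n - 0)) := (continuous_const.sub continuous_id).tendsto 0
    rw [sub_zero] at this
    exact this.mono_left nhdsWithin_le_nhds
  have h1 : Tendsto (fun ε : ℝ => (1 - 1 / (pcrit n - ε))⁻¹) (𝓝[>] (0:ℝ)) (𝓝 (1 - 1 / pcrit n)⁻¹) := by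
    refine (tendsto_const_nhds.sub (tendsto_const_nhds.div h0 (by linarith))).inv₀ ?_
    have : 1 / pcrit n < 1 := by rw [div_lt_one (by linarith)]; exact hp
    linarith
  refine (ht.rpow h1 (Or.inl (CHLS_pos hn).ne')).congr' ?_
  filter_upwards [Ioo_mem_nhdsGT hε1] with ε hε
  obtain ⟨h2, h3⟩ := hu ε hε
  have hq := hp1 ε hε
  have hΩ : Ω = {x | 0 < u ε x} := by ext x; exact (h3 x).symm
  have : 1 / (pcrit n - ε) < 1 := by rw [div_lt_one (by linarith)]; exact hq
  rw [hΩ, h2.enRatio hn hq, ← rpow_mul (Dq_nonneg h2.nonneg), mul_inv_cancel₀ (by linarith), rpow_one]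
def vs (l a : ℝ) (x0 : Eu n) (u : Eu n → ℝ) (x : Eu n) : ℝ := l ^ (-a) * u (x0 + l⁻¹ • x)
lemma lint_aff {f : Eu n → ENNReal} (hf : Measurable f) {l : ℝ} (hl : 0 < l) (x0 : Eu n) :
    ∫⁻ x, f (x0 + l⁻¹ • x) = oR (l ^ n) * ∫⁻ x, f x := by
  have h1 : ∫⁻ x, f (x0 + l⁻¹ • x) = ∫⁻ y, f (x0 + y) ∂(Measure.map (l⁻¹ • ·) volume) := by
    rw [lintegral_map (by fun_prop) (by fun_prop)]
  rw [h1, Measure.map_addHaar_smul _ (by positivity), lintegral_smul_measure, finrank_euclideanSpace_fin,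
    lintegral_add_left_eq_self f x0, inv_pow, inv_inv, abs_of_pos (by positivity), smul_eq_mul]
lemma vs_set {u : Eu n → ℝ} (hu : Measurable u) (h0 : ∀ x, 0 ≤ u x) {l a s : ℝ} (hl : 0 < l) (x0 : Eu n)
    {S T : Set (Eu n)} (hS : MeasurableSet S) (hT : MeasurableSet T) (hST : ∀ x, x ∈ T ↔ x0 + l⁻¹ • x ∈ S) :
    ∫⁻ x in T, oR (vs l a x0 u x ^ s) =
      oR (l ^ ((n:ℝ) - s * a)) * ∫⁻ y in S, oR (u y ^ s) := by
  rw [← lintegral_indicator hS, ← lintegral_indicator hT]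
  have hm : Measurable (S.indicator fun y => oR (u y ^ s)) := Measurable.indicator (by fun_prop) hS
  have e : ∀ x, T.indicator (fun x => oR (vs l a x0 u x ^ s)) x =
      oR (l ^ (- (s * a))) * S.indicator (fun y => oR (u y ^ s)) (x0 + l⁻¹ • x) := by
    intro x
    by_cases h : x ∈ T
    · rw [Set.indicator_of_mem h, Set.indicator_of_mem ((hST x).1 h), ← ENNReal.ofReal_mul (by positivity)]
      unfold vs
      rw [Real.mul_rpow (by positivity) (h0 _), ← rpow_mul hl.le]; congr 3; ring
    · rw [Set.indicator_of_notMem h, Set.indicator_of_notMem fun hh => h ((hST x).2 hh), mul_zero]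
  simp only [e]
  rw [lintegral_const_mul _ (by fun_prop), lint_aff hm hl, ← mul_assoc, ← ENNReal.ofReal_mul (by positivity), ← rpow_natCast l n, ← rpow_add hl]
  congr 3; ring
lemma NN_vs {u : Eu n → ℝ} (hu : Measurable u) (h0 : ∀ x, 0 ≤ u x) {l a q : ℝ} (hl : 0 < l) (ha : a * (q - 1) = 2) (x0 x : Eu n) :
    NN (fun z => oR (vs l a x0 u z ^ q)) x = oR (l ^ (-a)) * NN (fun z => oR (u z ^ q)) (x0 + l⁻¹ • x) := by
  unfold NN
  have e : ∀ z, oR (vs l a x0 u z ^ q) * oR (‖x - z‖ ^ (-((n:ℝ) - 2))) =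
      oR (l ^ (-(a * q) - ((n:ℝ) - 2))) * (fun ζ => oR (u ζ ^ q) * oR (‖x0 + l⁻¹ • x - ζ‖ ^ (-((n:ℝ) - 2)))) (x0 + l⁻¹ • z) := by
    intro z
    have h1 : x0 + l⁻¹ • x - (x0 + l⁻¹ • z) = l⁻¹ • (x - z) := by rw [smul_sub]; abel
    have h2 := h0 (x0 + l⁻¹ • z)
    have h3 : 0 ≤ vs l a x0 u z := by unfold vs; positivity
    simp only
    rw [h1, norm_smul, Real.norm_of_nonneg (by positivity), Real.mul_rpow (by positivity) (norm_nonneg _), ← ENNReal.ofReal_mul (by positivity), ← ENNReal.ofReal_mul (by positivity), ← ENNReal.ofReal_mul (by positivity)]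
    unfold vs
    rw [Real.mul_rpow (by positivity) h2, ← rpow_mul hl.le, Real.inv_rpow hl.le, ← rpow_neg hl.le, neg_neg, rpow_sub hl, neg_mul]
    have : 0 < l ^ ((n:ℝ) - 2) := by positivity
    congr 1
    field_simp
  have hm : Measurable (fun ζ => oR (u ζ ^ q) * oR (‖x0 + l⁻¹ • x - ζ‖ ^ (-((n:ℝ) - 2)))) := by fun_prop
  rw [lintegral_congr e, lintegral_const_mul _ (by fun_prop), lint_aff hm hl, ← mul_assoc, ← ENNReal.ofReal_mul (by positivity), ← rpow_natCast l n, ← rpow_add hl]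
  congr 3; linarith
lemma PS.scale {u : Eu n → ℝ} {q : ℝ} (h : PS u q) {l a : ℝ} (hl : 0 < l) (ha : a * (q - 1) = 2) (x0 : Eu n) : PS (vs l a x0 u) q := by
  have hla : 0 < l ^ (-a) := by positivity
  have hli : l⁻¹ ≠ 0 := by positivity
  have hpos : ∀ x, 0 < vs l a x0 u x ↔ 0 < u (x0 + l⁻¹ • x) := fun x => mul_pos_iff_of_pos_left hla
  have hc := h.cont
  have aff : ∀ x, 0 < u (x0 + l⁻¹ • x) → ContDiffAt ℝ 2 (fun x => u (x0 + l⁻¹ • x)) x := fun x hx =>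
    ContDiffAt.comp x (g := u) (h.c2 _ hx) (by fun_prop : ContDiff ℝ 2 fun x : Eu n => x0 + l⁻¹ • x).contDiffAt
  refine ⟨by unfold vs; fun_prop, ?_, fun x => mul_nonneg hla.le (h.nonneg _), fun x hx => ?_, fun x hx => ?_⟩
  · have : HasCompactSupport fun x => u (x0 + l⁻¹ • x) :=
      h.cs.comp_homeomorph ((Homeomorph.smulOfNeZero l⁻¹ hli).trans (Homeomorph.addLeft x0))
    exact this.mul_left
  · exact contDiffAt_const.mul (aff x ((hpos x).1 hx))
  · have hx' := (hpos x).1 hx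
    have e1 : lapl (vs l a x0 u) x = l ^ (-a) * lapl (fun x => u (x0 + l⁻¹ • x)) x := by
      have : ∀ᶠ y in 𝓝 x, fderiv ℝ (vs l a x0 u) y = l ^ (-a) • fderiv ℝ (fun x => u (x0 + l⁻¹ • x)) y := by
        filter_upwards [(aff x hx').eventually (by simp)] with y hy
        exact fderiv_const_mul (hy.differentiableAt (by simp)) _
      unfold lapl
      rw [Finset.mul_sum]
      refine Finset.sum_congr rfl fun i _ => ?_
      have h2 : (fun y => fderiv ℝ (vs l a x0 u) y (EuclideanSpace.single i 1)) =ᶠ[𝓝 x] fun y => l ^ (-a) * fderiv ℝ (fun x => u (x0 + l⁻¹ • x)) y (EuclideanSpace.single i 1) := by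
        filter_upwards [this] with y hy
        rw [hy]; rfl
      rw [h2.fderiv_eq]
      have h3 : DifferentiableAt ℝ (fun y => fderiv ℝ (fun x => u (x0 + l⁻¹ • x)) y (EuclideanSpace.single i 1)) x :=
        (((aff x hx').fderiv_right (m := 1) (by norm_num)).differentiableAt (by simp)).clm_apply (differentiableAt_const _)
      rw [fderiv_const_mul h3]; rfl
    rw [e1, lapl_aff x0 l⁻¹ x (h.c2 _ hx')]
    have e2 := h.eqn _ hx'
    have e3 : Np (fun z => vs l a x0 u z ^ q) x = l ^ (-a) * Np (fun z => u z ^ q) (x0 + l⁻¹ • x) := by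
      unfold Np
      rw [NN_vs hc.measurable h.nonneg hl ha, ENNReal.toReal_mul, ENNReal.toReal_ofReal hla.le]
    have e4 : vs l a x0 u x ^ (q - 1) = l⁻¹ ^ 2 * u (x0 + l⁻¹ • x) ^ (q - 1) := by
      unfold vs
      rw [Real.mul_rpow hla.le hx'.le, ← rpow_mul hl.le, neg_mul, ha, rpow_neg hl.le, inv_pow]
      congr 2; exact_mod_cast rpow_natCast l 2
    rw [e3, e4]
    linear_combination l ^ (-a) * l⁻¹ ^ 2 * e2
structure Hy (n : ℕ) (M V : ℝ) (u : Eu n → ℝ) (ε l a : ℝ) (x0 : Eu n) : Prop where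
  e0 : 0 < ε
  q1 : 1 < pcrit n - ε
  ps : PS u (pcrit n - ε)
  l1 : 1 ≤ l
  ha : a * (pcrit n - ε - 1) = 2
  le : ∀ y, u y ≤ l ^ a
  eq : u x0 = l ^ a
  mass : ∫⁻ z, oR (u z ^ sob n) ≤ oR M
  vol : volume {x | 0 < u x} ≤ oR V
lemma Hy.a_ge (hn : 3 ≤ n) {M V : ℝ} {u : Eu n → ℝ} {ε l a : ℝ} {x0 : Eu n} (h : Hy n M V u ε l a x0) :
    2 * ε / (pcrit n - 1) ^ 2 ≤ a - ((n:ℝ) - 2) / 2 := by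
  have h1 := al_p1 hn
  have h2 := h.ha
  have h3 := h.q1
  have h4 := h.e0
  have e : a - ((n:ℝ) - 2) / 2 = 2 * ε / ((pcrit n - ε - 1) * (pcrit n - 1)) := by
    rw [eq_div_iff (by apply mul_ne_zero <;> linarith)]
    linear_combination (pcrit n - 1) * h2 - (pcrit n - ε - 1) / 2 * h1
  rw [e]
  have : 0 < pcrit n - ε - 1 := by linarith
  rw [sq]
  have h5 : 0 < pcrit n - 1 := by linarith
  exact div_le_div_of_nonneg_left (by linarith) (by positivity) (mul_le_mul_of_nonneg_right (by linarith) h5.le)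
lemma exists_NNv (hn : 3 ≤ n) {M V : ℝ} (hM : 0 < M) (hV : 0 < V) : ∃ K > 0, ∀ (u : Eu n → ℝ) (ε l a : ℝ) (x0 : Eu n), Hy n M V u ε l a x0 →
    ∀ x, NN (fun z => oR (vs l a x0 u z ^ (pcrit n - ε))) x ≤ oR K := by
  have hs := sob_pos hn
  have hp := p_gt hn
  obtain ⟨C, hC, hNN⟩ := exists_NN_le hn
  refine ⟨C * (1 + (M + V + 1)), by positivity, fun u ε l a x0 h x => ?_⟩
  have hage := h.a_ge hn
  obtain ⟨hε, hq, hu, hl, ha, hle, heq, hmass, hvol⟩ := h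
  have hage' : 0 ≤ a - ((n:ℝ) - 2) / 2 := le_trans (by positivity) hage
  set q := pcrit n - ε with hqd
  have hl0 : 0 < l := by linarith
  have hum := hu.cont.measurable
  have hset : MeasurableSet {x | 0 < u x} := measurableSet_lt measurable_const hum
  have k := hNN (fun z => u z ^ (q / pcrit n)) (x0 + l⁻¹ • x) l⁻¹ (M + V) (l ^ (a * q / pcrit n)) (by positivity) (by positivity) (by positivity)
    (fun z => rpow_nonneg (hu.nonneg z) _) (by fun_prop) ?_ ?_
  · have e1 : ∀ z, (u z ^ (q / pcrit n)) ^ pcrit n = u z ^ q := fun z => by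
      rw [← rpow_mul (hu.nonneg z)]; congr 1; field_simp
    simp only [e1] at k
    rw [NN_vs hum hu.nonneg hl0 ha]
    refine (mul_le_mul_right k _).trans ?_
    rw [← ENNReal.ofReal_mul (by positivity)]
    apply ENNReal.ofReal_le_ofReal
    have e2 : l ^ (-a) * ((l ^ (a * q / pcrit n)) ^ pcrit n * l⁻¹ ^ 2) = 1 := by
      rw [← rpow_mul hl0.le, inv_pow, ← rpow_natCast l 2, ← rpow_neg hl0.le, ← rpow_add hl0, ← rpow_add hl0, div_mul_cancel₀ _ (by linarith)]
      rw [show -a + (a * q + -((2:ℕ):ℝ)) = 0 by push_cast; linarith, rpow_zero]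
    have e3 : l ^ (-a) * l⁻¹ ^ (-(((n:ℝ) - 2) / 2)) ≤ 1 := by
      rw [Real.inv_rpow hl0.le, ← rpow_neg hl0.le, ← rpow_add hl0]
      exact rpow_le_one_of_one_le_of_nonpos hl (by linarith)
    calc _ = C * (l ^ (-a) * ((l ^ (a * q / pcrit n)) ^ pcrit n * l⁻¹ ^ 2) + (M + V + 1) * (l ^ (-a) * l⁻¹ ^ (-(((n:ℝ) - 2) / 2)))) := by ring
      _ ≤ C * (1 + (M + V + 1) * 1) := by rw [e2]; gcongr
      _ = _ := by ring
  · calc _ ≤ ∫⁻ x, (oR (u x ^ sob n) + {x | 0 < u x}.indicator (fun _ => (1:ENNReal)) x) := by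
          refine lintegral_mono fun z => ?_
          have h0 := hu.nonneg z
          simp only
          rw [← rpow_mul h0]
          have hqs : 0 < q / pcrit n * sob n := by positivity
          by_cases h : 0 < u z
          · rw [Set.indicator_of_mem (show z ∈ {x | 0 < u x} from h), ← ENNReal.ofReal_one, ← ENNReal.ofReal_add (by positivity) zero_le_one]
            apply ENNReal.ofReal_le_ofReal
            have h3 : 0 ≤ u z ^ sob n := by positivity
            rcases le_total (u z) 1 with h2 | h2
            · have := rpow_le_one h0 h2 hqs.le; linarith
            · have : u z ^ (q / pcrit n * sob n) ≤ u z ^ sob n := rpow_le_rpow_of_exponent_le h2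
                (mul_le_of_le_one_left hs.le (by rw [div_le_one (by linarith)]; linarith))
              linarith
          · have : u z = 0 := by linarith
            rw [this, Real.zero_rpow hqs.ne']; simp
      _ = (∫⁻ x, oR (u x ^ sob n)) + volume {x | 0 < u x} := by
          rw [lintegral_add_left (by fun_prop), lintegral_indicator_const hset, one_mul]
      _ ≤ _ := by rw [ENNReal.ofReal_add hM.le hV.le]; exact add_le_add hmass hvol
  · intro z _
    rw [mul_div_assoc, rpow_mul hl0.le]
    exact rpow_le_rpow (hu.nonneg z) (hle z) (by positivity)
lemma Hy.vs_le {M V : ℝ} {u : Eu n → ℝ} {ε l a : ℝ} {x0 : Eu n} (h : Hy n M V u ε l a x0) (x : Eu n) : vs l a x0 u x ≤ 1 := by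
  have hl0 : 0 < l := by linarith [h.l1]
  unfold vs
  rw [rpow_neg hl0.le, inv_mul_le_iff₀ (by positivity), mul_one]; exact h.le _
lemma Hy.pow_le (hn : 3 ≤ n) {M V : ℝ} {u : Eu n → ℝ} {ε l a : ℝ} {x0 : Eu n} (h : Hy n M V u ε l a x0) : l ^ ((n:ℝ) - sob n * a) ≤ 1 := by
  have h1 := h.a_ge hn
  have h2 : 0 ≤ 2 * ε / (pcrit n - 1) ^ 2 := by have := h.e0; positivity
  have h3 := al_sob hn
  have h4 := mul_le_mul_of_nonneg_left (h2.trans h1) (sob_pos hn).le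
  exact rpow_le_one_of_one_le_of_nonpos h.l1 (by linarith)
lemma exists_low (hn : 3 ≤ n) {M V : ℝ} (hM : 0 < M) (hV : 0 < V) : ∃ c ρ Λ : ℝ, 0 < c ∧ 0 < ρ ∧ 1 ≤ Λ ∧
    ∀ (u : Eu n → ℝ) (ε l a : ℝ) (x0 : Eu n), Hy n M V u ε l a x0 →
    oR c ≤ ∫⁻ y in ball x0 (l⁻¹ * ρ), oR (u y ^ sob n) ∧ l ^ ε ≤ Λ := by
  have hs := sob_pos hn
  have hp := p_gt hn
  obtain ⟨K, hK, hNN⟩ := exists_NNv hn hM hV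
  obtain ⟨C, hC, hmv⟩ := exists_mv hn
  obtain ⟨ρ, hρ, -, hρ'⟩ := ex_small (c := C * K) (κ := 1 / 4) (γ := 2) (by positivity) (by norm_num) two_pos
  have hρ2 := hρ' ρ hρ.le le_rfl
  rw [show ρ ^ (2:ℝ) = ρ ^ 2 from by exact_mod_cast rpow_natCast ρ 2] at hρ2
  set b := C * ((1/4:ℝ) ^ (1 - sob n) * ρ ^ (-(n:ℝ))) with hb
  have hb0 : 0 < b := by positivity
  set c := 1 / (4 * b) with hc
  have hc0 : 0 < c := by positivity
  set γ := sob n * (2 / (pcrit n - 1) ^ 2) with hγ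
  have hγ0 : 0 < γ := by have : 0 < pcrit n - 1 := by linarith
                         positivity
  refine ⟨c, ρ, max 1 ((M / c) ^ γ⁻¹), hc0, hρ, le_max_left _ _, fun u ε l a x0 h => ?_⟩
  have hage := h.a_ge hn
  have hvle := h.vs_le
  have hpl := h.pow_le hn
  have hNN' := hNN u ε l a x0 h
  obtain ⟨hε, hq, hu, hl, ha, hle, heq, hmass, hvol⟩ := h
  have hl0 : 0 < l := by linarith
  have hv := hu.scale hl0 ha x0
  set v := vs l a x0 u with hvd
  have hv0 : v 0 = 1 := by
    simp only [hvd, vs]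
    rw [smul_zero, add_zero, heq, ← rpow_add hl0]; simp
  have hsc : ∫⁻ x in ball 0 ρ, oR (v x ^ sob n) = oR (l ^ ((n:ℝ) - sob n * a)) * ∫⁻ y in ball x0 (l⁻¹ * ρ), oR (u y ^ sob n) := by
    refine vs_set hu.cont.measurable hu.nonneg hl0 x0 measurableSet_ball measurableSet_ball fun x => ?_
    rw [mem_ball, mem_ball, dist_eq_norm, dist_eq_norm, add_sub_cancel_left, norm_smul, Real.norm_of_nonneg (by positivity), sub_zero, mul_lt_mul_iff_right₀ (by positivity)]
  have hlow : oR c ≤ ∫⁻ x in ball 0 ρ, oR (v x ^ sob n) := by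
    by_contra! hcon
    have := hmv v 0 ρ K (1/4) c hρ hK.le (by norm_num) hc0.le hv.cont hv.cs hv.nonneg hv.c2 ?_ hcon.le
    · rw [hv0] at this
      have e : C * ((1/4:ℝ) ^ (1 - sob n) * ρ ^ (-(n:ℝ)) * c + K * ρ ^ 2) = b * c + C * K * ρ ^ 2 := by rw [hb]; ring
      have e2 : b * c = 1 / 4 := by rw [hc]; field_simp
      rw [e, e2] at this
      linarith
    · intro y _ hy
      rw [hv.eqn y hy]
      have k1 : Np (fun z => v z ^ (pcrit n - ε)) y ≤ K := ENNReal.toReal_le_of_le_ofReal hK.le (hNN' y)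
      have k2 := rpow_le_one hy.le (hvle y) (by linarith : 0 ≤ pcrit n - ε - 1)
      exact (mul_le_of_le_one_right (Np_nonneg _ _) k2).trans k1
  rw [hsc] at hlow
  constructor
  · refine hlow.trans (mul_le_of_le_one_left' ?_)
    rw [← ENNReal.ofReal_one]; exact ENNReal.ofReal_le_ofReal hpl
  · have h1 := hlow.trans (mul_le_mul_right ((setLIntegral_le_lintegral _ _).trans hmass) _)
    rw [← ENNReal.ofReal_mul (by positivity), ENNReal.ofReal_le_ofReal_iff (by positivity)] at h1
    have h2 : l ^ (ε * γ) ≤ M / c := by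
      have h3 : l ^ (ε * γ) ≤ l ^ (-((n:ℝ) - sob n * a)) := by
        refine rpow_le_rpow_of_exponent_le hl ?_
        have h4 := mul_le_mul_of_nonneg_left hage hs.le
        have h5 := al_sob hn
        have h6 : ε * γ = sob n * (2 * ε / (pcrit n - 1) ^ 2) := by rw [hγ]; ring
        linarith
      refine h3.trans ?_
      rw [rpow_neg hl0.le, le_div_iff₀ hc0, inv_mul_le_iff₀ (by positivity)]; exact h1
    have h3 := rpow_le_rpow (by positivity) h2 (by positivity : 0 ≤ γ⁻¹)
    rw [← rpow_mul hl0.le, mul_assoc, mul_inv_cancel₀ hγ0.ne', mul_one] at h3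
    exact h3.trans (le_max_right _ _)
lemma Bb_mass (hn : 3 ≤ n) : ∃ C > 0, ∫⁻ x, oR (Bb n x ^ sob n) ≤ oR C := by
  have h3 := al_sob hn
  have hn0 : (3:ℝ) ≤ n := by exact_mod_cast hn
  have hi : Integrable (fun x : Eu n => (1 + ‖x‖ ^ 2) ^ (-(2 * (n:ℝ)) / 2)) :=
    integrable_rpow_neg_one_add_norm_sq (by rw [finrank_euclideanSpace_fin]; linarith)
  have e : ∀ x : Eu n, Bb n x ^ sob n = (1 + ‖x‖ ^ 2) ^ (-(2 * (n:ℝ)) / 2) := fun x => by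
    unfold Bb; rw [← rpow_mul (by positivity)]; congr 1; linarith
  have h0 : 0 ≤ ∫ x : Eu n, (1 + ‖x‖ ^ 2) ^ (-(2 * (n:ℝ)) / 2) := integral_nonneg fun x => by positivity
  refine ⟨(∫ x : Eu n, (1 + ‖x‖ ^ 2) ^ (-(2 * (n:ℝ)) / 2)) + 1, by linarith, ?_⟩
  simp only [e]
  rw [← ofReal_integral_eq_lintegral_ofReal hi (ae_of_all _ fun x => by positivity)]
  exact ENNReal.ofReal_le_ofReal (by linarith)
lemma exists_dec (hn : 3 ≤ n) {M V Λ d : ℝ} (hM : 0 < M) (hΛ : 1 ≤ Λ) (hd : 1 ≤ d) : ∃ C1 > 0, ∃ C2 > 0,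
    ∀ (u : Eu n → ℝ) (ε l a : ℝ) (x0 : Eu n), Hy n M V u ε l a x0 → ε ≤ 1 → l ^ ε ≤ Λ → (∀ y, 0 < u y → ‖y - x0‖ ≤ d) →
    Dec n C1 C2 (vs l a x0 u) := by
  have hs := sob_pos hn
  have hp := p_gt hn
  have hal := al_pos hn
  obtain ⟨B, hB, hBm⟩ := Bb_mass hn
  set α := ((n:ℝ) - 2) / 2 with hα
  have hα0 : 0 < α := by positivity
  set G := (2 * d ^ 2) ^ α * (Λ ^ 2) ^ α with hG
  have hd0 : 0 < d := by linarith
  have hΛ0 : 0 < Λ := by linarith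
  have hG0 : 0 < G := by positivity
  refine ⟨G * G, by positivity, M + B, by positivity, fun u ε l a x0 h hε1 hlΛ hsup => ?_⟩
  have hvle := h.vs_le
  have hpl := h.pow_le hn
  obtain ⟨hε, hq, hu, hl, ha, hle, heq, hmass, hvol⟩ := h
  have hl0 : 0 < l := by linarith
  have hv := hu.scale hl0 ha x0
  have hsc := vs_set (a := a) (s := sob n) hu.cont.measurable hu.nonneg hl0 x0 MeasurableSet.univ MeasurableSet.univ (fun x => by simp)
  have hnorm : ∀ z, 0 < vs l a x0 u z → ‖z‖ ≤ l * d := fun z hz => by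
    have h1 : 0 < u (x0 + l⁻¹ • z) := (mul_pos_iff_of_pos_left (by positivity : 0 < l ^ (-a))).1 hz
    have h2 := hsup _ h1
    rw [add_sub_cancel_left, norm_smul, Real.norm_of_nonneg (by positivity), inv_mul_le_iff₀ hl0] at h2
    exact h2
  set v := vs l a x0 u with hvd
  have hkey : ∀ z, 0 < v z → wm v z ^ (-ε) ≤ G := fun z hz => by
    have h1 := hnorm z hz
    have h2 : (2 * (l * d) ^ 2) ^ (-α) ≤ wm v z := by
      refine le_trans ?_ (le_max_right _ _)
      refine rpow_le_rpow_of_nonpos (by positivity) ?_ (by linarith)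
      have h3 : ‖z‖ ^ 2 ≤ (l * d) ^ 2 := by gcongr
      have h4 : 1 ≤ (l * d) ^ 2 := one_le_pow₀ (by nlinarith)
      linarith
    calc wm v z ^ (-ε) ≤ ((2 * (l * d) ^ 2) ^ (-α)) ^ (-ε) := rpow_le_rpow_of_nonpos (by positivity) h2 (by linarith)
      _ = ((2 * d ^ 2) ^ ε) ^ α * ((l ^ ε) ^ 2) ^ α := by
        rw [← rpow_natCast (l ^ ε) 2, ← rpow_mul hl0.le ε, mul_comm ε, rpow_mul hl0.le, rpow_natCast, ← rpow_mul (by positivity), ← rpow_mul (by positivity), ← rpow_mul (by positivity), ← Real.mul_rpow (by positivity) (by positivity)]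
        congr 1 <;> ring
      _ ≤ G := by
        have : (2 * d ^ 2) ^ ε ≤ 2 * d ^ 2 := by
          conv_rhs => rw [← rpow_one (2 * d ^ 2)]
          exact rpow_le_rpow_of_exponent_le (by nlinarith) hε1
        rw [hG]; gcongr
  have hkey2 : ∀ z t, 0 < t → v z ^ t ≤ G * wm v z ^ (t + ε) := fun z t ht => by
    have hw := wm_pos v z
    rcases (hv.nonneg z).eq_or_lt with h0 | h0
    · rw [← h0, Real.zero_rpow ht.ne']; positivity
    · calc v z ^ t ≤ wm v z ^ t := rpow_le_rpow h0.le (le_max_left _ _) ht.le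
        _ = wm v z ^ (-ε) * wm v z ^ (t + ε) := by rw [← rpow_add hw]; congr 1; ring
        _ ≤ _ := by gcongr; exact hkey z h0
  refine ⟨hv.cont, hv.cs, hv.nonneg, hvle, hv.c2, fun x hx Φ hΦ hN => ?_, ?_⟩
  · rw [hv.eqn x hx]
    have k1 : NN (fun z => oR (v z ^ (pcrit n - ε))) x ≤ oR (G * Φ) := by
      have hwm := wm_meas hv.cont
      calc _ ≤ NN (fun z => oR G * oR (wm v z ^ pcrit n)) x := by
            refine NN_mono (fun z => ?_) x
            rw [← ENNReal.ofReal_mul hG0.le]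
            apply ENNReal.ofReal_le_ofReal
            have := hkey2 z (pcrit n - ε) (by linarith)
            rwa [sub_add_cancel] at this
        _ = oR G * NN (fun z => oR (wm v z ^ pcrit n)) x := NN_const_mul _ (by fun_prop) x
        _ ≤ _ := by rw [ENNReal.ofReal_mul hG0.le]; gcongr
    have k2 : Np (fun z => v z ^ (pcrit n - ε)) x ≤ G * Φ := ENNReal.toReal_le_of_le_ofReal (by positivity) k1
    have k3 := hkey2 x (pcrit n - ε - 1) (by linarith)
    rw [show pcrit n - ε - 1 + ε = pcrit n - 1 by ring] at k3
    calc _ ≤ (G * Φ) * (G * wm v x ^ (pcrit n - 1)) := mul_le_mul k2 k3 (rpow_nonneg (hv.nonneg x) _) (by positivity)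
      _ = _ := by ring
  · have hvm := hv.cont.measurable
    calc _ ≤ ∫⁻ x, (oR (v x ^ sob n) + oR (Bb n x ^ sob n)) := by
          refine lintegral_mono fun z => ?_
          simp only [wm]
          rcases le_total (v z) (Bb n z) with h | h
          · rw [max_eq_right h]; exact le_add_self
          · rw [max_eq_left h]; exact le_self_add
      _ = (∫⁻ x, oR (v x ^ sob n)) + ∫⁻ x, oR (Bb n x ^ sob n) := lintegral_add_left (by fun_prop) _
      _ ≤ _ := by
          rw [ENNReal.ofReal_add hM.le hB.le]
          refine add_le_add ?_ hBm
          rw [setLIntegral_univ, setLIntegral_univ] at hsc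
          rw [hsc]
          refine le_trans (mul_le_of_le_one_left' ?_) hmass
          rw [← ENNReal.ofReal_one]; exact ENNReal.ofReal_le_ofReal hpl
lemma exists_core (hn : 3 ≤ n) {M V d : ℝ} (hM : 0 < M) (hV : 0 < V) (hd : 1 ≤ d) : ∃ κ ε1 C : ℝ, 0 < κ ∧ 0 < ε1 ∧ 0 < C ∧
    ∀ (u : Eu n → ℝ) (ε l a : ℝ) (x0 : Eu n), Hy n M V u ε l a x0 → ε ≤ 1 → ε < ε1 → Dq (pcrit n - ε) u ≤ E0 n * (1 + κ) →
    (∀ y, 0 < u y → ‖y - x0‖ ≤ d) → ∀ x, vs l a x0 u x ≤ C * Bb n x := by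
  obtain ⟨c, ρ, Λ, hc, hρ, hΛ, hlow⟩ := exists_low hn hM hV
  obtain ⟨C1, hC1, C2, hC2, hdec⟩ := exists_dec (V := V) hn hM hΛ hd
  obtain ⟨δ, hδ, Rm, hRm, hD⟩ := exists_decay hn hC1 hC2
  obtain ⟨R, κ, ε1, hR, hκ, hε1, htail⟩ := exists_tail hn hc hδ hV
  obtain ⟨C, hC, hfin⟩ := hD (max Rm (R * ρ)) (le_max_left _ _)
  refine ⟨κ, ε1, C, hκ, hε1, hC, fun u ε l a x0 h h1 h2 hE hsup => ?_⟩
  obtain ⟨hl1, hl2⟩ := hlow u ε l a x0 h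
  have hl0 : 0 < l := by linarith [h.l1]
  refine hfin _ (hdec u ε l a x0 h h1 hl2 hsup) ?_
  have ht := htail u ε h.e0 h2 h.q1 h.ps h.vol hE x0 (l⁻¹ * ρ) (by positivity) hl1
  have hsc := vs_set (a := a) (s := sob n) (S := {x | R * (l⁻¹ * ρ) < ‖x - x0‖}) (T := {x | R * ρ < ‖x‖}) h.ps.cont.measurable h.ps.nonneg hl0 x0
    (measurableSet_lt (by fun_prop) (by fun_prop)) (measurableSet_lt (by fun_prop) (by fun_prop)) (fun x => by
      simp only [Set.mem_setOf_eq]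
      rw [add_sub_cancel_left, norm_smul, Real.norm_of_nonneg (by positivity), show R * (l⁻¹ * ρ) = l⁻¹ * (R * ρ) by ring, mul_lt_mul_iff_right₀ (by positivity)])
  have hsub : {x : Eu n | max Rm (R * ρ) < ‖x‖} ⊆ {x | R * ρ < ‖x‖} := fun x hx => by
    simp only [Set.mem_setOf_eq] at hx ⊢
    exact (le_max_right _ _).trans_lt hx
  refine (lintegral_mono_set hsub).trans ?_
  rw [hsc]
  refine le_trans (mul_le_of_le_one_left' ?_) ht
  rw [← ENNReal.ofReal_one]; exact ENNReal.ofReal_le_ofReal (h.pow_le hn)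
end aux

/-- uniform decay estimate for the rescaled least energy solutions:
`v_ε(x) ≤ c W(x)` on `ℝⁿ` with `c` independent of `ε`. -/
theorem statement_10 {n : ℕ} (hn : n = 3 ∨ n = 4 ∨ n = 5)
    (Ω : Set (Eu n)) (hΩo : IsOpen Ω) (hΩb : IsBounded Ω) (hΩne : Ω.Nonempty)
    (ε₀ : ℝ) (hε₀ : 0 < ε₀) (u : ℝ → Eu n → ℝ)
    (hfam : LeastEnergyFamily Ω ε₀ u)
    (xε : ℝ → Eu n) (lam : ℝ → ℝ)
    (hx : ∀ ε ∈ Set.Ioo (0:ℝ) ε₀, xε ε ∈ Ω ∧ u ε (xε ε) = supN Ω (u ε))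
    (hlam : ∀ ε ∈ Set.Ioo (0:ℝ) ε₀, 0 < lam ε ∧
      lam ε ^ (2 * ((n:ℝ) - 2) / (4 - ((n:ℝ) - 2) * ε)) = supN Ω (u ε)) :
    ∃ c > (0:ℝ), ∃ ε₁ ∈ Set.Ioc (0:ℝ) ε₀, ∀ ε ∈ Set.Ioo (0:ℝ) ε₁, ∀ x : Eu n,
      lam ε ^ (-(2 * ((n:ℝ) - 2) / (4 - ((n:ℝ) - 2) * ε))) *
          u ε ((lam ε)⁻¹ • x + xε ε) ≤ c * W0 n x := by
  have hn3 : 3 ≤ n := by omega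
  clear hn hΩne
  have hs := sob_pos hn3
  have hp := p_gt hn3
  have hal := al_pos hn3
  have hE := E0_pos hn3
  have hct := ctilde_pos hn3
  obtain ⟨Cs, hCs, hmass⟩ := PS.mass hn3
  obtain ⟨d0, hd0⟩ := hΩb.subset_closedBall 0
  set d := max 1 (2 * d0) with hdd
  have hd : 1 ≤ d := le_max_left _ _
  have hdiam : ∀ y ∈ Ω, ∀ z ∈ Ω, ‖y - z‖ ≤ d := fun y hy z hz => by
    have h1 := hd0 hy
    have h2 := hd0 hz
    rw [mem_closedBall_zero_iff] at h1 h2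
    have h3 : 2 * d0 ≤ d := le_max_right _ _
    linarith [norm_sub_le y z]
  have hvol : volume Ω ≤ ENNReal.ofReal ((volume Ω).toReal + 1) := by
    refine le_trans (ENNReal.ofReal_toReal hΩb.measure_lt_top.ne).ge (ENNReal.ofReal_le_ofReal (by linarith))
  obtain ⟨κ, ε1, C, hκ, hε1, hC, hcore⟩ := exists_core (M := Cs * (2 * E0 n) ^ (sob n / 2)) (V := (volume Ω).toReal + 1) (d := d) hn3
    (by positivity) (by positivity) hd
  set e2 := min ε₀ (min 1 (min ε1 (pcrit n - 1))) with he2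
  have he2p : 0 < e2 := by
    have : 0 < pcrit n - 1 := by linarith
    rw [he2]; positivity
  have b1 : e2 ≤ ε₀ := min_le_left _ _
  have b2 : e2 ≤ 1 := (min_le_right _ _).trans (min_le_left _ _)
  have b3 : e2 ≤ ε1 := (min_le_right _ _).trans ((min_le_right _ _).trans (min_le_left _ _))
  have b4 : e2 ≤ pcrit n - 1 := (min_le_right _ _).trans ((min_le_right _ _).trans (min_le_right _ _))
  have hp1 : ∀ ε ∈ Set.Ioo 0 e2, 1 < pcrit n - ε := fun ε hε => by linarith [hε.2]
  have hu : ∀ ε ∈ Set.Ioo 0 e2, PS (u ε) (pcrit n - ε) ∧ ∀ x, 0 < u ε x ↔ x ∈ Ω := fun ε hε =>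
    (hfam.1 ε ⟨hε.1, hε.2.trans_le b1⟩).ps hΩo hΩb (by linarith [hp1 ε hε])
  have hev := Dq_eventually hn3 he2p hp1 hu hfam.2
  have hlt : E0 n < min (2 * E0 n) (E0 n * (1 + κ)) := lt_min (by linarith) (by nlinarith)
  have hev2 := hev.eventually (gt_mem_nhds hlt)
  obtain ⟨e3, he3, hsub⟩ := mem_nhdsGT_iff_exists_Ioo_subset.1 hev2
  have he3 : 0 < e3 := he3
  set A := (1 + d ^ 2) ^ (((n:ℝ) - 2) / 2) with hA
  have hA0 : 0 < A := by positivity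
  refine ⟨(C + A) / ctilde n ((n:ℝ) - 2), by positivity, min e2 e3, ⟨by positivity, (min_le_left _ _).trans b1⟩, fun ε hε x => ?_⟩
  have hεe : ε ∈ Set.Ioo 0 e2 := ⟨hε.1, hε.2.trans_le (min_le_left _ _)⟩
  have hε0 : ε ∈ Set.Ioo 0 ε₀ := ⟨hε.1, hεe.2.trans_le b1⟩
  have hD : Dq (pcrit n - ε) (u ε) < min (2 * E0 n) (E0 n * (1 + κ)) := hsub ⟨hε.1, hε.2.trans_le (min_le_right _ _)⟩
  obtain ⟨hps, hpos⟩ := hu ε hεe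
  have hq := hp1 ε hεe
  obtain ⟨hx1, hx2⟩ := hx ε hε0
  obtain ⟨hl, hl2⟩ := hlam ε hε0
  have hW : (C + A) / ctilde n ((n:ℝ) - 2) * W0 n x = (C + A) * Bb n x := by
    unfold W0 Wb Bb
    rw [one_pow, one_mul, sub_zero, Real.div_rpow zero_le_one (by positivity), Real.one_rpow, Real.rpow_neg (by positivity)]
    field_simp
  rw [hW, add_comm _ (xε ε)]
  set a := 2 * ((n:ℝ) - 2) / (4 - ((n:ℝ) - 2) * ε) with had
  have ha : a * (pcrit n - ε - 1) = 2 := by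
    have h1 := al_p1 hn3
    have h2 : 4 - ((n:ℝ) - 2) * ε = ((n:ℝ) - 2) * (pcrit n - ε - 1) := by rw [← h1]; ring
    have h3 : 0 < pcrit n - ε - 1 := by linarith
    rw [had, h2]; field_simp
  have hB := Bb_pos x
  change vs (lam ε) a (xε ε) (u ε) x ≤ _
  have hle : ∀ y, u ε y ≤ lam ε ^ a := fun y => by
    rw [hl2]
    have hbd : BddAbove ((fun x => |u ε x|) '' closure Ω) :=
      (hΩb.isCompact_closure.image hps.cont.abs).bddAbove
    by_cases hy : y ∈ Ω
    · exact (le_abs_self _).trans (le_csSup hbd ⟨y, subset_closure hy, rfl⟩)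
    · have : ¬ 0 < u ε y := fun h => hy ((hpos y).1 h)
      rw [← hl2]
      have h3 : 0 < lam ε ^ a := by positivity
      linarith
  have hset : {x | 0 < u ε x} = Ω := Set.ext fun y => hpos y
  have hsupp : ∀ y, 0 < u ε y → ‖y - xε ε‖ ≤ d := fun y hy => hdiam y ((hpos y).1 hy) _ hx1
  rcases le_total 1 (lam ε) with h1 | h1
  · have hH : Hy n (Cs * (2 * E0 n) ^ (sob n / 2)) ((volume Ω).toReal + 1) (u ε) ε (lam ε) a (xε ε) := by
      refine ⟨hε.1, hq, hps, h1, ha, hle, hx2.trans hl2.symm, ?_, by rw [hset]; exact hvol⟩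
      refine (hmass _ _ hps hq).trans (ENNReal.ofReal_le_ofReal ?_)
      have h0 := Dq_nonneg (q := pcrit n - ε) hps.nonneg
      have h2 := (hD.trans_le (min_le_left _ _)).le
      gcongr
    have h2 := hcore (u ε) ε (lam ε) a (xε ε) hH (by linarith [hεe.2]) (by linarith [hεe.2]) (hD.trans_le (min_le_right _ _)).le hsupp x
    nlinarith
  · have hv := hps.scale hl ha (xε ε)
    rcases (hv.nonneg x).eq_or_lt with h0 | h0
    · rw [← h0]; positivity
    · have h2 : 0 < u ε (xε ε + (lam ε)⁻¹ • x) := (mul_pos_iff_of_pos_left (by positivity : 0 < lam ε ^ (-a))).1 h0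
      have h3 := hsupp _ h2
      rw [add_sub_cancel_left, norm_smul, Real.norm_of_nonneg (by positivity), inv_mul_le_iff₀ hl] at h3
      have h4 : ‖x‖ ≤ d := h3.trans (mul_le_of_le_one_left (by linarith) h1)
      have h5 : vs (lam ε) a (xε ε) (u ε) x ≤ 1 := by
        unfold vs
        rw [Real.rpow_neg hl.le, inv_mul_le_iff₀ (by positivity), mul_one]; exact hle _
      have h6 : 1 ≤ A * Bb n x := by
        unfold Bb
        rw [Real.rpow_neg (by positivity), ← div_eq_mul_inv, one_le_div (by positivity), hA]
        gcongr
      have h7 : 0 < C * Bb n x := by positivity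
      linarith
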